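/- Let d ≥ 3 and let Ω₁ ⊆ Ω₂ ⊂ ℝ^d be nonempty bounded convex open sets. Then μ₂(Ω₁) ≥ (π²/(j_{(d−2)/2,1} + j_{(d−2)/2,2})²)·μ₂(Ω₂), where j_{(d−2)/2,1} and j_{(d−2)/2,2} are the first and second positive zeros of the Bessel function J_{(d−2)/2}; in particular α_{2,d} ≥ π²/(j_{(d−2)/2,1} + j_{(d−2)/2,2})². -/

import Mathlib

open MeasureTheory Real Filter

noncomputable section

/-- Euclidean space `ℝ^d`. -/
abbrev Euc (d : ℕ) := EuclideanSpace ℝ (Fin d)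

/-- The Rayleigh quotient of a function `u` on a set `Ω ⊆ ℝ^d`. -/
noncomputable def rayleigh {d : ℕ} (Ω : Set (Euc d)) (u : Euc d → ℝ) : ℝ :=
  (∫ x in Ω, ‖fderiv ℝ u x‖ ^ 2) / (∫ x in Ω, (u x) ^ 2)

/-- The `k`-th Neumann eigenvalue of `Ω ⊆ ℝ^d`, defined by the variational (min-max)
principle: the infimum, over all subspaces `V` of smooth functions `ℝ^d → ℝ` whose space of
restrictions to `Ω` is `(k+1)`-dimensional, of the supremum of the Rayleigh quotient over
the elements of `V` that are nonzero in `L²(Ω)`. -/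
noncomputable def neumannEigenvalue {d : ℕ} (k : ℕ) (Ω : Set (Euc d)) : ℝ :=
  sInf { t : ℝ | ∃ V : Submodule ℝ (Euc d → ℝ),
    (∀ u ∈ V, ContDiff ℝ (⊤ : ℕ∞) u) ∧
    Module.finrank ℝ (V.map (LinearMap.funLeft ℝ ℝ ((↑) : Ω → Euc d))) = k + 1 ∧
    t = sSup { r : ℝ | ∃ u ∈ V, (0 < ∫ x in Ω, (u x) ^ 2) ∧ r = rayleigh Ω u } }

/-- A nonempty bounded convex open subset of `ℝ^d`. -/
def IsConvexDomain {d : ℕ} (Ω : Set (Euc d)) : Prop :=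
  Ω.Nonempty ∧ IsOpen Ω ∧ Bornology.IsBounded Ω ∧ Convex ℝ Ω

/-- The optimal constant `α_{k,d}`: the infimum of `μ_k(Ω₁)/μ_k(Ω₂)` over all pairs of
nonempty bounded convex open sets `Ω₁ ⊆ Ω₂ ⊂ ℝ^d`. -/
noncomputable def alphaConst (k d : ℕ) : ℝ :=
  sInf { r : ℝ | ∃ Ω₁ Ω₂ : Set (Euc d), IsConvexDomain Ω₁ ∧ IsConvexDomain Ω₂ ∧ Ω₁ ⊆ Ω₂ ∧
    r = neumannEigenvalue k Ω₁ / neumannEigenvalue k Ω₂ }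

/-- The Bessel function of the first kind of order `ν` (for `x > 0`). -/
noncomputable def besselJ (ν : ℝ) (x : ℝ) : ℝ :=
  ∑' m : ℕ, ((-1 : ℝ) ^ m / (m.factorial * Real.Gamma (m + ν + 1))) * (x / 2) ^ (2 * (m : ℝ) + ν)

/-- The first positive zero `j_{ν,1}` of the Bessel function `J_ν`. -/
noncomputable def besselZero1 (ν : ℝ) : ℝ :=
  sInf {x : ℝ | 0 < x ∧ besselJ ν x = 0}

/-- The second positive zero `j_{ν,2}` of the Bessel function `J_ν`. -/
noncomputable def besselZero2 (ν : ℝ) : ℝ :=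
  sInf {x : ℝ | besselZero1 ν < x ∧ besselJ ν x = 0}

section
open scoped Pointwise ENNReal

/-- One-dimensional Brunn-Minkowski for compact sets. -/
theorem bm_one_compact {A B : Set ℝ} (hA : IsCompact A) (hB : IsCompact B)
    (hA' : A.Nonempty) (hB' : B.Nonempty) :
    volume A + volume B ≤ volume (A + B) := by
  have ha := hA.sSup_mem hA'
  have hb := hB.sInf_mem hB'
  set a := sSup A
  set b := sInf B
  have h1 : (b +ᵥ A) ∪ (a +ᵥ B) ⊆ A + B := by
    rintro x (⟨y, hy, rfl⟩ | ⟨y, hy, rfl⟩)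
    · exact ⟨y, hy, b, hb, add_comm _ _⟩
    · exact ⟨a, ha, y, hy, rfl⟩
  have h2 : AEDisjoint volume (b +ᵥ A) (a +ᵥ B) := by
    refine measure_mono_null (t := {a + b}) ?_ (by simp)
    rintro x ⟨⟨y, hy, rfl⟩, ⟨z, hz, hzx⟩⟩
    have h3 : y ≤ a := le_csSup hA.bddAbove hy
    have h4 : b ≤ z := csInf_le hB.bddBelow hz
    simp only [vadd_eq_add] at hzx ⊢
    simp only [Set.mem_singleton_iff]
    linarith
  calc volume A + volume B = volume (b +ᵥ A) + volume (a +ᵥ B) := by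
        rw [measure_vadd, measure_vadd]
    _ = volume ((b +ᵥ A) ∪ (a +ᵥ B)) := by
        rw [measure_union₀ _ h2]
        exact (hB.vadd a).measurableSet.nullMeasurableSet
    _ ≤ _ := measure_mono h1

/-- One-dimensional Brunn-Minkowski, measurable version, with convex combination and superset. -/
theorem bm_one {A B C : Set ℝ} (hA : MeasurableSet A) (hB : MeasurableSet B)
    (hA' : A.Nonempty) (hB' : B.Nonempty) {s t : ℝ} (hs : 0 < s) (ht : 0 < t)
    (hC : ∀ x ∈ A, ∀ y ∈ B, s * x + t * y ∈ C) :
    ENNReal.ofReal s * volume A + ENNReal.ofReal t * volume B ≤ volume C := by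
  have key : ∀ K L : Set ℝ, IsCompact K → IsCompact L → K ⊆ A → L ⊆ B → K.Nonempty → L.Nonempty →
      ENNReal.ofReal s * volume K + ENNReal.ofReal t * volume L ≤ volume C := by
    intro K L hK hL hKA hLB hKn hLn
    have h1 := bm_one_compact (hK.smul s) (hL.smul t) (hKn.smul_set) (hLn.smul_set)
    rw [Measure.addHaar_smul, Measure.addHaar_smul] at h1
    simp only [Module.finrank_self, pow_one, abs_of_pos hs, abs_of_pos ht] at h1
    refine h1.trans (measure_mono ?_)
    rintro _ ⟨_, ⟨x, hx, rfl⟩, _, ⟨y, hy, rfl⟩, rfl⟩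
    exact hC x (hKA hx) y (hLB hy)
  have key2 : ∀ K L : Set ℝ, IsCompact K → IsCompact L → K ⊆ A → L ⊆ B →
      ENNReal.ofReal s * volume K + ENNReal.ofReal t * volume L ≤ volume C := by
    intro K L hK hL hKA hLB
    obtain ⟨a, ha⟩ := hA'
    obtain ⟨b, hb⟩ := hB'
    refine le_trans ?_ (key (insert a K) (insert b L) (hK.insert a) (hL.insert b)
      (Set.insert_subset ha hKA) (Set.insert_subset hb hLB) (by simp) (by simp))
    gcongr <;> simp
  rw [hA.measure_eq_iSup_isCompact, hB.measure_eq_iSup_isCompact]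
  simp only [ENNReal.mul_iSup]
  simp only [iSup_and']
  have e1 : (⨆ K, ⨆ (_ : K ⊆ A ∧ IsCompact K), ENNReal.ofReal s * volume K) =
    ⨆ K : {K : Set ℝ // K ⊆ A ∧ IsCompact K}, ENNReal.ofReal s * volume K.1 := by
    rw [iSup_subtype]
  have e2 : (⨆ K, ⨆ (_ : K ⊆ B ∧ IsCompact K), ENNReal.ofReal t * volume K) =
    ⨆ K : {K : Set ℝ // K ⊆ B ∧ IsCompact K}, ENNReal.ofReal t * volume K.1 := by
    rw [iSup_subtype]
  rw [e1, e2]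
  have : Nonempty {K : Set ℝ // K ⊆ A ∧ IsCompact K} := ⟨⟨∅, by simp⟩⟩
  have : Nonempty {K : Set ℝ // K ⊆ B ∧ IsCompact K} := ⟨⟨∅, by simp⟩⟩
  refine ENNReal.iSup_add_iSup_le ?_
  intro K L
  exact key2 K.1 L.1 K.2.2 L.2.2 K.2.1 L.2.1


/-- Prékopa–Leindler in dimension one, normalized. -/
theorem pl_one_norm {f g h : ℝ → ℝ} (hf : Measurable f) (hg : Measurable g) (hh : Measurable h)
    (f0 : ∀ x, 0 ≤ f x) (g0 : ∀ x, 0 ≤ g x) (h0 : ∀ x, 0 ≤ h x)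
    (f1 : ∀ x, f x ≤ 1) (g1 : ∀ x, g x ≤ 1)
    (fs : ∀ r < (1 : ℝ), ∃ x, r < f x) (gs : ∀ r < (1 : ℝ), ∃ x, r < g x)
    {s t : ℝ} (hs : 0 < s) (ht : 0 < t)
    (hfg : ∀ x y r, 0 < r → r < f x → r < g y → r < h (s * x + t * y)) :
    ENNReal.ofReal s * (∫⁻ x, ENNReal.ofReal (f x)) +
      ENNReal.ofReal t * (∫⁻ x, ENNReal.ofReal (g x)) ≤ ∫⁻ x, ENNReal.ofReal (h x) := by
  rw [lintegral_eq_lintegral_meas_lt volume (Eventually.of_forall f0) hf.aemeasurable,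
    lintegral_eq_lintegral_meas_lt volume (Eventually.of_forall g0) hg.aemeasurable,
    lintegral_eq_lintegral_meas_lt volume (Eventually.of_forall h0) hh.aemeasurable]
  have mf : Measurable fun r : ℝ => volume {a | r < f a} :=
    Antitone.measurable fun a b hab => measure_mono fun x hx => lt_of_le_of_lt hab hx
  have mg : Measurable fun r : ℝ => volume {a | r < g a} :=
    Antitone.measurable fun a b hab => measure_mono fun x hx => lt_of_le_of_lt hab hx
  rw [← lintegral_const_mul _ mf, ← lintegral_const_mul _ mg, ← lintegral_add_left (by fun_prop)]
  refine setLIntegral_mono' measurableSet_Ioi fun r hr => ?_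
  by_cases hr1 : r < 1
  · exact bm_one (measurableSet_lt measurable_const hf) (measurableSet_lt measurable_const hg)
      (fs r hr1) (gs r hr1) hs ht (fun x hx y hy => hfg x y r hr hx hy)
  · have e1 : {a | r < f a} = ∅ := by
      ext x; simp only [Set.mem_ofPred_eq, Set.mem_empty_iff_false, iff_false, not_lt]
      exact (f1 x).trans (not_lt.1 hr1)
    have e2 : {a | r < g a} = ∅ := by
      ext x; simp only [Set.mem_ofPred_eq, Set.mem_empty_iff_false, iff_false, not_lt]
      exact (g1 x).trans (not_lt.1 hr1)
    rw [e1, e2]; simp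

/-- weighted AM-GM in `ℝ≥0∞`. -/
theorem ennreal_geom_le_arith {s t : ℝ} (hs : 0 < s) (ht : 0 < t) (hst : s + t = 1) (a b : ℝ≥0∞) :
    a ^ s * b ^ t ≤ ENNReal.ofReal s * a + ENNReal.ofReal t * b := by
  by_cases ha : a = ⊤
  · subst ha
    rw [ENNReal.mul_top (by simpa using hs)]; simp
  by_cases hb : b = ⊤
  · subst hb
    rw [ENNReal.mul_top (by simpa using ht)]; simp
  lift a to NNReal using ha
  lift b to NNReal using hb
  have := NNReal.geom_mean_le_arith_mean2_weighted (s.toNNReal) (t.toNNReal) a b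
    (by rw [← Real.toNNReal_add hs.le ht.le, hst]; simp)
  rw [Real.coe_toNNReal _ hs.le, Real.coe_toNNReal _ ht.le] at this
  rw [← ENNReal.coe_rpow_of_nonneg _ hs.le, ← ENNReal.coe_rpow_of_nonneg _ ht.le]
  unfold ENNReal.ofReal
  exact_mod_cast this

theorem pl_one_bdd {f g h : ℝ → ℝ≥0∞} (hf : Measurable f) (hg : Measurable g) (hh : Measurable h)
    {k : ℝ≥0∞} (hk : k ≠ ⊤) (fk : ∀ x, f x ≤ k) (gk : ∀ x, g x ≤ k)
    {s t : ℝ} (hs : 0 < s) (ht : 0 < t) (hst : s + t = 1)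
    (hfg : ∀ x y, f x ^ s * g y ^ t ≤ h (s * x + t * y)) :
    (∫⁻ x, f x) ^ s * (∫⁻ x, g x) ^ t ≤ ∫⁻ x, h x := by
  set a := ⨆ x, f x with ha
  set b := ⨆ x, g x with hb
  have fa : ∀ x, f x ≤ a := fun x => le_iSup f x
  have gb : ∀ x, g x ≤ b := fun x => le_iSup g x
  by_cases a0 : a = 0
  · have : ∀ x, f x = 0 := fun x => le_antisymm (a0 ▸ fa x) bot_le
    simp [this, hs]
  by_cases b0 : b = 0
  · have : ∀ x, g x = 0 := fun x => le_antisymm (b0 ▸ gb x) bot_le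
    simp [this, ht]
  have atop : a ≠ ⊤ := ne_top_of_le_ne_top hk (iSup_le fk)
  have btop : b ≠ ⊤ := ne_top_of_le_ne_top hk (iSup_le gk)
  set c := a ^ s * b ^ t with hc
  have as0 : a ^ s ≠ 0 := (ENNReal.rpow_pos (pos_iff_ne_zero.2 a0) atop).ne'
  have bt0 : b ^ t ≠ 0 := (ENNReal.rpow_pos (pos_iff_ne_zero.2 b0) btop).ne'
  have ast : a ^ s ≠ ⊤ := ENNReal.rpow_ne_top_of_nonneg hs.le atop
  have btt : b ^ t ≠ ⊤ := ENNReal.rpow_ne_top_of_nonneg ht.le btop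
  have c0 : c ≠ 0 := mul_ne_zero as0 bt0
  have ctop : c ≠ ⊤ := ENNReal.mul_ne_top ast btt
  have main := pl_one_norm (f := fun x => (f x / a).toReal) (g := fun x => (g x / b).toReal)
    (h := fun x => (min (h x / c) 1).toReal) (by fun_prop) (by fun_prop) (by fun_prop)
    (fun x => by positivity) (fun x => by positivity) (fun x => by positivity)
    (fun x => ENNReal.toReal_le_of_le_ofReal zero_le_one (by
      simpa using ENNReal.div_le_of_le_mul (by simpa using fa x)))
    (fun x => ENNReal.toReal_le_of_le_ofReal zero_le_one (by
      simpa using ENNReal.div_le_of_le_mul (by simpa using gb x)))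
    ?_ ?_ hs ht ?_
  · have e1 : ∀ x, ENNReal.ofReal ((f x / a).toReal) = a⁻¹ * f x := fun x => by
      rw [ENNReal.ofReal_toReal (ENNReal.div_ne_top (ne_top_of_le_ne_top atop (fa x)) a0),
        ENNReal.div_eq_inv_mul]
    have e2 : ∀ x, ENNReal.ofReal ((g x / b).toReal) = b⁻¹ * g x := fun x => by
      rw [ENNReal.ofReal_toReal (ENNReal.div_ne_top (ne_top_of_le_ne_top btop (gb x)) b0),
        ENNReal.div_eq_inv_mul]
    have e3 : ∀ x, ENNReal.ofReal ((min (h x / c) 1).toReal) ≤ c⁻¹ * h x := fun x => by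
      rw [ENNReal.ofReal_toReal (by simp), ← ENNReal.div_eq_inv_mul]
      exact min_le_left _ _
    simp only [e1, e2] at main
    rw [lintegral_const_mul _ hf, lintegral_const_mul _ hg] at main
    have h2 := main.trans (lintegral_mono e3)
    rw [lintegral_const_mul _ hh] at h2
    have h3 := (ennreal_geom_le_arith hs ht hst _ _).trans h2
    rw [ENNReal.mul_rpow_of_nonneg _ _ hs.le, ENNReal.mul_rpow_of_nonneg _ _ ht.le] at h3
    have h4 : c * (a⁻¹ ^ s * b⁻¹ ^ t) = 1 := by
      rw [ENNReal.inv_rpow, ENNReal.inv_rpow, ← ENNReal.mul_inv, ENNReal.mul_inv_cancel c0 ctop]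
      · exact Or.inl as0
      · exact Or.inl ast
    calc (∫⁻ x, f x) ^ s * (∫⁻ x, g x) ^ t
        = c * (a⁻¹ ^ s * b⁻¹ ^ t) * ((∫⁻ x, f x) ^ s * (∫⁻ x, g x) ^ t) := by rw [h4, one_mul]
      _ = c * ((a⁻¹ ^ s * (∫⁻ x, f x) ^ s) * (b⁻¹ ^ t * (∫⁻ x, g x) ^ t)) := by ring
      _ ≤ c * (c⁻¹ * ∫⁻ x, h x) := by gcongr
      _ = _ := by rw [← mul_assoc, ENNReal.mul_inv_cancel c0 ctop, one_mul]
  · intro r hr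
    by_cases hr0 : r < 0
    · exact ⟨0, hr0.trans_le ENNReal.toReal_nonneg⟩
    have : ENNReal.ofReal r * a < a := by
      conv_rhs => rw [← one_mul a]
      exact ENNReal.mul_lt_mul_left a0 atop (by simpa using hr)
    obtain ⟨x, hx⟩ := lt_iSup_iff.1 this
    refine ⟨x, ?_⟩
    rw [← ENNReal.ofReal_lt_iff_lt_toReal (not_lt.1 hr0)
      (ENNReal.div_ne_top (ne_top_of_le_ne_top atop (fa x)) a0)]
    exact (ENNReal.lt_div_iff_mul_lt (Or.inl a0) (Or.inl atop)).2 hx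
  · intro r hr
    by_cases hr0 : r < 0
    · exact ⟨0, hr0.trans_le ENNReal.toReal_nonneg⟩
    have : ENNReal.ofReal r * b < b := by
      conv_rhs => rw [← one_mul b]
      exact ENNReal.mul_lt_mul_left b0 btop (by simpa using hr)
    obtain ⟨x, hx⟩ := lt_iSup_iff.1 this
    refine ⟨x, ?_⟩
    rw [← ENNReal.ofReal_lt_iff_lt_toReal (not_lt.1 hr0)
      (ENNReal.div_ne_top (ne_top_of_le_ne_top btop (gb x)) b0)]
    exact (ENNReal.lt_div_iff_mul_lt (Or.inl b0) (Or.inl btop)).2 hx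
  · intro x y r hr hx hy
    have ex := ENNReal.div_ne_top (ne_top_of_le_ne_top atop (fa x)) a0
    have ey := ENNReal.div_ne_top (ne_top_of_le_ne_top btop (gb y)) b0
    have fx1 : f x / a ≤ 1 := ENNReal.div_le_of_le_mul (by simpa using fa x)
    have gy1 : g y / b ≤ 1 := ENNReal.div_le_of_le_mul (by simpa using gb y)
    rw [← ENNReal.ofReal_lt_iff_lt_toReal hr.le ex] at hx
    rw [← ENNReal.ofReal_lt_iff_lt_toReal hr.le ey] at hy
    rw [← ENNReal.ofReal_lt_iff_lt_toReal hr.le (by simp)]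
    refine lt_min ?_ (hx.trans_le fx1)
    set R := ENNReal.ofReal r with hR
    have R0 : R ≠ 0 := by simpa [hR] using hr
    have h5 : R = R ^ s * R ^ t := by
      rw [← ENNReal.rpow_add _ _ R0 ENNReal.ofReal_ne_top, hst, ENNReal.rpow_one]
    rw [h5]
    have h6 : R ^ s * R ^ t < (f x / a) ^ s * (g y / b) ^ t :=
      ENNReal.mul_lt_mul (ENNReal.rpow_lt_rpow hx hs) (ENNReal.rpow_lt_rpow hy ht)
    refine h6.trans_le ?_
    rw [ENNReal.div_rpow_of_nonneg _ _ hs.le, ENNReal.div_rpow_of_nonneg _ _ ht.le]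
    rw [ENNReal.div_eq_inv_mul, ENNReal.div_eq_inv_mul, ENNReal.div_eq_inv_mul, hc, ENNReal.mul_inv]
    · calc _ = (a ^ s)⁻¹ * (b ^ t)⁻¹ * (f x ^ s * g y ^ t) := by ring
        _ ≤ _ := by gcongr; exact hfg x y
    · exact Or.inl as0
    · exact Or.inl ast

theorem pl_one {f g h : ℝ → ℝ≥0∞} (hf : Measurable f) (hg : Measurable g) (hh : Measurable h)
    {s t : ℝ} (hs : 0 < s) (ht : 0 < t) (hst : s + t = 1)
    (hfg : ∀ x y, f x ^ s * g y ^ t ≤ h (s * x + t * y)) :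
    (∫⁻ x, f x) ^ s * (∫⁻ x, g x) ^ t ≤ ∫⁻ x, h x := by
  by_cases f0 : ∫⁻ x, f x = 0
  · simp [f0, hs]
  by_cases g0 : ∫⁻ x, g x = 0
  · simp [g0, ht]
  have key : ∀ F : ℝ → ℝ≥0∞, Measurable F →
      Tendsto (fun k : ℕ => ∫⁻ x, min (F x) k) atTop (nhds (∫⁻ x, F x)) := by
    intro F hF
    refine lintegral_tendsto_of_tendsto_of_monotone (fun k => by fun_prop) ?_ ?_
    · refine Eventually.of_forall fun x i j hij => ?_
      exact min_le_min le_rfl (by exact_mod_cast hij)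
    · refine Eventually.of_forall fun x => ?_
      have := (tendsto_const_nhds (x := F x)).min ENNReal.tendsto_nat_nhds_top
      simpa using this
  have hlim := ENNReal.Tendsto.mul ((key f hf).ennrpow_const s) (Or.inl (by simp [ENNReal.rpow_eq_zero_iff, f0, hs, hs.le]))
    ((key g hg).ennrpow_const t) (Or.inl (by simp [ENNReal.rpow_eq_zero_iff, g0, ht, ht.le]))
  refine le_of_tendsto hlim (Eventually.of_forall fun k => ?_)
  refine pl_one_bdd (by fun_prop) (by fun_prop) hh (k := k) (by simp) (fun x => min_le_right _ _)
    (fun x => min_le_right _ _) hs ht hst (fun x y => le_trans ?_ (hfg x y))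
  gcongr <;> exact min_le_left _ _

/-- Prékopa–Leindler in dimension `n`. -/
theorem pl_pi (n : ℕ) {f g h : (Fin n → ℝ) → ℝ≥0∞} (hf : Measurable f) (hg : Measurable g)
    (hh : Measurable h) {s t : ℝ} (hs : 0 < s) (ht : 0 < t) (hst : s + t = 1)
    (hfg : ∀ x y, f x ^ s * g y ^ t ≤ h (s • x + t • y)) :
    (∫⁻ x, f x) ^ s * (∫⁻ x, g x) ^ t ≤ ∫⁻ x, h x := by
  induction n with
  | zero =>
    have : ∀ F : (Fin 0 → ℝ) → ℝ≥0∞, ∫⁻ x, F x = F default := by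
      intro F
      have hv : (volume : Measure (Fin 0 → ℝ)) Set.univ = 1 := by
        rw [volume_pi, ← Set.pi_univ Set.univ, Measure.pi_pi]; simp
      rw [lintegral_unique, hv, mul_one]
      exact congrArg F (Subsingleton.elim _ _)
    rw [this, this, this]
    have := hfg default default
    rwa [Subsingleton.elim (s • default + t • default) (default : Fin 0 → ℝ)] at this
  | succ n ih =>
    have key : ∀ F : (Fin (n + 1) → ℝ) → ℝ≥0∞, Measurable F →
        ∫⁻ x, F x = ∫⁻ r : ℝ, ∫⁻ y : Fin n → ℝ, F (Fin.cons r y) := by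
      intro F hF
      have e := (volume_preserving_piFinSuccAbove (fun _ : Fin (n + 1) => ℝ) 0).symm
      rw [← e.lintegral_comp hF]
      rw [Measure.volume_eq_prod, lintegral_prod]
      · simp [MeasurableEquiv.piFinSuccAbove, Fin.insertNthEquiv]
      · exact (hF.comp e.measurable).aemeasurable
    have mc : Measurable fun p : ℝ × (Fin n → ℝ) => (Fin.cons p.1 p.2 : Fin (n + 1) → ℝ) := by
      refine measurable_pi_iff.2 fun i => ?_
      refine Fin.cases ?_ (fun j => ?_) i
      · simpa using measurable_fst
      · simp only [Fin.cons_succ]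
        fun_prop
    rw [key f hf, key g hg, key h hh]
    have mi : ∀ F : (Fin (n + 1) → ℝ) → ℝ≥0∞, Measurable F →
        Measurable fun r : ℝ => ∫⁻ y : Fin n → ℝ, F (Fin.cons r y) := by
      intro F hF
      exact (hF.comp mc).lintegral_prod_right'
    refine pl_one (mi f hf) (mi g hg) (mi h hh) hs ht hst fun x y => ?_
    have mm : ∀ (F : (Fin (n + 1) → ℝ) → ℝ≥0∞), Measurable F → ∀ r : ℝ,
        Measurable fun y : Fin n → ℝ => F (Fin.cons r y) := fun F hF r =>
      (hF.comp mc).comp measurable_prodMk_left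
    refine ih (mm f hf x) (mm g hg y) (mm h hh _) fun u w => ?_
    refine (hfg _ _).trans_eq ?_
    congr 1
    ext i
    refine Fin.cases ?_ (fun j => ?_) i <;> simp

/-- multiplicative Brunn–Minkowski -/
theorem bm_mul (n : ℕ) {A B C : Set (Fin n → ℝ)} (hA : MeasurableSet A) (hB : MeasurableSet B)
    (hC : MeasurableSet C) {s t : ℝ} (hs : 0 < s) (ht : 0 < t) (hst : s + t = 1)
    (hAB : ∀ x ∈ A, ∀ y ∈ B, s • x + t • y ∈ C) :
    volume A ^ s * volume B ^ t ≤ volume C := by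
  have := pl_pi n (f := A.indicator 1) (g := B.indicator 1) (h := C.indicator 1)
    (measurable_one.indicator hA) (measurable_one.indicator hB) (measurable_one.indicator hC)
    hs ht hst ?_
  · simpa [lintegral_indicator_one hA, lintegral_indicator_one hB, lintegral_indicator_one hC] using this
  · intro x y
    by_cases hx : x ∈ A
    · by_cases hy : y ∈ B
      · simp [hx, hy, hAB x hx y hy]
      · simp [hy, ht]
    · simp [hx, hs]

/-- Brunn–Minkowski, `1/n`-concave form (real volumes). -/
theorem bm_root (n : ℕ) (hn : 0 < n) {A B C : Set (Fin n → ℝ)} (hA : MeasurableSet A)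
    (hB : MeasurableSet B) (hC : MeasurableSet C) {s t : ℝ} (hs : 0 < s) (ht : 0 < t)
    (hAB : ∀ x ∈ A, ∀ y ∈ B, s • x + t • y ∈ C) {a b c : ℝ} (ha : 0 < a) (hb : 0 < b) (hc : 0 ≤ c)
    (hva : volume A = ENNReal.ofReal (a ^ n)) (hvb : volume B = ENNReal.ofReal (b ^ n))
    (hvc : volume C = ENNReal.ofReal (c ^ n)) : s * a + t * b ≤ c := by
  set k := s * a + t * b with hk
  have k0 : 0 < k := by positivity
  have key := bm_mul n (A := a⁻¹ • A) (B := b⁻¹ • B) (C := k⁻¹ • C)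
    (hA.const_smul_of_ne_zero (by positivity)) (hB.const_smul_of_ne_zero (by positivity))
    (hC.const_smul_of_ne_zero (by positivity)) (s := s * a / k) (t := t * b / k)
    (by positivity) (by positivity) (by rw [← add_div, ← hk, div_self k0.ne']) ?_
  · rw [Measure.addHaar_smul, Measure.addHaar_smul, Measure.addHaar_smul, hva, hvb, hvc] at key
    have aux : ∀ x : ℝ, 0 < x → ∀ y : ℝ, 0 ≤ y →
        ENNReal.ofReal |x⁻¹ ^ (Module.finrank ℝ (Fin n → ℝ))| * ENNReal.ofReal (y ^ n)
        = ENNReal.ofReal ((y / x) ^ n) := by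
      intro x hx y hy
      rw [← ENNReal.ofReal_mul (abs_nonneg _), abs_of_nonneg (by positivity)]
      simp [div_pow]
      congr 1
      field_simp
    rw [aux a ha a ha.le, aux b hb b hb.le, aux k k0 c hc, div_self ha.ne', div_self hb.ne'] at key
    simp only [one_pow, ENNReal.ofReal_one, ENNReal.one_rpow, one_mul] at key
    rw [ENNReal.one_le_ofReal] at key
    have : 1 ≤ c / k := by
      by_contra hlt
      exact absurd key (not_le.2 (pow_lt_one₀ (by positivity) (not_le.1 hlt) hn.ne'))
    rwa [one_le_div k0] at this
  · rintro _ ⟨x, hx, rfl⟩ _ ⟨y, hy, rfl⟩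
    refine ⟨s • x + t • y, hAB x hx y hy, ?_⟩
    ext i
    simp
    field_simp

end

section
open scoped Pointwise ENNReal

theorem open_bdd_convex_eq_Ioo {I : Set ℝ} (ho : IsOpen I) (hc : Convex ℝ I)
    (hb : Bornology.IsBounded I) (hn : I.Nonempty) : ∃ a b, a < b ∧ I = Set.Ioo a b := by
  have hp := hc.isPreconnected
  have h1 := IsConnected.Ioo_csInf_csSup_subset ⟨hn, hp⟩ hb.bddBelow hb.bddAbove
  have ha : sInf I ∉ I := fun h => by
    obtain ⟨ε, hε, hI⟩ := Metric.isOpen_iff.1 ho _ h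
    have : sInf I - ε / 2 ∈ I := hI (by simpa [abs_of_pos hε] using hε)
    have := csInf_le hb.bddBelow this
    linarith
  have hbI : sSup I ∉ I := fun h => by
    obtain ⟨ε, hε, hI⟩ := Metric.isOpen_iff.1 ho _ h
    have : sSup I + ε / 2 ∈ I := hI (by simpa [abs_of_pos hε] using hε)
    have := le_csSup hb.bddAbove this
    linarith
  have h2 : I ⊆ Set.Ioo (sInf I) (sSup I) := fun x hx =>
    ⟨lt_of_le_of_ne (csInf_le hb.bddBelow hx) (fun h => ha (h ▸ hx)),
     lt_of_le_of_ne (le_csSup hb.bddAbove hx) (fun h => hbI (h ▸ hx))⟩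
  obtain ⟨x, hx⟩ := hn
  exact ⟨sInf I, sSup I, (h2 hx).1.trans (h2 hx).2, h2.antisymm h1⟩

/-- coordinates adapted to a unit vector -/
theorem exists_coords (n : ℕ) (e : Euc (n + 1)) (he : ‖e‖ = 1) :
    ∃ G : (ℝ × (Fin n → ℝ)) ≃ₗ[ℝ] Euc (n + 1), Continuous G ∧
      MeasurePreserving G volume volume ∧ (∀ p, inner ℝ e (G p) = p.1) ∧
      (∀ p j, |p.2 j| ≤ ‖G p‖) := by
  obtain ⟨b, hb⟩ := Orthonormal.exists_orthonormalBasis_extension_of_card_eq (𝕜 := ℝ)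
    (E := Euc (n + 1)) (ι := Fin (n + 1)) (by simp) (v := fun _ => e) (s := {0}) (by
      constructor
      · rintro ⟨i, hi⟩; simpa using he
      · rintro ⟨i, hi⟩ ⟨j, hj⟩ hij
        simp only [Set.mem_singleton_iff] at hi hj
        exact absurd (Subtype.ext (hi.trans hj.symm)) hij)
  have hb0 : b 0 = e := hb 0 rfl
  let L1 : (ℝ × (Fin n → ℝ)) ≃ₗ[ℝ] (Fin (n + 1) → ℝ) :=
    { toFun := fun p => Fin.cons p.1 p.2
      invFun := fun f => (f 0, fun j => f j.succ)
      left_inv := fun p => by simp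
      right_inv := fun f => by
        ext i; refine Fin.cases ?_ (fun j => ?_) i <;> simp
      map_add' := fun p q => by
        ext i; refine Fin.cases ?_ (fun j => ?_) i <;> simp
      map_smul' := fun c q => by
        ext i; refine Fin.cases ?_ (fun j => ?_) i <;> simp }
  have mp1 : MeasurePreserving L1 volume volume := by
    have := (volume_preserving_piFinSuccAbove (fun _ : Fin (n + 1) => ℝ) 0).symm
    have hL : (L1 : ℝ × (Fin n → ℝ) → (Fin (n + 1) → ℝ)) =
        (MeasurableEquiv.piFinSuccAbove (fun _ : Fin (n + 1) => ℝ) 0).symm := by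
      funext p
      simp [L1, MeasurableEquiv.piFinSuccAbove, Fin.insertNthEquiv]
    rw [hL]
    exact this
  let L2 : (Fin (n + 1) → ℝ) ≃ₗ[ℝ] Euc (n + 1) := (WithLp.linearEquiv 2 ℝ (Fin (n + 1) → ℝ)).symm
  have mp2 : MeasurePreserving L2 volume volume := PiLp.volume_preserving_toLp (Fin (n + 1))
  have mp3 : MeasurePreserving b.repr.symm volume volume := b.repr.symm.measurePreserving
  let G := (L1.trans L2).trans b.repr.symm.toLinearEquiv
  have hG : ∀ p, G p = b.repr.symm (WithLp.toLp 2 (Fin.cons p.1 p.2)) := fun p => rfl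
  have hr : ∀ p, b.repr (G p) = (WithLp.toLp 2 (Fin.cons p.1 p.2)) := fun p => by
    rw [hG, LinearIsometryEquiv.apply_symm_apply]
  refine ⟨G, ?_, mp3.comp (mp2.comp mp1), ?_, ?_⟩
  · exact LinearMap.continuous_of_finiteDimensional (G : (ℝ × (Fin n → ℝ)) →ₗ[ℝ] Euc (n + 1))
  · intro p
    rw [← hb0, ← b.repr_apply_apply, hr]
    simp
  · intro p j
    rw [← b.repr.norm_map, hr]
    have := PiLp.norm_apply_le (WithLp.toLp 2 (Fin.cons p.1 p.2) : Euc (n + 1)) j.succ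
    simpa using this

theorem section_lemma (n : ℕ) (hn : 0 < n) (Ω : Set (Euc (n + 1))) (hΩ : IsConvexDomain Ω)
    (e : Euc (n + 1)) (he : ‖e‖ = 1) :
    ∃ (a b H : ℝ) (h : ℝ → ℝ), a < b ∧ (fun x => inner ℝ e x) '' Ω = Set.Ioo a b ∧
      ConcaveOn ℝ (Set.Ioo a b) h ∧ (∀ t ∈ Set.Ioo a b, 0 < h t ∧ h t ≤ H) ∧ Measurable h ∧
      (volume.restrict Ω).map (fun x => inner ℝ e x) =
        (volume.restrict (Set.Ioo a b)).withDensity (fun t => ENNReal.ofReal (h t ^ n)) := by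
  obtain ⟨hne, hop, hbd, hcv⟩ := hΩ
  obtain ⟨G, Gc, Gm, Ge, Gn⟩ := exists_coords n e he
  have hmΩ := hop.measurableSet
  have heC : Continuous fun x : Euc (n + 1) => inner ℝ e x := by fun_prop
  set I := (fun x => inner ℝ e x) '' Ω with hI
  have Io : IsOpen I := by
    have h1 : I = Prod.fst '' (G ⁻¹' Ω) := by
      ext t
      constructor
      · rintro ⟨x, hx, rfl⟩
        refine ⟨G.symm x, by simpa using hx, ?_⟩
        rw [← Ge]; simp
      · rintro ⟨p, hp, rfl⟩
        exact ⟨G p, hp, Ge p⟩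
    rw [h1]
    exact isOpenMap_fst _ (hop.preimage Gc)
  have Ic : Convex ℝ I := hcv.linear_image ((innerSL ℝ e : Euc (n + 1) →L[ℝ] ℝ) : Euc (n + 1) →ₗ[ℝ] ℝ)
  obtain ⟨R, hR⟩ := hbd.exists_norm_le
  have Ib : Bornology.IsBounded I := by
    refine isBounded_iff_forall_norm_le.2 ⟨R, ?_⟩
    rintro _ ⟨x, hx, rfl⟩
    refine (norm_inner_le_norm e x).trans ?_
    rw [he, one_mul]; exact hR x hx
  obtain ⟨a, b, hab, hIab⟩ := open_bdd_convex_eq_Ioo Io Ic Ib (hne.image _)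
  let S : ℝ → Set (Fin n → ℝ) := fun t => {y | G (t, y) ∈ Ω}
  have So : ∀ t, IsOpen (S t) := fun t => hop.preimage (Gc.comp (by fun_prop))
  have Sn : ∀ t ∈ Set.Ioo a b, (S t).Nonempty := by
    intro t ht
    rw [← hIab] at ht
    obtain ⟨x, hx, rfl⟩ := ht
    refine ⟨(G.symm x).2, ?_⟩
    have : inner ℝ e x = (G.symm x).1 := by rw [← Ge]; simp
    simpa [S, this] using hx
  have Se : ∀ t, t ∉ Set.Ioo a b → S t = ∅ := by
    intro t ht
    by_contra hne
    obtain ⟨y, hy⟩ := Set.nonempty_iff_ne_empty.2 hne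
    refine ht ?_
    rw [← hIab]
    exact ⟨G (t, y), hy, Ge _⟩
  have Sb : ∀ t, S t ⊆ Metric.closedBall 0 R := by
    intro t y hy
    have hR0 : 0 ≤ R := (norm_nonneg _).trans (hR _ hy)
    rw [mem_closedBall_zero_iff, pi_norm_le_iff_of_nonneg hR0]
    intro j
    exact (Gn (t, y) j).trans (hR _ hy)
  set W : ℝ≥0∞ := volume (Metric.closedBall (0 : Fin n → ℝ) R)
  have Wt : W ≠ ⊤ := (isCompact_closedBall _ _).measure_lt_top.ne
  have Sv : ∀ t, volume (S t) ≤ W := fun t => measure_mono (Sb t)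
  have St : ∀ t, volume (S t) ≠ ⊤ := fun t => ne_top_of_le_ne_top Wt (Sv t)
  have hSm : Measurable fun t => volume (S t) := by
    exact measurable_measure_prodMk_left (hmΩ.preimage Gc.measurable)
  let h : ℝ → ℝ := fun t => (volume (S t)).toReal ^ ((n : ℝ)⁻¹)
  have hn0 : (n : ℝ) ≠ 0 := by exact_mod_cast hn.ne'
  have hpow : ∀ t, h t ^ n = (volume (S t)).toReal := fun t => by
    simp only [h]
    rw [← Real.rpow_natCast, ← Real.rpow_mul ENNReal.toReal_nonneg, inv_mul_cancel₀ hn0, Real.rpow_one]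
  have hof : ∀ t, volume (S t) = ENNReal.ofReal (h t ^ n) := fun t => by
    rw [hpow, ENNReal.ofReal_toReal (St t)]
  have hpos : ∀ t ∈ Set.Ioo a b, 0 < h t := fun t ht => by
    refine Real.rpow_pos_of_pos (ENNReal.toReal_pos ?_ (St t)) _
    exact ((So t).measure_pos volume (Sn t ht)).ne'
  refine ⟨a, b, W.toReal ^ ((n : ℝ)⁻¹), h, hab, hIab, ?_, ?_, ?_, ?_⟩
  · refine ⟨convex_Ioo a b, ?_⟩
    intro x hx y hy s t hs ht hst
    rcases hs.eq_or_lt with rfl | hs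
    · have : t = 1 := by linarith
      subst this; simp
    rcases ht.eq_or_lt with rfl | ht
    · have : s = 1 := by linarith
      subst this; simp
    simp only [smul_eq_mul]
    refine bm_root n hn (So x).measurableSet (So y).measurableSet (So (s * x + t * y)).measurableSet
      hs ht ?_ (hpos x hx) (hpos y hy) (by positivity) (hof _) (hof _) (hof _)
    intro u hu w hw
    have := hcv hu hw hs.le ht.le hst
    rw [← map_smul, ← map_smul, ← map_add] at this
    exact this
  · intro t ht
    refine ⟨hpos t ht, ?_⟩
    exact Real.rpow_le_rpow ENNReal.toReal_nonneg (ENNReal.toReal_mono Wt (Sv t)) (by positivity)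
  · exact hSm.ennreal_toReal.pow_const _
  · ext s hs
    rw [Measure.map_apply heC.measurable hs, withDensity_apply _ hs,
      Measure.restrict_apply (hs.preimage heC.measurable)]
    rw [← Gm.measure_preimage ((hs.preimage heC.measurable).inter hmΩ).nullMeasurableSet]
    rw [Measure.volume_eq_prod, Measure.prod_apply
      (((hs.preimage heC.measurable).inter hmΩ).preimage Gc.measurable)]
    rw [Measure.restrict_restrict hs, ← lintegral_indicator (hs.inter measurableSet_Ioo)]
    congr 1
    ext t
    by_cases hts : t ∈ s
    · by_cases htI : t ∈ Set.Ioo a b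
      · rw [Set.indicator_of_mem (show t ∈ s ∩ Set.Ioo a b from ⟨hts, htI⟩), ← hof]
        congr 1
        ext y
        simp [Ge, hts, S]
      · rw [Set.indicator_of_notMem (fun h => htI h.2)]
        rw [← nonpos_iff_eq_zero, ← measure_empty (μ := (volume : Measure (Fin n → ℝ))), ← Se t htI]
        refine measure_mono fun y hy => hy.2
    · rw [Set.indicator_of_notMem (fun h => hts h.1)]
      rw [← nonpos_iff_eq_zero, ← measure_empty (μ := (volume : Measure (Fin n → ℝ)))]
      refine measure_mono fun y hy => hts ?_
      have := hy.1
      simpa [Ge] using this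

/-- integral form of the density statement -/
theorem integral_of_map_eq {n : ℕ} {d : ℕ} {Ω : Set (Euc d)} {e : Euc d} {a b : ℝ} {h : ℝ → ℝ}
    (hab : a < b) (hpos : ∀ t ∈ Set.Ioo a b, 0 < h t) (hm : Measurable h)
    (hmap : (volume.restrict Ω).map (fun x => inner ℝ e x) =
        (volume.restrict (Set.Ioo a b)).withDensity (fun t => ENNReal.ofReal (h t ^ n)))
    (F : ℝ → ℝ) (hF : Measurable F) :
    ∫ x in Ω, F (inner ℝ e x) = ∫ t in a..b, F t * h t ^ n := by
  have heC : Continuous fun x : Euc d => inner ℝ e x := by fun_prop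
  have h1 := integral_map (μ := volume.restrict Ω) heC.aemeasurable (f := F) hF.aestronglyMeasurable
  rw [← h1, hmap, integral_withDensity_eq_integral_toReal_smul (by fun_prop) (by simp)]
  rw [intervalIntegral.integral_of_le hab.le, integral_Ioc_eq_integral_Ioo]
  refine setIntegral_congr_fun measurableSet_Ioo fun t ht => ?_
  simp only [smul_eq_mul]
  rw [ENNReal.toReal_ofReal (pow_nonneg (hpos t ht).le n), mul_comm]

end

section
theorem upper_set_integral_nonpos {a b : ℝ} (hab : a ≤ b) {g : ℝ → ℝ} {S : Set ℝ}
    (hS : ∀ x ∈ S, ∀ y, x ≤ y → y ∈ S)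
    (hg : ∀ s ∈ Set.Icc a b, ∫ x in s..b, g x ≤ 0) : ∫ x in Set.Ioc a b ∩ S, g x ≤ 0 := by
  rcases (Set.Ioc a b ∩ S).eq_empty_or_nonempty with he | hne
  · rw [he]; simp
  set s := sInf (Set.Ioc a b ∩ S) with hs
  have hbd : BddBelow (Set.Ioc a b ∩ S) := ⟨a, fun x hx => hx.1.1.le⟩
  have hsa : a ≤ s := le_csInf hne fun x hx => hx.1.1.le
  obtain ⟨x0, hx0⟩ := hne
  have hsb : s ≤ b := (csInf_le hbd hx0).trans hx0.1.2
  have h1 : Set.Ioc s b ⊆ Set.Ioc a b ∩ S := by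
    intro x hx
    obtain ⟨y, hy, hyx⟩ := exists_lt_of_csInf_lt ⟨x0, hx0⟩ hx.1
    exact ⟨⟨hsa.trans_lt hx.1, hx.2⟩, hS y hy.2 x hyx.le⟩
  have h2 : Set.Ioc a b ∩ S ⊆ Set.Icc s b := fun x hx => ⟨csInf_le hbd hx, hx.1.2⟩
  have h3 : (Set.Ioc a b ∩ S : Set ℝ) =ᵐ[volume] Set.Ioc s b := by
    refine Filter.EventuallyLE.antisymm ?_ (LE.le.eventuallyLE h1)
    exact (LE.le.eventuallyLE h2).trans Ioc_ae_eq_Icc.symm.le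
  rw [setIntegral_congr_set h3, ← intervalIntegral.integral_of_le hsb]
  exact hg s ⟨hsa, hsb⟩

theorem mono_lemma_aux {a b : ℝ} (hab : a ≤ b) {ρ g : ℝ → ℝ} (hρ : Monotone ρ) (hρ0 : 0 ≤ ρ a)
    (hgi : IntervalIntegrable g volume a b)
    (hg : ∀ s ∈ Set.Icc a b, ∫ x in s..b, g x ≤ 0) : ∫ x in a..b, ρ x * g x ≤ 0 := by
  have hρb : 0 ≤ ρ b := hρ0.trans (hρ hab)
  rw [intervalIntegral.integral_of_le hab]
  rw [intervalIntegrable_iff_integrableOn_Ioc_of_le hab] at hgi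
  have hm : Measurable ρ := hρ.measurable
  let S : Set (ℝ × ℝ) := {p | p.2 < ρ p.1}
  have hSm : MeasurableSet S := measurableSet_lt measurable_snd (hm.comp measurable_fst)
  have hint : Integrable (fun p : ℝ × ℝ => S.indicator (fun p => g p.1 * 1) p)
      ((volume.restrict (Set.Ioc a b)).prod (volume.restrict (Set.Ioc 0 (ρ b)))) :=
    (Integrable.mul_prod (f := g) (g := fun _ : ℝ => (1 : ℝ)) hgi (integrable_const 1)).indicator hSm
  have hsw := integral_integral_swap (f := fun x t => S.indicator (fun p => g p.1 * 1) (x, t)) hint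
  have e1 : ∫ x in Set.Ioc a b, ρ x * g x =
      ∫ x in Set.Ioc a b, ∫ t in Set.Ioc 0 (ρ b), S.indicator (fun p => g p.1 * 1) (x, t) := by
    refine setIntegral_congr_fun measurableSet_Ioc fun x hx => ?_
    have h0 : 0 ≤ ρ x := hρ0.trans (hρ hx.1.le)
    have h1 : ρ x ≤ ρ b := hρ hx.2
    have : ∀ t, S.indicator (fun p => g p.1 * 1) (x, t) = (Set.Iio (ρ x)).indicator (fun _ => g x) t := by
      intro t
      simp [S, Set.indicator_apply]
    simp only [this]
    rw [setIntegral_indicator measurableSet_Iio]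
    have h2 : Set.Ioc 0 (ρ b) ∩ Set.Iio (ρ x) = Set.Ioo 0 (ρ x) := by
      ext t; constructor
      · rintro ⟨h, h'⟩; exact ⟨h.1, h'⟩
      · rintro ⟨h, h'⟩; exact ⟨⟨h, h'.le.trans h1⟩, h'⟩
    rw [h2]; simp [h0]
  rw [e1, hsw]
  refine integral_nonpos fun t => ?_
  have : ∀ x, S.indicator (fun p => g p.1 * 1) (x, t) = ({x | t < ρ x} : Set ℝ).indicator g x := by
    intro x
    simp [S, Set.indicator_apply]
  simp only [this]
  rw [setIntegral_indicator (measurableSet_lt measurable_const hm)]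
  exact upper_set_integral_nonpos hab (fun x hx y hxy => lt_of_lt_of_le hx (hρ hxy)) hg

/-- `ρ ≥ 0` monotone, tails of `g` have nonpositive integral, then `∫ ρ g ≤ 0`. -/
theorem mono_lemma {a b : ℝ} (hab : a ≤ b) {ρ g : ℝ → ℝ} (hρ : MonotoneOn ρ (Set.Icc a b))
    (hρ0 : 0 ≤ ρ a) (hgi : IntervalIntegrable g volume a b)
    (hg : ∀ s ∈ Set.Icc a b, ∫ x in s..b, g x ≤ 0) : ∫ x in a..b, ρ x * g x ≤ 0 := by
  have h1 := mono_lemma_aux hab (ρ := fun x => ρ (max a (min x b))) (g := g) ?_ ?_ hgi hg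
  · refine le_of_eq_of_le ?_ h1
    refine intervalIntegral.integral_congr fun x hx => ?_
    rw [Set.uIcc_of_le hab] at hx
    simp [hx.1, hx.2]
  · intro x y hxy
    refine hρ ⟨le_max_left _ _, max_le hab (min_le_right _ _)⟩
      ⟨le_max_left _ _, max_le hab (min_le_right _ _)⟩ ?_
    gcongr
  · simpa [hab] using hρ0

/-- antitone version -/
theorem anti_lemma {a b : ℝ} (hab : a ≤ b) {ρ g : ℝ → ℝ} (hρ : AntitoneOn ρ (Set.Icc a b))
    (hρ0 : 0 ≤ ρ b) (hgi : IntervalIntegrable g volume a b)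
    (hg : ∀ s ∈ Set.Icc a b, ∫ x in a..s, g x ≤ 0) : ∫ x in a..b, ρ x * g x ≤ 0 := by
  have h1 := mono_lemma (a := -b) (b := -a) (by linarith) (ρ := fun x => ρ (-x))
    (g := fun x => g (-x)) ?_ (by simpa using hρ0) ?_ ?_
  · rw [intervalIntegral.integral_comp_neg (fun x => ρ x * g x)] at h1
    simpa using h1
  · intro x hx y hy hxy
    exact hρ ⟨by linarith [hy.2], by linarith [hy.1]⟩ ⟨by linarith [hx.2], by linarith [hx.1]⟩ (by linarith)
  · have := (IntervalIntegrable.iff_comp_neg).mp hgi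
    exact this.symm
  · intro s hs
    rw [intervalIntegral.integral_comp_neg (fun x => g x)]
    simp only [neg_neg]
    exact hg (-s) ⟨by linarith [hs.2], by linarith [hs.1]⟩

/-- signed monotone version, with total integral zero -/
theorem mono_lemma_zero {a b : ℝ} (hab : a ≤ b) {ρ g : ℝ → ℝ} (hρ : MonotoneOn ρ (Set.Icc a b))
    (hgi : IntervalIntegrable g volume a b) (h0 : ∫ x in a..b, g x = 0)
    (hρg : IntervalIntegrable (fun x => ρ x * g x) volume a b)
    (hg : ∀ s ∈ Set.Icc a b, ∫ x in s..b, g x ≤ 0) : ∫ x in a..b, ρ x * g x ≤ 0 := by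
  have h1 := mono_lemma hab (ρ := fun x => ρ x - ρ a) (fun x hx y hy hxy => by
    have := hρ hx hy hxy
    simpa using this) (by simp) hgi hg
  have h2 : ∫ x in a..b, (ρ x - ρ a) * g x = (∫ x in a..b, ρ x * g x) - ∫ x in a..b, ρ a * g x := by
    rw [← intervalIntegral.integral_sub hρg (hgi.const_mul _)]
    congr 1; ext x; ring
  rw [h2, intervalIntegral.integral_const_mul, h0] at h1
  simpa using h1

end

section
def bco (ν : ℝ) (m : ℕ) : ℝ := (-1 : ℝ) ^ m / (m.factorial * Real.Gamma (m + ν + 1)) / 4 ^ m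

def bg (ν : ℝ) (y : ℝ) : ℝ := ∑' m : ℕ, bco ν m * y ^ m

theorem gamma_lower {ν : ℝ} (hν : 0 ≤ ν) (m : ℕ) :
    Real.Gamma (ν + 1) ≤ Real.Gamma (m + ν + 1) := by
  induction m with
  | zero => simp
  | succ k ih =>
    have hp : 0 < (k : ℝ) + ν + 1 := by positivity
    have : ((k + 1 : ℕ) : ℝ) + ν + 1 = (k + ν + 1) + 1 := by push_cast; ring
    rw [this, Real.Gamma_add_one hp.ne']
    have hg : 0 < Real.Gamma (k + ν + 1) := Real.Gamma_pos_of_pos hp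
    have hk : (0 : ℝ) ≤ k := Nat.cast_nonneg k
    nlinarith

theorem bco_bound {ν : ℝ} (hν : 0 ≤ ν) (m : ℕ) :
    |bco ν m| ≤ (Real.Gamma (ν + 1))⁻¹ * (m.factorial : ℝ)⁻¹ := by
  have hg0 : 0 < Real.Gamma (ν + 1) := Real.Gamma_pos_of_pos (by linarith)
  have hg := gamma_lower hν m
  have hf : (0 : ℝ) < m.factorial := by positivity
  unfold bco
  rw [abs_div, abs_div, abs_pow, abs_neg, abs_one, one_pow, abs_of_pos (by positivity : (0:ℝ) < 4 ^ m),
    abs_of_pos (mul_pos hf (hg0.trans_le hg))]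
  have h4 : (1 : ℝ) ≤ 4 ^ m := one_le_pow₀ (by norm_num)
  calc _ ≤ 1 / (m.factorial * Real.Gamma (m + ν + 1)) := by
        apply div_le_self _ h4
        exact div_nonneg zero_le_one (mul_pos hf (hg0.trans_le hg)).le
    _ ≤ 1 / (m.factorial * Real.Gamma (ν + 1)) := by gcongr
    _ = _ := by field_simp

theorem bg_summable {ν : ℝ} (hν : 0 ≤ ν) (y : ℝ) : Summable fun m => bco ν m * y ^ m := by
  refine Summable.of_norm_bounded
    (g := fun m : ℕ => (Real.Gamma (ν + 1))⁻¹ * (|y| ^ m / (m.factorial : ℝ))) ?_ ?_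
  · exact (Real.summable_pow_div_factorial |y|).mul_left _
  · intro m
    rw [norm_mul, norm_pow, Real.norm_eq_abs, Real.norm_eq_abs]
    calc _ ≤ (Real.Gamma (ν + 1))⁻¹ * (m.factorial : ℝ)⁻¹ * |y| ^ m := by
          gcongr; exact bco_bound hν m
      _ = _ := by ring

theorem bco_succ (ν : ℝ) (m : ℕ) : bco ν (m + 1) * (m + 1) = -(1 / 4) * bco (ν + 1) m := by
  unfold bco
  have : ((m + 1 : ℕ) : ℝ) + ν + 1 = m + (ν + 1) + 1 := by push_cast; ring
  rw [this, Nat.factorial_succ]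
  push_cast
  have hf : (m.factorial : ℝ) ≠ 0 := by positivity
  have hm : (m : ℝ) + 1 ≠ 0 := by positivity
  by_cases hg : Real.Gamma (m + (ν + 1) + 1) = 0
  · simp [hg]
  · field_simp
    ring

theorem bg_hasDerivAt {ν : ℝ} (hν : 0 ≤ ν) (y : ℝ) :
    HasDerivAt (bg ν) (-(1 / 4) * bg (ν + 1) y) y := by
  set R : ℝ := |y| + 1 with hR
  have hR0 : 0 < R := by positivity
  have key := hasDerivAt_tsum_of_isPreconnected (𝕜 := ℝ) (F := ℝ)
    (u := fun m : ℕ => |bco ν m| * (m * R ^ (m - 1)))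
    (g := fun m y => bco ν m * y ^ m) (g' := fun m y => bco ν m * (m * y ^ (m - 1)))
    (t := Metric.ball 0 R) (y₀ := 0) (y := y) ?_ Metric.isOpen_ball
    (convex_ball 0 R).isPreconnected ?_ ?_ (by simpa using hR0) (bg_summable hν 0) ?_
  · refine key.congr_deriv ?_
    have hsh : ∀ m : ℕ, bco ν (m + 1) * (((m + 1 : ℕ) : ℝ) * y ^ (m + 1 - 1))
        = -(1 / 4) * (bco (ν + 1) m * y ^ m) := by
      intro m
      rw [Nat.add_sub_cancel, ← mul_assoc, ← mul_assoc, ← bco_succ]; push_cast; ring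
    have hsm : Summable fun m : ℕ => bco ν m * (m * y ^ (m - 1)) := by
      rw [← summable_nat_add_iff 1]
      simp only [hsh]
      exact (bg_summable (ν := ν + 1) (by linarith) y).mul_left (-(1 / 4))
    rw [hsm.tsum_eq_zero_add]
    simp only [hsh, tsum_mul_left]
    simp [bg]
  · rw [← summable_nat_add_iff 1]
    have := ((Real.summable_pow_div_factorial R).mul_left (Real.Gamma (ν + 1 + 1))⁻¹)
    refine Summable.of_nonneg_of_le (fun m => by positivity) ?_ this
    intro m
    have h1 : |bco ν (m + 1)| * ((m + 1 : ℕ) : ℝ) = (1 / 4) * |bco (ν + 1) m| := by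
      have := congrArg abs (bco_succ ν m)
      rw [abs_mul, abs_mul, abs_neg, abs_of_pos (by norm_num : (0:ℝ) < 1/4),
        abs_of_pos (by positivity : (0:ℝ) < m + 1)] at this
      push_cast; exact this
    rw [Nat.add_sub_cancel, ← mul_assoc, h1]
    have h2 := bco_bound (ν := ν + 1) (by linarith) m
    have h3 : (1 / 4) * |bco (ν + 1) m| ≤ |bco (ν + 1) m| := by
      have := abs_nonneg (bco (ν + 1) m); linarith
    calc _ ≤ ((Real.Gamma (ν + 1 + 1))⁻¹ * (m.factorial : ℝ)⁻¹) * R ^ m := by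
          exact mul_le_mul_of_nonneg_right (h3.trans h2) (by positivity)
      _ = _ := by ring
  · intro m z _
    exact (hasDerivAt_pow m z).const_mul _
  · intro m z hz
    rw [norm_mul, norm_mul, norm_pow]
    simp only [Real.norm_eq_abs, Nat.abs_cast]
    have : |z| ≤ R := by
      have := Metric.mem_ball.1 hz; rw [dist_zero_right] at this; exact this.le
    gcongr
  · simp [hR]

theorem bg_rec {ν : ℝ} (hν : 0 ≤ ν) (y : ℝ) :
    bg ν y = (ν + 1) * bg (ν + 1) y - y * bg (ν + 2) y / 4 := by
  have hs0 := bg_summable hν y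
  have hs1 := bg_summable (ν := ν + 1) (by linarith) y
  have hs2 := bg_summable (ν := ν + 2) (by linarith) y
  have h : ∀ m : ℕ, bco ν m - (ν + 1) * bco (ν + 1) m = m * (bco (ν+1) m) := by
    intro m
    unfold bco
    have hp : 0 < (m : ℝ) + ν + 1 := by positivity
    have : (m : ℝ) + (ν + 1) + 1 = (m + ν + 1) + 1 := by ring
    rw [this, Real.Gamma_add_one hp.ne']
    have hg : Real.Gamma (m + ν + 1) ≠ 0 := (Real.Gamma_pos_of_pos hp).ne'
    field_simp
    ring
  have e1 : bg ν y - (ν + 1) * bg (ν + 1) y = ∑' m : ℕ, (m * bco (ν + 1) m) * y ^ m := by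
    rw [bg, bg, ← tsum_mul_left, ← Summable.tsum_sub hs0 (hs1.mul_left _)]
    congr 1; ext m; rw [← h]; ring
  have e2 : ∑' m : ℕ, (m * bco (ν + 1) m) * y ^ m = - (y * bg (ν + 2) y / 4) := by
    have hsh : ∀ m : ℕ, (((m + 1 : ℕ) : ℝ) * bco (ν + 1) (m + 1)) * y ^ (m + 1)
        = (-(1 / 4) * y) * (bco (ν + 2) m * y ^ m) := by
      intro m
      have := bco_succ (ν + 1) m
      rw [show ν + 1 + 1 = ν + 2 by ring] at this
      push_cast
      rw [mul_comm ((m : ℝ) + 1), this, pow_succ]; ring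
    rw [Summable.tsum_eq_zero_add]
    · simp only [hsh, tsum_mul_left]
      simp [bg]; ring
    · rw [← summable_nat_add_iff 1]
      simp only [hsh]
      exact hs2.mul_left _
  linarith

theorem bg_zero_pos {ν : ℝ} (hν : 0 ≤ ν) : 0 < bg ν 0 := by
  have : bg ν 0 = bco ν 0 := by
    rw [bg, tsum_eq_single 0]
    · simp
    · intro m hm; simp [hm]
  rw [this]; unfold bco
  have := Real.Gamma_pos_of_pos (show 0 < ν + 1 by linarith)
  simp [this]

/-- normalized Bessel profile -/
def bPhi (ν : ℝ) (x : ℝ) : ℝ := bg ν (x ^ 2)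
def bQ (ν : ℝ) (x : ℝ) : ℝ := -(1 / 2) * bg (ν + 1) (x ^ 2)

theorem besselJ_eq {ν x : ℝ} (hx : 0 < x) : besselJ ν x = (x / 2) ^ ν * bPhi ν x := by
  unfold besselJ bPhi bg
  rw [← tsum_mul_left]
  congr 1; ext m
  have hx2 : 0 < x / 2 := by positivity
  have h2 : (x / 2) ^ (2 * (m : ℝ)) = (x / 2) ^ (2 * m : ℕ) := by
    rw [← Real.rpow_natCast]; push_cast; rfl
  rw [Real.rpow_add hx2, h2, bco, pow_mul, div_pow x 2 2, div_pow]
  norm_num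
  ring

theorem bPhi_hasDerivAt {ν : ℝ} (hν : 0 ≤ ν) (x : ℝ) :
    HasDerivAt (bPhi ν) (x * bQ ν x) x := by
  have h := (bg_hasDerivAt hν (x ^ 2)).comp x (hasDerivAt_pow 2 x)
  refine h.congr_deriv ?_
  unfold bQ; push_cast; ring

theorem bPhi_hasDerivAt2 {ν : ℝ} (hν : 0 ≤ ν) (x : ℝ) :
    HasDerivAt (fun x => x * bQ ν x) (-(bPhi ν x) - (2 * ν + 1) * bQ ν x) x := by
  have h := (bg_hasDerivAt (ν := ν + 1) (by linarith) (x ^ 2)).comp x (hasDerivAt_pow 2 x)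
  have h2 := (hasDerivAt_id x).mul (h.const_mul (-(1/2)))
  refine h2.congr_deriv ?_
  unfold bQ bPhi; rw [bg_rec hν]
  simp only [id, Function.comp]
  rw [show ν + 1 + 1 = ν + 2 by ring]
  push_cast; ring

theorem bPhi_zero_pos {ν : ℝ} (hν : 0 ≤ ν) : 0 < bPhi ν 0 := by
  unfold bPhi; simpa using bg_zero_pos hν

end

section
def bw (ν p x : ℝ) : ℝ := x ^ p * bPhi ν x
def bw1 (ν p x : ℝ) : ℝ := x ^ p * (p * bPhi ν x / x + x * bQ ν x)

theorem bw_hasDerivAt {ν p : ℝ} (hν : 0 ≤ ν) {x : ℝ} (hx : 0 < x) :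
    HasDerivAt (bw ν p) (bw1 ν p x) x := by
  have h := (Real.hasDerivAt_rpow_const (p := p) (Or.inl hx.ne')).mul (bPhi_hasDerivAt hν x)
  refine h.congr_deriv ?_
  rw [bw1, Real.rpow_sub_one hx.ne']
  field_simp

theorem bw1_hasDerivAt {ν p : ℝ} (hν : 0 ≤ ν) (hp : 2 * p = 2 * ν + 1) {x : ℝ} (hx : 0 < x) :
    HasDerivAt (bw1 ν p) (-(1 - (p ^ 2 - p) / x ^ 2) * bw ν p x) x := by
  have h := (Real.hasDerivAt_rpow_const (p := p) (Or.inl hx.ne')).mul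
    ((((bPhi_hasDerivAt hν x).const_mul p).div (hasDerivAt_id x) hx.ne').add
      (bPhi_hasDerivAt2 hν x))
  refine h.congr_deriv ?_
  rw [bw, Real.rpow_sub_one hx.ne', ← hp]
  simp only [id, Pi.add_apply, Pi.div_apply]
  field_simp
  ring

/-- Sturm comparison -/
theorem sturm_aux {w w1 w2 : ℝ → ℝ} {s : ℝ}
    (h1 : ∀ x ∈ Set.Icc s (s + 2 * π), HasDerivAt w (w1 x) x)
    (h2 : ∀ x ∈ Set.Icc s (s + 2 * π), HasDerivAt w1 (w2 x) x)
    (h3 : ∀ x ∈ Set.Icc s (s + 2 * π), w2 x ≤ -(1 / 4) * w x)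
    (hpos : ∀ x ∈ Set.Icc s (s + 2 * π), 0 < w x) : False := by
  have hpi := Real.pi_pos
  let W : ℝ → ℝ := fun x => w1 x * Real.sin ((x - s) / 2) - w x * (1 / 2 * Real.cos ((x - s) / 2))
  have hd : ∀ x ∈ Set.Icc s (s + 2 * π), HasDerivAt W
      ((w2 x + 1 / 4 * w x) * Real.sin ((x - s) / 2)) x := by
    intro x hx
    have hl : HasDerivAt (fun x => (x - s) / 2) (1 / 2) x := ((hasDerivAt_id x).sub_const s).div_const 2
    have := ((h2 x hx).mul hl.sin).sub ((h1 x hx).mul (hl.cos.const_mul (1 / 2)))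
    refine this.congr_deriv ?_
    ring
  have hanti : AntitoneOn W (Set.Icc s (s + 2 * π)) := by
    apply antitoneOn_of_deriv_nonpos (convex_Icc _ _)
    · exact fun x hx => (hd x hx).continuousAt.continuousWithinAt
    · intro x hx; rw [interior_Icc] at hx
      exact (hd x (Set.Ioo_subset_Icc_self hx)).differentiableAt.differentiableWithinAt
    · intro x hx; rw [interior_Icc] at hx
      have hx' := Set.Ioo_subset_Icc_self hx
      rw [(hd x hx').deriv]
      refine mul_nonpos_of_nonpos_of_nonneg (by linarith [h3 x hx']) ?_
      exact Real.sin_nonneg_of_nonneg_of_le_pi (by linarith [hx.1]) (by linarith [hx.2])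
  have hs : s ∈ Set.Icc s (s + 2 * π) := ⟨le_rfl, by linarith⟩
  have ht : s + 2 * π ∈ Set.Icc s (s + 2 * π) := ⟨by linarith, le_rfl⟩
  have := hanti hs ht (by linarith)
  have e : (s + 2 * π - s) / 2 = π := by ring
  simp only [W, e, sub_self, zero_div, Real.sin_zero, Real.cos_zero, Real.sin_pi, Real.cos_pi] at this
  linarith [hpos s hs, hpos _ ht]

theorem bPhi_continuous {ν : ℝ} (hν : 0 ≤ ν) : Continuous (bPhi ν) :=
  continuous_iff_continuousAt.2 fun x => (bPhi_hasDerivAt hν x).continuousAt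

theorem bPhi_zero_exists {ν : ℝ} (hν : 0 ≤ ν) (S : ℝ) : ∃ x, S < x ∧ 0 < x ∧ bPhi ν x = 0 := by
  set p : ℝ := ν + 1 / 2 with hp
  have hp2 : 2 * p = 2 * ν + 1 := by rw [hp]; ring
  obtain ⟨s, hs⟩ : ∃ s : ℝ, S < s ∧ 1 ≤ s ∧ 4 * (p ^ 2 - p) ≤ 3 * s := by
    refine ⟨max (S + 1) (max 1 (4 * (p ^ 2 - p) / 3)), ?_, ?_, ?_⟩
    · exact lt_max_of_lt_left (by linarith)
    · exact le_max_of_le_right (le_max_left _ _)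
    · have : 4 * (p ^ 2 - p) / 3 ≤ max (S + 1) (max 1 (4 * (p ^ 2 - p) / 3)) :=
        le_max_of_le_right (le_max_right _ _)
      linarith
  have hpi := Real.pi_pos
  by_contra hcon
  push Not at hcon
  have hne : ∀ x ∈ Set.Icc s (s + 2 * π), bPhi ν x ≠ 0 := fun x hx =>
    hcon x (hs.1.trans_le hx.1) (by linarith [hx.1, hs.2.1])
  have hx0 : ∀ x ∈ Set.Icc s (s + 2 * π), 0 < x := fun x hx => by linarith [hx.1, hs.2.1]
  have hQ : ∀ x ∈ Set.Icc s (s + 2 * π), 1 / 4 ≤ 1 - (p ^ 2 - p) / x ^ 2 := by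
    intro x hx
    have : (p ^ 2 - p) / x ^ 2 ≤ 3 / 4 := by
      rw [div_le_iff₀ (by have := hx0 x hx; positivity)]
      nlinarith [hx.1, hs.2.1]
    linarith
  -- constant sign
  have hsign : (∀ x ∈ Set.Icc s (s + 2 * π), 0 < bPhi ν x) ∨ (∀ x ∈ Set.Icc s (s + 2 * π), bPhi ν x < 0) := by
    by_contra h
    push Not at h
    obtain ⟨⟨x, hx, hx'⟩, ⟨y, hy, hy'⟩⟩ := h
    have hc := isPreconnected_Icc.intermediate_value hx hy (bPhi_continuous hν).continuousOn
    obtain ⟨z, hz, hz'⟩ := hc ⟨hx', hy'⟩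
    exact hne z hz hz'
  rcases hsign with h | h
  · refine sturm_aux (w := bw ν p) (w1 := bw1 ν p) (s := s)
      (fun x hx => bw_hasDerivAt hν (hx0 x hx)) (fun x hx => bw1_hasDerivAt hν hp2 (hx0 x hx)) ?_ ?_
    · intro x hx
      have : 0 < bw ν p x := mul_pos (Real.rpow_pos_of_pos (hx0 x hx) _) (h x hx)
      nlinarith [hQ x hx]
    · intro x hx
      exact mul_pos (Real.rpow_pos_of_pos (hx0 x hx) _) (h x hx)
  · have hb : ∀ x ∈ Set.Icc s (s + 2 * π), 0 < -bw ν p x := fun x hx => by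
      have := mul_neg_of_pos_of_neg (Real.rpow_pos_of_pos (hx0 x hx) p) (h x hx)
      rw [bw]; linarith
    refine sturm_aux (w := fun x => -bw ν p x) (w1 := fun x => -bw1 ν p x) (s := s)
      (fun x hx => (bw_hasDerivAt hν (hx0 x hx)).neg)
      (fun x hx => (bw1_hasDerivAt hν hp2 (hx0 x hx)).neg) ?_ hb
    intro x hx
    nlinarith [hQ x hx, hb x hx]

/-- everything needed about the Bessel zeros -/
structure BesselPack (p j1 j2 : ℝ) (Φ q v v1 : ℝ → ℝ) : Prop where
  j1_pos : 0 < j1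
  j12 : j1 < j2
  dΦ : ∀ x, HasDerivAt Φ (x * q x) x
  dΦ1 : ∀ x, HasDerivAt (fun x => x * q x) (-(Φ x) - 2 * p * q x) x
  Φ_pos : ∀ x ∈ Set.Ico 0 j1, 0 < Φ x
  Φ_j1 : Φ j1 = 0
  q_nonpos : ∀ x ∈ Set.Ioc 0 j1, q x ≤ 0
  dv : ∀ x, 0 < x → HasDerivAt v (v1 x) x
  dv1 : ∀ x, 0 < x → HasDerivAt v1 (-(1 - (p ^ 2 - p) / x ^ 2) * v x) x
  v_j1 : v j1 = 0
  v_j2 : v j2 = 0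
  v_pos : ∀ x ∈ Set.Ioo j1 j2, 0 < v x
  c_le : p ^ 2 - p ≤ j1 ^ 2

theorem bessel_pack {n : ℕ} (hn : 2 ≤ n) : ∃ Φ q v v1, BesselPack (n / 2 : ℝ)
    (besselZero1 (((n : ℝ) - 1) / 2)) (besselZero2 (((n : ℝ) - 1) / 2)) Φ q v v1 := by
  have hn' : (2 : ℝ) ≤ n := by exact_mod_cast hn
  set ν : ℝ := ((n : ℝ) - 1) / 2 with hνd
  have hν : 0 ≤ ν := by rw [hνd]; linarith
  set p : ℝ := (n : ℝ) / 2 with hpd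
  have hp2 : 2 * p = 2 * ν + 1 := by rw [hpd, hνd]; ring
  have hp1 : 1 ≤ p := by rw [hpd]; linarith
  have hc := bPhi_continuous hν
  have hset : ∀ S : ℝ, 0 ≤ S → {x : ℝ | S < x ∧ besselJ ν x = 0} = {x | S < x ∧ bPhi ν x = 0} := by
    intro S hS
    ext x
    simp only [Set.mem_ofPred_eq]
    refine and_congr_right fun hx => ?_
    have hx0 : 0 < x := hS.trans_lt hx
    rw [besselJ_eq hx0]
    have := (Real.rpow_pos_of_pos (half_pos hx0) ν).ne'
    simp [this]
  have hne : ∀ S : ℝ, {x : ℝ | S < x ∧ bPhi ν x = 0}.Nonempty := fun S => by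
    obtain ⟨x, h1, -, h3⟩ := bPhi_zero_exists hν S
    exact ⟨x, h1, h3⟩
  have hbb : ∀ S : ℝ, BddBelow {x : ℝ | S < x ∧ bPhi ν x = 0} := fun S => ⟨S, fun x hx => hx.1.le⟩
  -- general attaining fact
  have hatt : ∀ S : ℝ, (∃ δ > 0, ∀ x ∈ Set.Ioo S (S + δ), bPhi ν x ≠ 0) →
      S < sInf {x : ℝ | S < x ∧ bPhi ν x = 0} ∧ bPhi ν (sInf {x : ℝ | S < x ∧ bPhi ν x = 0}) = 0 := by
    rintro S ⟨δ, hδ, hd⟩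
    have hlow : ∀ x ∈ {x : ℝ | S < x ∧ bPhi ν x = 0}, S + δ ≤ x := by
      intro x hx
      by_contra h
      exact hd x ⟨hx.1, not_le.1 h⟩ hx.2
    have heq : {x : ℝ | S < x ∧ bPhi ν x = 0} = {x | S + δ ≤ x} ∩ {x | bPhi ν x = 0} := by
      ext x; constructor
      · intro hx; exact ⟨hlow x hx, hx.2⟩
      · intro hx
        have : S + δ ≤ x := hx.1
        exact ⟨by linarith, hx.2⟩
    have hcl : IsClosed {x : ℝ | S < x ∧ bPhi ν x = 0} := by
      rw [heq]
      exact (isClosed_le continuous_const continuous_id).inter (isClosed_eq hc continuous_const)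
    exact hcl.csInf_mem (hne S) (hbb S)
  set j1 := besselZero1 ν with hj1
  have hj1e : j1 = sInf {x : ℝ | 0 < x ∧ bPhi ν x = 0} := by
    rw [hj1, besselZero1, hset 0 le_rfl]
  have hΦ0 := bPhi_zero_pos hν
  have ha1 : 0 < j1 ∧ bPhi ν j1 = 0 := by
    rw [hj1e]
    refine hatt 0 ?_
    have : ∀ᶠ x in nhds (0 : ℝ), 0 < bPhi ν x := hc.continuousAt.eventually (lt_mem_nhds hΦ0)
    obtain ⟨δ, hδ, h⟩ := Metric.eventually_nhds_iff.1 this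
    refine ⟨δ, hδ, fun x hx => (h ?_).ne'⟩
    rw [Real.dist_eq, sub_zero, abs_of_pos hx.1]; linarith [hx.2]
  obtain ⟨hj1p, hj1z⟩ := ha1
  have hΦpos : ∀ x ∈ Set.Ico 0 j1, 0 < bPhi ν x := by
    intro x hx
    by_contra h
    obtain ⟨z, hz, hz'⟩ := intermediate_value_Icc' hx.1 hc.continuousOn ⟨not_lt.1 h, hΦ0.le⟩
    have hz0 : 0 < z := lt_of_le_of_ne hz.1 (by rintro rfl; exact hΦ0.ne' hz')
    have : j1 ≤ z := by rw [hj1e]; exact csInf_le (hbb 0) ⟨hz0, hz'⟩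
    linarith [hz.2, hx.2]
  -- q < 0
  have hq : ∀ x ∈ Set.Ioc 0 j1, bQ ν x < 0 := by
    have hG : ∀ x, HasDerivAt (fun x => x ^ n * (x * bQ ν x)) (-(x ^ n * bPhi ν x)) x := by
      intro x
      have := (hasDerivAt_pow n x).mul (bPhi_hasDerivAt2 hν x)
      refine this.congr_deriv ?_
      have e : x ^ n = x ^ (n - 1) * x := by rw [← pow_succ]; congr 1; omega
      have e2 : 2 * ν + 1 = n := by rw [hνd]; ring
      rw [e, e2]; ring
    have hanti : StrictAntiOn (fun x => x ^ n * (x * bQ ν x)) (Set.Icc 0 j1) := by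
      apply strictAntiOn_of_deriv_neg (convex_Icc _ _)
      · exact fun x _ => (hG x).continuousAt.continuousWithinAt
      · intro x hx
        rw [interior_Icc] at hx
        rw [(hG x).deriv]
        have := mul_pos (pow_pos hx.1 n) (hΦpos x ⟨hx.1.le, hx.2⟩)
        linarith
    intro x hx
    have := hanti ⟨le_rfl, hj1p.le⟩ ⟨hx.1.le, hx.2⟩ hx.1
    simp only [zero_mul, mul_zero] at this
    rw [← mul_assoc] at this
    by_contra h
    have := mul_nonneg (mul_pos (pow_pos hx.1 n) hx.1).le (not_lt.1 h)
    linarith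
  -- j2
  have hneg : ∃ δ > 0, ∀ x ∈ Set.Ioo j1 (j1 + δ), bPhi ν x < 0 := by
    have hd := bPhi_hasDerivAt hν j1
    have hlt : j1 * bQ ν j1 < 0 := mul_neg_of_pos_of_neg hj1p (hq j1 ⟨hj1p, le_rfl⟩)
    have h1 : ∀ᶠ x in nhdsWithin j1 (Set.Ioi j1), slope (bPhi ν) j1 x < 0 :=
      (hasDerivAt_iff_tendsto_slope.1 hd).eventually (gt_mem_nhds hlt) |>.filter_mono
        (nhdsWithin_mono _ (fun x hx => ne_of_gt hx))
    obtain ⟨u, hu, h⟩ := (mem_nhdsGT_iff_exists_Ioo_subset).1 h1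
    refine ⟨u - j1, by simpa using hu, fun x hx => ?_⟩
    have hx' : x ∈ Set.Ioo j1 u := ⟨hx.1, by linarith [hx.2]⟩
    have := h hx'
    simp only [Set.mem_ofPred_eq, slope_def_field, hj1z, sub_zero] at this
    by_contra h0
    have := div_nonneg (not_lt.1 h0) (sub_pos.2 hx.1).le
    linarith
  have hj2e : besselZero2 ν = sInf {x : ℝ | j1 < x ∧ bPhi ν x = 0} := by
    rw [besselZero2, ← hj1, hset j1 hj1p.le]
  obtain ⟨δ, hδ, hδn⟩ := hneg
  obtain ⟨hj12, hj2z⟩ := hatt j1 ⟨δ, hδ, fun x hx => (hδn x hx).ne⟩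
  rw [← hj2e] at hj12 hj2z
  set j2 := besselZero2 ν with hj2
  have hΦneg : ∀ x ∈ Set.Ioo j1 j2, bPhi ν x < 0 := by
    intro x hx
    by_contra h
    set y := min (j1 + δ / 2) x with hy
    have hy1 : j1 < y := lt_min (by linarith) hx.1
    have hy2 : y < j1 + δ := (min_le_left _ _).trans_lt (by linarith)
    have hyx : y ≤ x := min_le_right _ _
    obtain ⟨z, hz, hz'⟩ := intermediate_value_Icc hyx hc.continuousOn
      ⟨(hδn y ⟨hy1, hy2⟩).le, not_lt.1 h⟩
    have : j2 ≤ z := by rw [hj2e]; exact csInf_le (hbb _) ⟨by linarith [hz.1], hz'⟩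
    linarith [hz.2, hx.2]
  refine ⟨bPhi ν, bQ ν, fun x => - bw ν p x, fun x => - bw1 ν p x, ?_⟩
  refine ⟨hj1p, hj12, bPhi_hasDerivAt hν, ?_, hΦpos, hj1z, fun x hx => (hq x hx).le, ?_, ?_, ?_, ?_, ?_, ?_⟩
  · intro x; rw [hp2]; exact bPhi_hasDerivAt2 hν x
  · intro x hx; exact (bw_hasDerivAt hν hx).neg
  · intro x hx; exact (bw1_hasDerivAt hν hp2 hx).neg.congr_deriv (by ring)
  · simp [bw, hj1z]
  · simp [bw, hj2z]
  · intro x hx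
    have := mul_neg_of_pos_of_neg (Real.rpow_pos_of_pos (hj1p.trans hx.1) p) (hΦneg x hx)
    simp only [bw]; linarith
  · by_contra hcon
    push Not at hcon
    have hconv : ConvexOn ℝ (Set.Icc 0 j1) (bw ν p) := by
      apply convexOn_of_hasDerivWithinAt2_nonneg (f' := bw1 ν p)
        (f'' := fun x => -(1 - (p ^ 2 - p) / x ^ 2) * bw ν p x) (convex_Icc _ _)
      · refine ContinuousOn.mul ?_ hc.continuousOn
        exact (Real.continuous_rpow_const (by linarith)).continuousOn
      · intro x hx; rw [interior_Icc] at hx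
        exact (bw_hasDerivAt hν hx.1).hasDerivWithinAt
      · intro x hx; rw [interior_Icc] at hx
        exact (bw1_hasDerivAt hν hp2 hx.1).hasDerivWithinAt
      · intro x hx; rw [interior_Icc] at hx
        have h1 : 0 < bw ν p x := mul_pos (Real.rpow_pos_of_pos hx.1 p) (hΦpos x ⟨hx.1.le, hx.2⟩)
        have h2 : 1 ≤ (p ^ 2 - p) / x ^ 2 := by
          rw [le_div_iff₀ (by have := hx.1; positivity)]
          nlinarith [hx.1, hx.2]
        exact mul_nonneg (by linarith) h1.le
    have hm0 : (0 : ℝ) ∈ Set.Icc 0 j1 := ⟨le_rfl, hj1p.le⟩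
    have hm1 : j1 ∈ Set.Icc 0 j1 := ⟨hj1p.le, le_rfl⟩
    have h := hconv.2 hm0 hm1
      (show (0 : ℝ) ≤ 1 / 2 by norm_num) (show (0 : ℝ) ≤ 1 / 2 by norm_num) (by norm_num)
    have e0 : bw ν p 0 = 0 := by simp [bw, Real.zero_rpow (by linarith : p ≠ 0)]
    have e1 : bw ν p j1 = 0 := by simp [bw, hj1z]
    simp only [smul_eq_mul, mul_zero, zero_add, e0, e1] at h
    have : 0 < bw ν p (1 / 2 * j1) := mul_pos (Real.rpow_pos_of_pos (by positivity) p)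
      (hΦpos _ ⟨by positivity, by linarith⟩)
    linarith

end

section
structure Piece (l : ℝ → ℝ) (s t : ℝ) (f g : ℝ → ℝ) : Prop where
  cf : ContinuousOn f (Set.Icc s t)
  cg : ContinuousOn g (Set.Icc s t)
  df : ∀ x ∈ Set.Ioo s t, HasDerivAt f (g x) x
  fpos : ∀ x ∈ Set.Ioo s t, 0 < f x
  int : ∫ x in s..t, (g x ^ 2 - f x ^ 2) * l x ≤ 0

theorem Piece.reflect {l : ℝ → ℝ} {s t D : ℝ} {f g : ℝ → ℝ}
    (h : Piece (fun x => l (D - x)) s t f g) :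
    Piece l (D - t) (D - s) (fun x => f (D - x)) (fun x => - g (D - x)) := by
  have hm : Set.MapsTo (fun x => D - x) (Set.Icc (D - t) (D - s)) (Set.Icc s t) := by
    intro x hx; exact ⟨by linarith [hx.2], by linarith [hx.1]⟩
  have hm' : Set.MapsTo (fun x => D - x) (Set.Ioo (D - t) (D - s)) (Set.Ioo s t) := by
    intro x hx; exact ⟨by linarith [hx.2], by linarith [hx.1]⟩
  refine ⟨h.cf.comp (by fun_prop) hm, (h.cg.comp (by fun_prop) hm).neg, ?_, fun x hx => h.fpos _ (hm' hx), ?_⟩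
  · intro x hx
    have h1 : HasDerivAt (fun x => D - x) (-1) x := by
      simpa using (hasDerivAt_id x).const_sub D
    exact ((h.df _ (hm' hx)).comp x h1).congr_deriv (by ring)
  · have := h.int
    have e := intervalIntegral.integral_comp_sub_left (a := D - t) (b := D - s)
      (fun x => (g x ^ 2 - f x ^ 2) * l (D - x)) D
    simp only [sub_sub_cancel] at e
    simp only [neg_sq]
    rw [e]; exact this

theorem concave_div_antitone {h : ℝ → ℝ} {D : ℝ} (hc : ConcaveOn ℝ (Set.Ioo 0 D) h)
    (hpos : ∀ x ∈ Set.Ioo 0 D, 0 < h x) {x y : ℝ} (hx : x ∈ Set.Ioo 0 D) (hy : y ∈ Set.Ioo 0 D)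
    (hxy : x ≤ y) : h y / y ≤ h x / x := by
  rcases hxy.eq_or_lt with rfl | hlt
  · exact le_rfl
  rw [div_le_div_iff₀ hy.1 hx.1]
  have key : ∀ ε ∈ Set.Ioo 0 x, h y * (x - ε) ≤ h x * (y - ε) := by
    intro ε hε
    have hεD : ε ∈ Set.Ioo 0 D := ⟨hε.1, hε.2.trans hx.2⟩
    have h1 := hc.2 hεD hy
      (show 0 ≤ (y - x) / (y - ε) from div_nonneg (by linarith) (by linarith [hε.2]))
      (show 0 ≤ (x - ε) / (y - ε) from div_nonneg (by linarith [hε.2]) (by linarith [hε.2]))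
      (by have : y - ε ≠ 0 := by linarith [hε.2]
          field_simp; ring)
    have hne : y - ε ≠ 0 := by linarith [hε.2]
    have hp : 0 < y - ε := by linarith [hε.2]
    have e : ((y - x) / (y - ε)) • ε + ((x - ε) / (y - ε)) • y = x := by
      simp only [smul_eq_mul]; field_simp; ring
    rw [e] at h1
    simp only [smul_eq_mul] at h1
    have h2 : 0 ≤ (y - x) / (y - ε) * h ε :=
      mul_nonneg (div_nonneg (by linarith) hp.le) (hpos ε hεD).le
    have h3 : (x - ε) / (y - ε) * h y ≤ h x := by linarith
    rw [div_mul_eq_mul_div, div_le_iff₀ hp] at h3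
    linarith
  have hcont : Tendsto (fun ε : ℝ => h x * (y - ε) - h y * (x - ε)) (nhdsWithin 0 (Set.Ioi 0))
      (nhds (h x * (y - 0) - h y * (x - 0))) := by
    apply Tendsto.mono_left _ nhdsWithin_le_nhds
    exact (Continuous.tendsto (by fun_prop) 0)
  have := ge_of_tendsto (b := 0) hcont (by
    filter_upwards [Ioo_mem_nhdsGT hx.1] with ε hε
    linarith [key ε hε])
  linarith

theorem left_piece {n : ℕ} {p j1 j2 : ℝ} {Φ q v v1 : ℝ → ℝ} (hn : 2 ≤ n) (hp : 2 * p = n)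
    (B : BesselPack p j1 j2 Φ q v v1) {D H : ℝ} (hD : j1 < D) {h : ℝ → ℝ}
    (hc : ConcaveOn ℝ (Set.Ioo 0 D) h) (hpos : ∀ x ∈ Set.Ioo 0 D, 0 < h x ∧ h x ≤ H) :
    Piece (fun x => h x ^ n) 0 j1 Φ (fun x => x * q x) := by
  have cΦ : Continuous Φ := continuous_iff_continuousAt.2 fun x => (B.dΦ x).continuousAt
  have cg : Continuous fun x => x * q x := continuous_iff_continuousAt.2 fun x => (B.dΦ1 x).continuousAt
  refine ⟨cΦ.continuousOn, cg.continuousOn, fun x _ => B.dΦ x, fun x hx => B.Φ_pos x ⟨hx.1.le, hx.2⟩, ?_⟩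
  have hj := B.j1_pos
  set F : ℝ → ℝ := fun x => Φ x * (x ^ n * (x * q x)) with hF
  set k : ℝ → ℝ := fun x => ((x * q x) ^ 2 - Φ x ^ 2) * x ^ n with hk
  have ck : Continuous k := by rw [hk]; exact ((cg.pow 2).sub (cΦ.pow 2)).mul (continuous_pow n)
  have hFk : ∀ x, HasDerivAt F (k x) x := by
    intro x
    have := (B.dΦ x).mul ((hasDerivAt_pow n x).mul (B.dΦ1 x))
    refine this.congr_deriv ?_
    have e : x ^ n = x ^ (n - 1) * x := by rw [← pow_succ]; congr 1; omega
    simp only [hk, Pi.mul_apply]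
    rw [hp, e]; ring
  have hFle : ∀ x ∈ Set.Icc 0 j1, F x ≤ 0 := by
    intro x hx
    rcases hx.1.eq_or_lt with rfl | h0
    · simp [hF]
    · have h1 : 0 ≤ Φ x := by
        rcases hx.2.eq_or_lt with rfl | h2
        · exact B.Φ_j1.ge
        · exact (B.Φ_pos x ⟨hx.1, h2⟩).le
      have h2 := B.q_nonpos x ⟨h0, hx.2⟩
      refine mul_nonpos_of_nonneg_of_nonpos h1 ?_
      exact mul_nonpos_of_nonneg_of_nonpos (pow_nonneg hx.1 n) (mul_nonpos_of_nonneg_of_nonpos hx.1 h2)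
  have hFint : ∀ s, ∫ x in (0 : ℝ)..s, k x = F s - F 0 := fun s =>
    intervalIntegral.integral_eq_sub_of_hasDerivAt (fun x _ => hFk x) (ck.intervalIntegrable _ _)
  have hF0 : F 0 = 0 := by simp [hF]
  have hHpos : 0 ≤ H := by
    have := hpos j1 ⟨hj, hD⟩; linarith
  have hmem : ∀ x, 0 < x → x ≤ j1 → x ∈ Set.Ioo 0 D := fun x h1 h2 => ⟨h1, by linarith⟩
  let ρ : ℝ → ℝ := fun x => (h x / x) ^ n
  have hρanti : ∀ x y, 0 < x → x ≤ y → y ≤ j1 → ρ y ≤ ρ x := by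
    intro x y h0 hxy hy
    have hy' := hmem y (h0.trans_le hxy) hy
    exact pow_le_pow_left₀ (div_nonneg (hpos y hy').1.le hy'.1.le)
      (concave_div_antitone hc (fun z hz => (hpos z hz).1) (hmem x h0 (hxy.trans hy)) hy' hxy) n
  -- approximations
  let η : ℕ → ℝ := fun m => j1 / (m + 1)
  have hη0 : ∀ m, 0 < η m := fun m => by positivity
  have hηj : ∀ m, η m ≤ j1 := fun m => by
    apply div_le_self hj.le; have : (0:ℝ) ≤ m := Nat.cast_nonneg m; linarith
  have happ : ∀ m, ∫ x in (0:ℝ)..j1, ρ (max x (η m)) * k x ≤ 0 := by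
    intro m
    refine anti_lemma hj.le ?_ ?_ (ck.intervalIntegrable _ _) ?_
    · intro x hx y hy hxy
      exact hρanti _ _ (lt_max_of_lt_right (hη0 m)) (max_le_max hxy le_rfl) (max_le hy.2 (hηj m))
    · rw [max_eq_left (hηj m)]
      exact pow_nonneg (div_nonneg (hpos j1 ⟨hj, hD⟩).1.le hj.le) n
    · intro s hs
      rw [hFint, hF0]; linarith [hFle s hs]
  have hcont : ContinuousOn h (Set.Ioo 0 D) := hc.continuousOn isOpen_Ioo
  obtain ⟨C, hC⟩ := (isCompact_Icc (a := (0:ℝ)) (b := j1)).exists_bound_of_continuousOn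
    (((cg.pow 2).sub (cΦ.pow 2)).continuousOn)
  have hlim : Tendsto (fun m => ∫ x in (0:ℝ)..j1, ρ (max x (η m)) * k x) atTop
      (nhds (∫ x in (0:ℝ)..j1, ((x * q x) ^ 2 - Φ x ^ 2) * h x ^ n)) := by
    refine intervalIntegral.tendsto_integral_filter_of_dominated_convergence
      (bound := fun _ => C * H ^ n) ?_ ?_ ?_ ?_
    · refine Eventually.of_forall fun m => ?_
      rw [Set.uIoc_of_le hj.le]
      refine ContinuousOn.aestronglyMeasurable ?_ measurableSet_Ioc
      refine ContinuousOn.mul ?_ ck.continuousOn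
      have hmm : Set.MapsTo (fun x => max x (η m)) (Set.Ioc 0 j1) (Set.Ioo 0 D) := fun x hx =>
        hmem _ (lt_max_of_lt_right (hη0 m)) (max_le hx.2 (hηj m))
      refine ContinuousOn.pow ?_ n
      refine ContinuousOn.div (hcont.comp (by fun_prop) hmm) (by fun_prop) ?_
      intro x hx; exact (hmm hx).1.ne'
    · refine Eventually.of_forall fun m => Eventually.of_forall fun x hx => ?_
      rw [Set.uIoc_of_le hj.le] at hx
      have hxD := hmem x hx.1 hx.2
      have h1 : ρ (max x (η m)) ≤ ρ x := hρanti _ _ hx.1 (le_max_left _ _) (max_le hx.2 (hηj m))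
      have h2 : 0 ≤ ρ (max x (η m)) := by
        have := hmem (max x (η m)) (lt_max_of_lt_right (hη0 m)) (max_le hx.2 (hηj m))
        exact pow_nonneg (div_nonneg (hpos _ this).1.le this.1.le) n
      have h3 : ρ x * x ^ n = h x ^ n := by
        simp only [ρ, div_pow]; field_simp [hx.1.ne']
      have h4 := hC x ⟨hx.1.le, hx.2⟩
      rw [norm_mul, Real.norm_eq_abs, abs_of_nonneg h2]
      have h5 : ‖k x‖ = ‖(x * q x) ^ 2 - Φ x ^ 2‖ * x ^ n := by
        rw [hk, norm_mul, norm_pow, Real.norm_of_nonneg hx.1.le]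
      rw [h5]
      calc _ ≤ ρ x * (‖(x * q x) ^ 2 - Φ x ^ 2‖ * x ^ n) := by
            have := pow_nonneg hx.1.le n
            gcongr
        _ = ‖(x * q x) ^ 2 - Φ x ^ 2‖ * h x ^ n := by rw [← h3]; ring
        _ ≤ _ := by
            have := hpos x hxD
            have h6 := this.1.le
            have h7 := this.2
            have hC0 : 0 ≤ C := (norm_nonneg _).trans h4
            exact mul_le_mul h4 (pow_le_pow_left₀ h6 h7 n) (pow_nonneg h6 n) hC0
    · simp
    · refine Eventually.of_forall fun x hx => ?_
      rw [Set.uIoc_of_le hj.le] at hx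
      refine tendsto_const_nhds.congr' ?_
      have hη : Tendsto η atTop (nhds 0) := tendsto_const_div_atTop_nhds_zero_nat j1 |>.comp (tendsto_add_atTop_nat 1) |>.congr (fun m => by simp [η])
      filter_upwards [hη.eventually (gt_mem_nhds hx.1)] with m hm
      rw [max_eq_left hm.le]
      simp only [ρ, hk, div_pow]
      field_simp [hx.1.ne']
  exact le_of_tendsto hlim (Eventually.of_forall happ)

theorem ratio_mono {h : ℝ → ℝ} {A B y m : ℝ} (hc : ConcaveOn ℝ (Set.Icc A B) h)
    (hpos : ∀ x ∈ Set.Icc A B, 0 < h x) (hy : y ∈ Set.Icc A B)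
    (hle : ∀ x ∈ Set.Icc A B, h x ≤ h y + m * (x - y)) {x z : ℝ} (hx : x ∈ Set.Icc A B)
    (hz : z ∈ Set.Icc A B) (t : ℝ) (ht : 0 ≤ t) (ht1 : t ≤ 1) (hzt : z = (1 - t) * x + t * y) :
    h x / (h y + m * (x - y)) ≤ h z / (h y + m * (z - y)) := by
  have hx0 : 0 < h y + m * (x - y) := (hpos x hx).trans_le (hle x hx)
  have hz0 : 0 < h y + m * (z - y) := (hpos z hz).trans_le (hle z hz)
  have h1 := hc.2 hx hy (sub_nonneg.2 ht1) ht (by ring)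
  simp only [smul_eq_mul] at h1
  rw [← hzt] at h1
  rw [div_le_div_iff₀ hx0 hz0]
  have e : h y + m * (z - y) = (1 - t) * (h y + m * (x - y)) + t * h y := by rw [hzt]; ring
  rw [e]
  have h2 := hle x hx
  have h3 := hpos y hy
  have : h x * (t * h y) ≤ (h y + m * (x - y)) * (t * h y) := by gcongr
  nlinarith

theorem middle_piece {n : ℕ} {p A B y m : ℝ} (hp : 2 * p = n) (hAB : A < B) {h v v1 v2 : ℝ → ℝ}
    (hy : y ∈ Set.Icc A B) (hcont : ContinuousOn h (Set.Icc A B)) (hc : ConcaveOn ℝ (Set.Icc A B) h)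
    (hpos : ∀ x ∈ Set.Icc A B, 0 < h x)
    (hle : ∀ x ∈ Set.Icc A B, h x ≤ h y + m * (x - y))
    (dv : ∀ x ∈ Set.Icc A B, HasDerivAt v (v1 x) x) (dv1 : ∀ x ∈ Set.Icc A B, HasDerivAt v1 (v2 x) x)
    (cv2 : ContinuousOn v2 (Set.Icc A B)) (vA : v A = 0) (vB : v B = 0)
    (vpos : ∀ x ∈ Set.Ioo A B, 0 < v x)
    (ode : ∀ x ∈ Set.Icc A B, (p ^ 2 - p) * (m / (h y + m * (x - y))) ^ 2 * v x ≤ v2 x + v x)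
    (hr1 : ∀ x ∈ Set.Icc A y, 0 ≤ v1 x * (h y + m * (x - y)) - p * m * v x)
    (hr2 : ∀ x ∈ Set.Icc y B, v1 x * (h y + m * (x - y)) - p * m * v x ≤ 0) :
    ∃ f g, Piece (fun x => h x ^ n) A B f g ∧ f A = 0 ∧ f B = 0 := by
  set h0 : ℝ → ℝ := fun x => h y + m * (x - y) with hh0
  have h0pos : ∀ x ∈ Set.Icc A B, 0 < h0 x := fun x hx => (hpos x hx).trans_le (hle x hx)
  have dh0 : ∀ x, HasDerivAt h0 m x := fun x => by
    have := (((hasDerivAt_id x).sub_const y).const_mul m).const_add (h y)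
    exact this.congr_deriv (by simp)
  have ch0 : Continuous h0 := by rw [hh0]; fun_prop
  have cv : ContinuousOn v (Set.Icc A B) := fun x hx => (dv x hx).continuousAt.continuousWithinAt
  have cv1 : ContinuousOn v1 (Set.Icc A B) := fun x hx => (dv1 x hx).continuousAt.continuousWithinAt
  have vnn : ∀ x ∈ Set.Icc A B, 0 ≤ v x := by
    intro x hx
    rcases hx.1.eq_or_lt with rfl | h1
    · exact vA.ge
    rcases hx.2.eq_or_lt with rfl | h2
    · exact vB.ge
    exact (vpos x ⟨h1, h2⟩).le
  set κ : ℝ → ℝ := fun x => m / h0 x with hκ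
  have cκ : ContinuousOn κ (Set.Icc A B) :=
    continuousOn_const.div ch0.continuousOn fun x hx => (h0pos x hx).ne'
  have dκ : ∀ x ∈ Set.Icc A B, HasDerivAt κ (-(κ x) ^ 2) x := by
    intro x hx
    have := (hasDerivAt_const x m).div (dh0 x) (h0pos x hx).ne'
    refine this.congr_deriv ?_
    simp only [hκ]; ring
  set G : ℝ → ℝ := fun x => v1 x - p * κ x * v x with hG
  have cG : ContinuousOn G (Set.Icc A B) := cv1.sub ((continuousOn_const.mul cκ).mul cv)
  set F : ℝ → ℝ := fun x => v x * G x with hF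
  set k : ℝ → ℝ := fun x => v1 x * G x + v x * (v2 x - p * (-(κ x) ^ 2 * v x + κ x * v1 x)) with hk
  have ck : ContinuousOn k (Set.Icc A B) := by
    refine (cv1.mul cG).add (cv.mul (cv2.sub (continuousOn_const.mul ?_)))
    exact ((cκ.pow 2).neg.mul cv).add (cκ.mul cv1)
  have dF : ∀ x ∈ Set.Icc A B, HasDerivAt F (k x) x := by
    intro x hx
    have hG' : HasDerivAt G (v2 x - p * (-(κ x) ^ 2 * v x + κ x * v1 x)) x := by
      have := (dv1 x hx).sub ((((dκ x hx).const_mul p)).mul (dv x hx))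
      exact this.congr_deriv (by ring)
    exact (dv x hx).mul hG'
  have hGr : ∀ x ∈ Set.Icc A B, G x = (v1 x * h0 x - p * m * v x) / h0 x := by
    intro x hx
    have := (h0pos x hx).ne'
    simp only [hG, hκ]; field_simp
  have hF1 : ∀ x ∈ Set.Icc A y, 0 ≤ F x := by
    intro x hx
    have hx' : x ∈ Set.Icc A B := ⟨hx.1, hx.2.trans hy.2⟩
    refine mul_nonneg (vnn x hx') ?_
    rw [hGr x hx']; exact div_nonneg (hr1 x hx) (h0pos x hx').le
  have hF2 : ∀ x ∈ Set.Icc y B, F x ≤ 0 := by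
    intro x hx
    have hx' : x ∈ Set.Icc A B := ⟨hy.1.trans hx.1, hx.2⟩
    refine mul_nonpos_of_nonneg_of_nonpos (vnn x hx') ?_
    rw [hGr x hx']; exact div_nonpos_of_nonpos_of_nonneg (hr2 x hx) (h0pos x hx').le
  have hFy : F y = 0 := le_antisymm (hF2 y ⟨le_rfl, hy.2⟩) (hF1 y ⟨hy.1, le_rfl⟩)
  have hsub : ∀ s t, s ∈ Set.Icc A B → t ∈ Set.Icc A B → s ≤ t → Set.uIcc s t ⊆ Set.Icc A B := by
    intro s t hs ht hst
    rw [Set.uIcc_of_le hst]; exact Set.Icc_subset_Icc hs.1 ht.2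
  have kint : ∀ s t, s ∈ Set.Icc A B → t ∈ Set.Icc A B → s ≤ t → IntervalIntegrable k volume s t := by
    intro s t hs ht hst
    exact (ck.mono (hsub s t hs ht hst)).intervalIntegrable
  have hFint : ∀ s t, s ∈ Set.Icc A B → t ∈ Set.Icc A B → s ≤ t → ∫ x in s..t, k x = F t - F s := by
    intro s t hs ht hst
    exact intervalIntegral.integral_eq_sub_of_hasDerivAt (fun x hx => dF x (hsub s t hs ht hst hx))
      (kint s t hs ht hst)
  have hA : A ∈ Set.Icc A B := ⟨le_rfl, hAB.le⟩
  have hB : B ∈ Set.Icc A B := ⟨hAB.le, le_rfl⟩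
  let ρ : ℝ → ℝ := fun x => (h x / h0 x) ^ n
  have ρnn : ∀ x ∈ Set.Icc A B, 0 ≤ ρ x := fun x hx => pow_nonneg (div_nonneg (hpos x hx).le (h0pos x hx).le) n
  have cρ : ContinuousOn ρ (Set.Icc A B) :=
    (hcont.div ch0.continuousOn fun x hx => (h0pos x hx).ne').pow n
  have i1 : ∫ x in A..y, ρ x * k x ≤ 0 := by
    refine mono_lemma hy.1 ?_ (ρnn A hA) (kint _ _ hA hy hy.1) ?_
    · intro x hx z hz hxz
      have hx' : x ∈ Set.Icc A B := ⟨hx.1, hx.2.trans hy.2⟩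
      have hz' : z ∈ Set.Icc A B := ⟨hz.1, hz.2.trans hy.2⟩
      refine pow_le_pow_left₀ (div_nonneg (hpos x hx').le (h0pos x hx').le) ?_ n
      rcases hx.2.eq_or_lt with h1 | h1
      · have : x = z := le_antisymm hxz (h1 ▸ hz.2)
        rw [this]
      · have hne : y - x ≠ 0 := by linarith
        refine ratio_mono hc hpos hy hle hx' hz' ((z - x) / (y - x)) (div_nonneg (by linarith) (by linarith))
          ((div_le_one (by linarith)).2 (by linarith [hz.2])) ?_
        field_simp; ring
    · intro s hs
      have hs' : s ∈ Set.Icc A B := ⟨hs.1, hs.2.trans hy.2⟩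
      rw [hFint s y hs' hy hs.2, hFy]; linarith [hF1 s hs]
  have i2 : ∫ x in y..B, ρ x * k x ≤ 0 := by
    refine anti_lemma hy.2 ?_ (ρnn B hB) (kint _ _ hy hB hy.2) ?_
    · intro z hz x hx hxz
      have hx' : x ∈ Set.Icc A B := ⟨hy.1.trans hx.1, hx.2⟩
      have hz' : z ∈ Set.Icc A B := ⟨hy.1.trans hz.1, hz.2⟩
      refine pow_le_pow_left₀ (div_nonneg (hpos x hx').le (h0pos x hx').le) ?_ n
      rcases hx.1.eq_or_lt with h1 | h1
      · have : x = z := le_antisymm (h1 ▸ hz.1) hxz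
        rw [this]
      · have hne : x - y ≠ 0 := by linarith
        refine ratio_mono hc hpos hy hle hx' hz' ((x - z) / (x - y)) (div_nonneg (by linarith) (by linarith))
          ((div_le_one (by linarith)).2 (by linarith [hz.1])) ?_
        field_simp; ring
    · intro s hs
      have hs' : s ∈ Set.Icc A B := ⟨hy.1.trans hs.1, hs.2⟩
      rw [hFint y s hy hs' hs.1, hFy]; linarith [hF2 s hs]
  have i3 : ∫ x in A..B, ρ x * k x ≤ 0 := by
    rw [← intervalIntegral.integral_add_adjacent_intervals (b := y)]
    · linarith
    · exact ((cρ.mul ck).mono (hsub A y hA hy hy.1)).intervalIntegrable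
    · exact ((cρ.mul ck).mono (hsub y B hy hB hy.2)).intervalIntegrable
  have crp : ContinuousOn (fun x => h0 x ^ (-p)) (Set.Icc A B) :=
    ch0.continuousOn.rpow_const fun x hx => Or.inl (h0pos x hx).ne'
  refine ⟨fun x => h0 x ^ (-p) * v x, fun x => h0 x ^ (-p) * G x, ⟨crp.mul cv, crp.mul cG, ?_, ?_, ?_⟩, ?_, ?_⟩
  · intro x hx
    have hx' := Set.Ioo_subset_Icc_self hx
    have hne := (h0pos x hx').ne'
    have := ((dh0 x).rpow_const (p := -p) (Or.inl hne)).mul (dv x hx')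
    refine this.congr_deriv ?_
    rw [Real.rpow_sub_one hne]
    simp only [hG, hκ]
    field_simp; ring
  · intro x hx
    exact mul_pos (Real.rpow_pos_of_pos (h0pos x (Set.Ioo_subset_Icc_self hx)) _) (vpos x hx)
  · refine le_trans (intervalIntegral.integral_mono_on hAB.le ?_ ?_ ?_) i3
    · apply ContinuousOn.intervalIntegrable
      rw [Set.uIcc_of_le hAB.le]
      exact (((crp.mul cG).pow 2).sub ((crp.mul cv).pow 2)).mul (hcont.pow n)
    · apply ContinuousOn.intervalIntegrable
      rw [Set.uIcc_of_le hAB.le]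
      exact cρ.mul ck
    · intro x hx
      have hr : (h0 x ^ (-p)) ^ 2 = (h0 x ^ n)⁻¹ := by
        rw [← Real.rpow_natCast, ← Real.rpow_mul (h0pos x hx).le, ← Real.rpow_natCast (h0 x) n,
          ← Real.rpow_neg (h0pos x hx).le]
        congr 1; push_cast; linarith
      have e : ((h0 x ^ (-p) * G x) ^ 2 - (h0 x ^ (-p) * v x) ^ 2) * h x ^ n = ρ x * (G x ^ 2 - v x ^ 2) := by
        rw [mul_pow, mul_pow, hr]; simp only [ρ, div_pow]; ring
      rw [e]
      refine mul_le_mul_of_nonneg_left ?_ (ρnn x hx)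
      have h1 := mul_le_mul_of_nonneg_right (ode x hx) (vnn x hx)
      change (p ^ 2 - p) * (κ x) ^ 2 * v x * v x ≤ _ at h1
      simp only [hk, hG]
      nlinarith
  · simp [vA]
  · simp [vB]

end

section
theorem BesselPack.v2_nonpos {p j1 j2 : ℝ} {Φ q v v1 : ℝ → ℝ}
    (B : BesselPack p j1 j2 Φ q v v1) {x : ℝ} (hx : x ∈ Set.Icc j1 j2) :
    0 ≤ v x ∧ -(1 - (p ^ 2 - p) / x ^ 2) * v x ≤ 0 := by
  have hx0 : 0 < x := B.j1_pos.trans_le hx.1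
  have hv : 0 ≤ v x := by
    rcases hx.1.eq_or_lt with rfl | h1
    · exact B.v_j1.ge
    rcases hx.2.eq_or_lt with rfl | h2
    · exact B.v_j2.ge
    exact (B.v_pos x ⟨h1, h2⟩).le
  refine ⟨hv, ?_⟩
  have h2 : (p ^ 2 - p) / x ^ 2 ≤ 1 := by
    rw [div_le_one (by positivity)]
    exact B.c_le.trans (pow_le_pow_left₀ B.j1_pos.le hx.1 2)
  nlinarith

theorem BesselPack.v1_anti {p j1 j2 : ℝ} {Φ q v v1 : ℝ → ℝ}
    (B : BesselPack p j1 j2 Φ q v v1) : AntitoneOn v1 (Set.Icc j1 j2) := by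
  have hpos : ∀ x ∈ Set.Icc j1 j2, 0 < x := fun x hx => B.j1_pos.trans_le hx.1
  apply antitoneOn_of_deriv_nonpos (convex_Icc _ _)
  · exact fun x hx => (B.dv1 x (hpos x hx)).continuousAt.continuousWithinAt
  · intro x hx; rw [interior_Icc] at hx
    exact (B.dv1 x (hpos x (Set.Ioo_subset_Icc_self hx))).differentiableAt.differentiableWithinAt
  · intro x hx; rw [interior_Icc] at hx
    have hx' := Set.Ioo_subset_Icc_self hx
    rw [(B.dv1 x (hpos x hx')).deriv]
    exact (B.v2_nonpos hx').2

theorem BesselPack.peak {p j1 j2 : ℝ} {Φ q v v1 : ℝ → ℝ}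
    (B : BesselPack p j1 j2 Φ q v v1) : ∃ P ∈ Set.Ioo j1 j2, v1 P = 0 := by
  refine exists_hasDerivAt_eq_zero B.j12 ?_ (B.v_j1.trans B.v_j2.symm) ?_
  · exact fun x hx => (B.dv x (B.j1_pos.trans_le hx.1)).continuousAt.continuousWithinAt
  · exact fun x hx => B.dv x (B.j1_pos.trans hx.1)

theorem BesselPack.v2_cont {p j1 j2 : ℝ} {Φ q v v1 : ℝ → ℝ}
    (B : BesselPack p j1 j2 Φ q v v1) :
    ContinuousOn (fun x => -(1 - (p ^ 2 - p) / x ^ 2) * v x) (Set.Icc j1 j2) := by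
  have hpos : ∀ x ∈ Set.Icc j1 j2, 0 < x := fun x hx => B.j1_pos.trans_le hx.1
  refine ContinuousOn.mul ?_ (fun x hx => (B.dv x (hpos x hx)).continuousAt.continuousWithinAt)
  refine (continuousOn_const.sub (continuousOn_const.div (by fun_prop) ?_)).neg
  intro x hx; exact (pow_pos (hpos x hx) 2).ne'

/-- the touching argument -/
theorem touch {p D y m δ x : ℝ} {h v : ℝ → ℝ} {v1y : ℝ} (hp : 1 ≤ p)
    (hc : ConcaveOn ℝ (Set.Ioo 0 D) h) (hpos : ∀ x ∈ Set.Ioo 0 D, 0 < h x)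
    (hy : y ∈ Set.Ioo 0 D) (hx : x ∈ Set.Ioo 0 D)
    (dv : HasDerivAt v v1y y) (hvy : 0 < v y) (hm : m = h y * v1y / (p * v y))
    (hδ : 0 < δ) (hxδ : h x = h y + m * (x - y) + δ)
    (hloc : ∀ᶠ s : ℝ in nhdsWithin 0 (Set.Ioi 0), y - s * (x - y) ∈ Set.Ioo 0 D ∧
      v (y - s * (x - y)) / h (y - s * (x - y)) ^ p ≤ v y / h y ^ p) : False := by
  have hhy := hpos y hy
  set K := v y / h y ^ p with hK
  have hKpos : 0 < K := div_pos hvy (Real.rpow_pos_of_pos hhy p)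
  let E : ℝ → ℝ := fun s => K * (h y - s * (m * (x - y) + δ)) ^ p - v (y - s * (x - y))
  have hl1 : HasDerivAt (fun s : ℝ => h y - s * (m * (x - y) + δ)) (-(m * (x - y) + δ)) 0 := by
    have := ((hasDerivAt_id (0:ℝ)).mul_const (m * (x - y) + δ)).const_sub (h y)
    exact this.congr_deriv (by ring)
  have hl2 : HasDerivAt (fun s : ℝ => y - s * (x - y)) (-(x - y)) 0 := by
    have := ((hasDerivAt_id (0:ℝ)).mul_const (x - y)).const_sub y
    exact this.congr_deriv (by ring)
  have hE : HasDerivAt E (-(p * v y / h y * δ)) 0 := by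
    have a1 := (hl1.rpow_const (p := p) (Or.inr hp)).const_mul K
    have dv' : HasDerivAt v v1y (y - 0 * (x - y)) := by simpa using dv
    have a2 := HasDerivAt.comp (0:ℝ) dv' hl2
    refine (a1.sub a2).congr_deriv ?_
    simp only [zero_mul, sub_zero]
    rw [Real.rpow_sub_one hhy.ne', hK, hm]
    have : h y ^ p ≠ 0 := (Real.rpow_pos_of_pos hhy p).ne'
    have hp0 : p ≠ 0 := by linarith
    field_simp
    ring
  have hneg : -(p * v y / h y * δ) < 0 := by
    have : 0 < p * v y / h y * δ := by positivity
    linarith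
  have h0 : E 0 = 0 := by
    simp only [E, zero_mul, sub_zero, hK]
    have : h y ^ p ≠ 0 := (Real.rpow_pos_of_pos hhy p).ne'
    field_simp; ring
  have hs : ∀ᶠ s in nhdsWithin (0:ℝ) (Set.Ioi 0), slope E 0 s < 0 :=
    (hasDerivAt_iff_tendsto_slope.1 hE).eventually (gt_mem_nhds hneg) |>.filter_mono
      (nhdsWithin_mono _ (fun x hx => ne_of_gt hx))
  obtain ⟨s, hs1, hs2, hs3⟩ := (hs.and (hloc.and self_mem_nhdsWithin)).exists
  have hs0 : 0 < s := hs3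
  rw [slope_def_field, h0, sub_zero, sub_zero] at hs1
  have hEneg : E s < 0 := by
    by_contra hcon
    have := div_nonneg (not_lt.1 hcon) hs0.le
    linarith
  set z := y - s * (x - y) with hz
  have hhz := hpos z hs2.1
  have h1 := hc.2 hs2.1 hx (show 0 ≤ 1 / (1 + s) by positivity) (show 0 ≤ s / (1 + s) by positivity)
    (by field_simp)
  have e : (1 / (1 + s)) • z + (s / (1 + s)) • x = y := by
    simp only [smul_eq_mul, hz]; field_simp; ring
  rw [e] at h1
  simp only [smul_eq_mul] at h1
  have h2 : h z ≤ h y - s * (m * (x - y) + δ) := by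
    have h3 : (1 / (1 + s) * h z + s / (1 + s) * h x) * (1 + s) ≤ h y * (1 + s) := by gcongr
    have e3 : (1 / (1 + s) * h z + s / (1 + s) * h x) * (1 + s) = h z + s * h x := by
      field_simp
    rw [e3, hxδ] at h3
    nlinarith
  have h4 : v z ≤ K * h z ^ p := by
    have := hs2.2
    rwa [div_le_iff₀ (Real.rpow_pos_of_pos hhz p)] at this
  have h5 : h z ^ p ≤ (h y - s * (m * (x - y) + δ)) ^ p :=
    Real.rpow_le_rpow hhz.le h2 (by linarith)
  have : 0 ≤ E s := by
    simp only [E]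
    have := mul_le_mul_of_nonneg_left h5 hKpos.le
    linarith
  linarith

theorem line_lemma {n : ℕ} {p j1 j2 : ℝ} {Φ q v v1 : ℝ → ℝ} (hn : 2 ≤ n) (hp : 2 * p = n)
    (B : BesselPack p j1 j2 Φ q v v1) {D P : ℝ} (hD : D = j1 + j2) (hP : P ∈ Set.Ioo j1 j2)
    (hP0 : v1 P = 0) {h : ℝ → ℝ}
    (hc : ConcaveOn ℝ (Set.Ioo 0 D) h) (hpos : ∀ x ∈ Set.Ioo 0 D, 0 < h x) :
    (∃ f g, Piece (fun x => h x ^ n) j1 j2 f g ∧ f j1 = 0 ∧ f j2 = 0) ∨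
      ∀ x ∈ Set.Icc P j2, h x ≤ h P := by
  have hj1 := B.j1_pos
  have hj2 : 0 < j2 := hj1.trans B.j12
  have hn' : (2:ℝ) ≤ n := by exact_mod_cast hn
  have hp1 : 1 ≤ p := by linarith
  have hsub : Set.Icc j1 j2 ⊆ Set.Ioo 0 D := fun x hx => ⟨by linarith [hx.1], by linarith [hx.2]⟩
  have hcont : ContinuousOn h (Set.Ioo 0 D) := hc.continuousOn isOpen_Ioo
  have hPI := Set.Ioo_subset_Icc_self hP
  have hAP : Set.Icc j1 P ⊆ Set.Icc j1 j2 := Set.Icc_subset_Icc le_rfl hP.2.le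
  have cv : ContinuousOn v (Set.Icc j1 j2) := fun x hx =>
    (B.dv x (hj1.trans_le hx.1)).continuousAt.continuousWithinAt
  have ckk : ContinuousOn (fun x => v x / h x ^ p) (Set.Icc j1 P) := by
    refine (cv.mono hAP).div (((hcont.mono (hAP.trans hsub))).rpow_const ?_) ?_
    · intro x hx; exact Or.inl (hpos x (hsub (hAP hx))).ne'
    · intro x hx; exact (Real.rpow_pos_of_pos (hpos x (hsub (hAP hx))) p).ne'
  obtain ⟨y, hy, hmax⟩ := isCompact_Icc.exists_isMaxOn ⟨P, hP.1.le, le_rfl⟩ ckk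
  have hmax' : ∀ x ∈ Set.Icc j1 P, v x / h x ^ p ≤ v y / h y ^ p := fun x hx => hmax hx
  have hvP := B.v_pos P hP
  have hyj : j1 < y := by
    rcases hy.1.eq_or_lt with h1 | h1
    · exfalso
      have := hmax' P ⟨hP.1.le, le_rfl⟩
      rw [← h1, B.v_j1, zero_div] at this
      have := div_pos hvP (Real.rpow_pos_of_pos (hpos P (hsub hPI)) p)
      linarith
    · exact h1
  have hyI : y ∈ Set.Ioo j1 j2 := ⟨hyj, hy.2.trans_lt hP.2⟩
  have hyI' := Set.Ioo_subset_Icc_self hyI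
  have hyD := hsub hyI'
  have hvy := B.v_pos y hyI
  have dvy := B.dv y (hj1.trans hyj)
  set m := h y * v1 y / (p * v y) with hm
  -- continuity of the probe
  have hprobe : ∀ x, Tendsto (fun s : ℝ => y - s * (x - y)) (nhdsWithin 0 (Set.Ioi 0)) (nhds y) := by
    intro x
    have : Tendsto (fun s : ℝ => y - s * (x - y)) (nhds 0) (nhds (y - 0 * (x - y))) :=
      Continuous.tendsto (by fun_prop) 0
    simp only [zero_mul, sub_zero] at this
    exact this.mono_left nhdsWithin_le_nhds
  have hright : ∀ x ∈ Set.Ioo 0 D, y < x → h x ≤ h y + m * (x - y) := by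
    intro x hx hyx
    by_contra hcon
    push Not at hcon
    refine touch hp1 hc hpos hyD hx dvy hvy hm (δ := h x - (h y + m * (x - y))) (by linarith) (by ring) ?_
    filter_upwards [(hprobe x).eventually (lt_mem_nhds hyj), self_mem_nhdsWithin] with s hs1 hs2
    have hs2' : 0 < s := hs2
    have hz : y - s * (x - y) ∈ Set.Icc j1 P := ⟨hs1.le, by nlinarith [hy.2]⟩
    exact ⟨hsub (hAP hz), hmax' _ hz⟩
  have hv1anti := B.v1_anti
  have hv1l : ∀ x ∈ Set.Icc j1 P, 0 ≤ v1 x := fun x hx => by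
    have := hv1anti (hAP hx) hPI hx.2
    linarith
  have hv1r : ∀ x ∈ Set.Icc P j2, v1 x ≤ 0 := fun x hx => by
    have := hv1anti hPI ⟨hP.1.le.trans hx.1, hx.2⟩ hx.1
    linarith
  rcases hy.2.eq_or_lt with hyP | hyP
  · right
    have hm0 : m = 0 := by rw [hm, hyP, hP0]; simp
    intro x hx
    rcases hx.1.eq_or_lt with rfl | h1
    · exact le_rfl
    have := hright x (hsub ⟨hP.1.le.trans hx.1, hx.2⟩) (hyP ▸ h1)
    rw [hm0, zero_mul, add_zero, hyP] at this
    exact this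
  left
  have hleft : ∀ x ∈ Set.Ioo 0 D, x < y → h x ≤ h y + m * (x - y) := by
    intro x hx hyx
    by_contra hcon
    push Not at hcon
    refine touch hp1 hc hpos hyD hx dvy hvy hm (δ := h x - (h y + m * (x - y))) (by linarith) (by ring) ?_
    filter_upwards [(hprobe x).eventually (gt_mem_nhds hyP), self_mem_nhdsWithin] with s hs1 hs2
    have hs2' : 0 < s := hs2
    have hz : y - s * (x - y) ∈ Set.Icc j1 P := ⟨by nlinarith [hy.1], hs1.le⟩
    exact ⟨hsub (hAP hz), hmax' _ hz⟩
  have hall : ∀ x ∈ Set.Ioo 0 D, h x ≤ h y + m * (x - y) := by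
    intro x hx
    rcases lt_trichotomy x y with h1 | h1 | h1
    · exact hleft x hx h1
    · rw [h1]; simp
    · exact hright x hx h1
  have hm0 : 0 ≤ m := div_nonneg (mul_nonneg (hpos y hyD).le (hv1l y hy)) (by positivity)
  have h00 : 0 ≤ h y + m * (0 - y) := by
    have ht : Tendsto (fun x : ℝ => h y + m * (x - y)) (nhdsWithin 0 (Set.Ioi 0))
        (nhds (h y + m * (0 - y))) :=
      (Continuous.tendsto (by fun_prop) 0).mono_left nhdsWithin_le_nhds
    refine ge_of_tendsto ht ?_
    filter_upwards [Ioo_mem_nhdsGT (show (0:ℝ) < D by linarith)] with x hx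
    exact (hpos x hx).le.trans (hall x hx)
  have hr_anti : AntitoneOn (fun x => v1 x * (h y + m * (x - y)) - p * m * v x) (Set.Icc j1 P) := by
    have hd : ∀ x ∈ Set.Icc j1 P, HasDerivAt (fun x => v1 x * (h y + m * (x - y)) - p * m * v x)
        (-(1 - (p ^ 2 - p) / x ^ 2) * v x * (h y + m * (x - y)) + v1 x * m - p * m * v1 x) x := by
      intro x hx
      have hx0 : 0 < x := hj1.trans_le hx.1
      have hl : HasDerivAt (fun x => h y + m * (x - y)) m x := by
        have := (((hasDerivAt_id x).sub_const y).const_mul m).const_add (h y)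
        exact this.congr_deriv (by simp)
      exact ((B.dv1 x hx0).mul hl).sub ((B.dv x hx0).const_mul (p * m))
    apply antitoneOn_of_deriv_nonpos (convex_Icc _ _)
    · exact fun x hx => (hd x hx).continuousAt.continuousWithinAt
    · intro x hx; rw [interior_Icc] at hx
      exact (hd x (Set.Ioo_subset_Icc_self hx)).differentiableAt.differentiableWithinAt
    · intro x hx; rw [interior_Icc] at hx
      have hx' := Set.Ioo_subset_Icc_self hx
      rw [(hd x hx').deriv]
      have a1 := (B.v2_nonpos (hAP hx')).2
      have a2 : 0 ≤ h y + m * (x - y) := (hpos x (hsub (hAP hx'))).le.trans (hall x (hsub (hAP hx')))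
      have a3 := mul_nonneg (mul_nonneg hm0 (hv1l x hx')) (sub_nonneg.2 hp1)
      have a4 := mul_nonpos_of_nonpos_of_nonneg a1 a2
      nlinarith
  have hry : v1 y * (h y + m * (y - y)) - p * m * v y = 0 := by
    rw [hm]; have : p ≠ 0 := by linarith
    field_simp; ring
  refine middle_piece (p := p) (m := m) (y := y) (v := v) (v1 := v1)
    (v2 := fun x => -(1 - (p ^ 2 - p) / x ^ 2) * v x) hp B.j12 hyI' (hcont.mono hsub)
    (hc.subset hsub (convex_Icc _ _)) (fun x hx => hpos x (hsub hx)) (fun x hx => hall x (hsub hx))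
    (fun x hx => B.dv x (hj1.trans_le hx.1)) (fun x hx => B.dv1 x (hj1.trans_le hx.1)) B.v2_cont
    B.v_j1 B.v_j2 B.v_pos ?_ ?_ ?_
  · intro x hx
    have hx0 : 0 < x := hj1.trans_le hx.1
    have hh0 : 0 < h y + m * (x - y) := (hpos x (hsub hx)).trans_le (hall x (hsub hx))
    have hκ : (m / (h y + m * (x - y))) ^ 2 ≤ 1 / x ^ 2 := by
      rw [div_pow, div_le_div_iff₀ (by positivity) (by positivity), one_mul, ← mul_pow]
      apply pow_le_pow_left₀ (by positivity); linarith
    have hvx := (B.v2_nonpos hx).1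
    have hc0 : 0 ≤ p ^ 2 - p := by nlinarith
    have : (p ^ 2 - p) * (m / (h y + m * (x - y))) ^ 2 * v x ≤ (p ^ 2 - p) * (1 / x ^ 2) * v x := by
      gcongr
    refine this.trans (le_of_eq ?_)
    ring
  · intro x hx
    have := hr_anti ⟨hx.1, hx.2.trans hy.2⟩ hy hx.2
    simp only [hry] at this
    exact this
  · intro x hx
    rcases le_total x P with h1 | h1
    · have := hr_anti hy ⟨hyj.le.trans hx.1, h1⟩ hx.1
      simp only [hry] at this
      exact this
    · have hx' : x ∈ Set.Icc j1 j2 := ⟨hyj.le.trans hx.1, hx.2⟩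
      have a1 := hv1r x ⟨h1, hx.2⟩
      have a2 : 0 ≤ h y + m * (x - y) := (hpos x (hsub hx')).le.trans (hall x (hsub hx'))
      have a3 := mul_nonneg (mul_nonneg (by linarith : (0:ℝ) ≤ p) hm0) (B.v2_nonpos hx').1
      nlinarith [mul_nonpos_of_nonpos_of_nonneg a1 a2]

theorem mid_exists {n : ℕ} {p j1 j2 : ℝ} {Φ q v v1 : ℝ → ℝ} (hn : 2 ≤ n) (hp : 2 * p = n)
    (B : BesselPack p j1 j2 Φ q v v1) {D : ℝ} (hD : D = j1 + j2) {h : ℝ → ℝ}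
    (hc : ConcaveOn ℝ (Set.Ioo 0 D) h) (hpos : ∀ x ∈ Set.Ioo 0 D, 0 < h x) :
    ∃ f g, Piece (fun x => h x ^ n) j1 j2 f g ∧ f j1 = 0 ∧ f j2 = 0 := by
  obtain ⟨P, hP, hP0⟩ := B.peak
  have hj1 := B.j1_pos
  have hn' : (2:ℝ) ≤ n := by exact_mod_cast hn
  have hp1 : 1 ≤ p := by linarith
  have hsub : Set.Icc j1 j2 ⊆ Set.Ioo 0 D := fun x hx => ⟨by linarith [hx.1], by linarith [hx.2, B.j12]⟩
  have hcont : ContinuousOn h (Set.Ioo 0 D) := hc.continuousOn isOpen_Ioo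
  have hPI := Set.Ioo_subset_Icc_self hP
  rcases line_lemma hn hp B hD hP hP0 hc hpos with h1 | h1
  · exact h1
  have hrm : ∀ x ∈ Set.Ioo 0 D, D - x ∈ Set.Ioo 0 D := fun x hx => ⟨by linarith [hx.2], by linarith [hx.1]⟩
  have hrI : ∀ x ∈ Set.Icc j1 j2, D - x ∈ Set.Icc j1 j2 := fun x hx => ⟨by linarith [hx.2], by linarith [hx.1]⟩
  have hc' : ConcaveOn ℝ (Set.Ioo 0 D) (fun x => h (D - x)) := by
    refine ⟨convex_Ioo _ _, fun x hx y hy a b ha hb hab => ?_⟩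
    have := hc.2 (hrm x hx) (hrm y hy) ha hb hab
    refine this.trans (le_of_eq ?_)
    congr 1
    simp only [smul_eq_mul]
    have : D = (a + b) * D := by rw [hab, one_mul]
    linear_combination -this
  rcases line_lemma hn hp B hD hP hP0 hc' (fun x hx => hpos _ (hrm x hx)) with h2 | h2
  · obtain ⟨f, g, hfg, hf1, hf2⟩ := h2
    have := Piece.reflect (l := fun x => h x ^ n) hfg
    have e1 : D - j2 = j1 := by linarith
    have e2 : D - j1 = j2 := by linarith
    rw [e1, e2] at this
    refine ⟨_, _, this, ?_, ?_⟩
    · simp only [e2, hf2]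
    · simp only [e1, hf1]
  -- constant case
  have hQI := hrI P hPI
  have hus : Set.uIcc P (D - P) ⊆ Set.Icc j1 j2 := Set.uIcc_subset_Icc hPI hQI
  obtain ⟨M, hM, hmax⟩ := (isCompact_uIcc (a := P) (b := D - P)).exists_isMaxOn ⟨P, Set.left_mem_uIcc⟩
    (hcont.mono (hus.trans hsub))
  have hmax' : ∀ x ∈ Set.uIcc P (D - P), h x ≤ h M := fun x hx => hmax hx
  have hMI := hus hM
  have hgl : ∀ x ∈ Set.Icc j1 j2, h x ≤ h M := by
    intro x hx
    by_cases h3 : P ≤ x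
    · exact (h1 x ⟨h3, hx.2⟩).trans (hmax' P Set.left_mem_uIcc)
    by_cases h4 : x ≤ D - P
    · have := h2 (D - x) ⟨by linarith, (hrI x hx).2⟩
      simp only [sub_sub_cancel] at this
      exact this.trans (hmax' _ Set.right_mem_uIcc)
    · push Not at h3 h4
      exact hmax' x (Set.mem_uIcc.2 (Or.inr ⟨h4.le, h3.le⟩))
  have hanti := B.v1_anti
  -- theta
  obtain ⟨a, b, ha, hb, hab, hθ⟩ : ∃ a b : ℝ, 0 ≤ a ∧ 0 ≤ b ∧ a + b = 1 ∧ a * v1 M - b * v1 (D - M) = 0 := by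
    have hDM := hrI M hMI
    set X := v1 M
    set Y := v1 (D - M)
    have hXY : 0 ≤ X * Y ∧ (X + Y = 0 → X = 0 ∧ Y = 0) := by
      rcases Set.mem_uIcc.1 hM with ⟨h3, h4⟩ | ⟨h3, h4⟩
      · have hX : X ≤ 0 := by have := hanti hPI hMI h3; simp only [X]; linarith
        have hY : Y ≤ 0 := by
          have := hanti hPI hDM (by linarith : P ≤ D - M); simp only [Y]; linarith
        exact ⟨mul_nonneg_of_nonpos_of_nonpos hX hY, fun h => ⟨by linarith, by linarith⟩⟩
      · have hX : 0 ≤ X := by have := hanti hMI hPI h4; simp only [X]; linarith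
        have hY : 0 ≤ Y := by
          have := hanti hDM hPI (by linarith : D - M ≤ P); simp only [Y]; linarith
        exact ⟨mul_nonneg hX hY, fun h => ⟨by linarith, by linarith⟩⟩
    by_cases hs : X + Y = 0
    · obtain ⟨hX, hY⟩ := hXY.2 hs
      exact ⟨1, 0, by norm_num, by norm_num, by norm_num, by rw [hX]; ring⟩
    · refine ⟨Y / (X + Y), X / (X + Y), ?_, ?_, ?_, ?_⟩
      · have : Y / (X + Y) = (X * Y + Y ^ 2) / (X + Y) ^ 2 := by field_simp
        rw [this]; exact div_nonneg (by nlinarith [hXY.1, sq_nonneg Y]) (by positivity)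
      · have : X / (X + Y) = (X * Y + X ^ 2) / (X + Y) ^ 2 := by field_simp; ring
        rw [this]; exact div_nonneg (by nlinarith [hXY.1, sq_nonneg X]) (by positivity)
      · field_simp; ring
      · field_simp; ring
  let v2 : ℝ → ℝ := fun x => -(1 - (p ^ 2 - p) / x ^ 2) * v x
  have hR : ∀ x, HasDerivAt (fun x => D - x) (-1) x := fun x => by
    simpa using (hasDerivAt_id x).const_sub D
  have hp0 : ∀ x ∈ Set.Icc j1 j2, 0 < x := fun x hx => hj1.trans_le hx.1
  have hw1anti : AntitoneOn (fun x => a * v1 x - b * v1 (D - x)) (Set.Icc j1 j2) := by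
    intro x hx y hy hxy
    have h3 := hanti hx hy hxy
    have h4 := hanti (hrI y hy) (hrI x hx) (by linarith)
    simp only
    nlinarith
  refine middle_piece (p := p) (m := 0) (y := M) (v := fun x => a * v x + b * v (D - x))
    (v1 := fun x => a * v1 x - b * v1 (D - x))
    (v2 := fun x => a * v2 x + b * v2 (D - x)) hp B.j12 hMI (hcont.mono hsub)
    (hc.subset hsub (convex_Icc _ _)) (fun x hx => hpos x (hsub hx)) (fun x hx => by simpa using hgl x hx)
    ?_ ?_ ?_ ?_ ?_ ?_ ?_ ?_ ?_
  · intro x hx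
    have := ((B.dv x (hp0 x hx)).const_mul a).add
      (((B.dv (D - x) (hp0 _ (hrI x hx))).comp x (hR x)).const_mul b)
    exact this.congr_deriv (by ring)
  · intro x hx
    have := ((B.dv1 x (hp0 x hx)).const_mul a).sub
      (((B.dv1 (D - x) (hp0 _ (hrI x hx))).comp x (hR x)).const_mul b)
    exact this.congr_deriv (by simp only [v2]; ring)
  · refine (continuousOn_const.mul B.v2_cont).add (continuousOn_const.mul ?_)
    exact B.v2_cont.comp (by fun_prop) (fun x hx => hrI x hx)
  · have e2 : D - j1 = j2 := by linarith
    simp [e2, B.v_j1, B.v_j2]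
  · have e2 : D - j2 = j1 := by linarith
    simp [e2, B.v_j1, B.v_j2]
  · intro x hx
    have h3 := B.v_pos x hx
    have h4 := B.v_pos (D - x) ⟨by linarith [hx.2], by linarith [hx.1]⟩
    rcases ha.eq_or_lt with h5 | h5
    · have : b = 1 := by linarith
      rw [← h5, this]; simpa using h4
    · have := mul_pos h5 h3
      have := mul_nonneg hb h4.le
      linarith
  · intro x hx
    have hc0 : 0 ≤ p ^ 2 - p := by nlinarith
    have h3 : 0 ≤ (p ^ 2 - p) / x ^ 2 * v x := mul_nonneg (by positivity) (B.v2_nonpos hx).1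
    have h4 : 0 ≤ (p ^ 2 - p) / (D - x) ^ 2 * v (D - x) :=
      mul_nonneg (by positivity) (B.v2_nonpos (hrI x hx)).1
    have h5 := mul_nonneg ha h3
    have h6 := mul_nonneg hb h4
    simp only [v2, zero_div]
    nlinarith
  · intro x hx
    have := hw1anti ⟨hx.1, hx.2.trans hMI.2⟩ hMI hx.2
    simp only [hθ] at this
    have h3 := (hpos M (hsub hMI)).le
    simp only [zero_mul, add_zero, mul_zero, sub_zero]
    exact mul_nonneg this h3
  · intro x hx
    have := hw1anti hMI ⟨hMI.1.trans hx.1, hx.2⟩ hx.1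
    simp only [hθ] at this
    have h3 := (hpos M (hsub hMI)).le
    simp only [zero_mul, add_zero, mul_zero, sub_zero]
    exact mul_nonpos_of_nonpos_of_nonneg this h3

end

section
open scoped ContDiff

theorem wint {D L C : ℝ} (hD : 0 ≤ D) {l k : ℝ → ℝ} (hlm : Measurable l)
    (hl : ∀ x ∈ Set.Ioo 0 D, 0 < l x ∧ l x ≤ L) (hk : Measurable k)
    (hkb : ∀ x ∈ Set.Ioo 0 D, |k x| ≤ C) : IntervalIntegrable (fun x => k x * l x) volume 0 D := by
  rw [intervalIntegrable_iff_integrableOn_Ioo_of_le hD]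
  refine Measure.integrableOn_of_bounded (M := C * L) (by simp) (hk.mul hlm).aestronglyMeasurable ?_
  filter_upwards [ae_restrict_mem measurableSet_Ioo] with x hx
  rw [norm_mul, Real.norm_eq_abs, Real.norm_eq_abs, abs_of_pos (hl x hx).1]
  exact mul_le_mul (hkb x hx) (hl x hx).2 (hl x hx).1.le ((abs_nonneg _).trans (hkb x hx))

theorem l2_smooth {G : ℝ → ℝ} (hG : MemLp G 2 volume) {ε : ℝ} (hε : 0 < ε) :
    ∃ Q : ℝ → ℝ, ContDiff ℝ ∞ Q ∧ MemLp (G - Q) 2 volume ∧ ∫ x, (G x - Q x) ^ 2 ≤ ε ^ 2 := by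
  obtain ⟨Q, hQc, hQ, hQe⟩ := hG.exist_eLpNorm_sub_le (by norm_num) (by norm_num) hε
  have hm : MemLp (G - Q) 2 volume := hG.sub (hQ.continuous.memLp_of_hasCompactSupport hQc)
  refine ⟨Q, hQ, hm, ?_⟩
  have h := hm.eLpNorm_eq_integral_rpow_norm (by norm_num) (by norm_num)
  rw [h] at hQe
  simp only [ENNReal.toReal_ofNat] at hQe
  rw [ENNReal.ofReal_le_ofReal_iff hε.le] at hQe
  have hI : 0 ≤ ∫ x, ‖(G - Q) x‖ ^ (2:ℝ) := integral_nonneg fun x => by positivity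
  have h2 := pow_le_pow_left₀ (by positivity) hQe 2
  rw [← Real.rpow_natCast, ← Real.rpow_mul hI] at h2
  norm_num at h2
  simpa using h2

theorem piece_approx {D L s t κ : ℝ} {l f g : ℝ → ℝ} (hlm : Measurable l)
    (hl : ∀ x ∈ Set.Ioo 0 D, 0 < l x ∧ l x ≤ L) (hs : 0 ≤ s) (hst : s < t) (htD : t ≤ D)
    (hP : Piece l s t f g) (hs' : s = 0 ∨ f s = 0) (ht' : t = D ∨ f t = 0) (hκ : 0 < κ) :
    ∃ F G w w1 : ℝ → ℝ, Continuous F ∧ Measurable G ∧ (∃ C, ∀ x, |G x| ≤ C) ∧ ContDiff ℝ ∞ w ∧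
      (∀ x, HasDerivAt w (w1 x) x) ∧ Continuous w1 ∧
      (∀ x ∈ Set.Ioo 0 D, x ∉ Set.Ioo s t → F x = 0) ∧ (∀ x, x ∉ Set.Ioo s t → G x = 0) ∧
      0 < ∫ x in (0:ℝ)..D, F x ^ 2 * l x ∧
      ∫ x in (0:ℝ)..D, G x ^ 2 * l x ≤ ∫ x in (0:ℝ)..D, F x ^ 2 * l x ∧
      ∫ x in (0:ℝ)..D, (w1 x - G x) ^ 2 * l x ≤ κ * ∫ x in (0:ℝ)..D, F x ^ 2 * l x ∧
      ∫ x in (0:ℝ)..D, (w x - F x) ^ 2 * l x ≤ κ * ∫ x in (0:ℝ)..D, F x ^ 2 * l x := by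
  have hD : 0 < D := by linarith
  have hIst : Set.Ioo s t ⊆ Set.Ioo 0 D := Set.Ioo_subset_Ioo hs htD
  let F : ℝ → ℝ := fun x => f (max s (min t x))
  let G : ℝ → ℝ := (Set.Ioo s t).indicator g
  have hcl : ∀ x, max s (min t x) ∈ Set.Icc s t := fun x =>
    ⟨le_max_left _ _, max_le hst.le (min_le_left _ _)⟩
  have hFc : Continuous F := by
    rw [← continuousOn_univ]
    exact hP.cf.comp (by fun_prop) fun x _ => hcl x
  have hFin : ∀ x ∈ Set.Icc s t, F x = f x := fun x hx => by simp [F, hx.1, hx.2]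
  have hF0 : ∀ x ∈ Set.Ioo 0 D, x ∉ Set.Ioo s t → F x = 0 := by
    intro x hx hn
    by_cases h1 : s < x
    · have h2 : t ≤ x := by by_contra h; exact hn ⟨h1, not_le.1 h⟩
      have : f t = 0 := by
        rcases ht' with h | h
        · linarith [hx.2]
        · exact h
      simp [F, h2, hst.le, this]
    · have : f s = 0 := by
        rcases hs' with h | h
        · linarith [hx.1]
        · exact h
      have h3 : min t x ≤ s := (min_le_right _ _).trans (not_lt.1 h1)
      simp [F, h3, this]
  have hGm : Measurable G := by
    have : G = (Set.Ioo s t).indicator (fun x => g (max s (min t x))) := by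
      ext x
      by_cases hx : x ∈ Set.Ioo s t
      · simp [G, Set.indicator_of_mem hx, hx.1.le, hx.2.le]
      · simp [G, Set.indicator_of_notMem hx]
    rw [this]
    refine Measurable.indicator ?_ measurableSet_Ioo
    refine Continuous.measurable ?_
    rw [← continuousOn_univ]
    exact hP.cg.comp (by fun_prop) fun x _ => hcl x
  obtain ⟨C, hC⟩ := isCompact_Icc.exists_bound_of_continuousOn hP.cg
  have hC0 : 0 ≤ C := (norm_nonneg _).trans (hC s ⟨le_rfl, hst.le⟩)
  have hGb : ∀ x, |G x| ≤ C := by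
    intro x
    by_cases hx : x ∈ Set.Ioo s t
    · simp only [G, Set.indicator_of_mem hx]; exact hC x (Set.Ioo_subset_Icc_self hx)
    · simp only [G, Set.indicator_of_notMem hx, abs_zero]; exact hC0
  have hG0 : ∀ x, x ∉ Set.Ioo s t → G x = 0 := fun x hx => Set.indicator_of_notMem hx _
  obtain ⟨C', hC'⟩ := isCompact_Icc.exists_bound_of_continuousOn (hFc.continuousOn (s := Set.Icc 0 D))
  have iF : IntervalIntegrable (fun x => F x ^ 2 * l x) volume 0 D := by
    refine wint (C := C' ^ 2) hD.le hlm hl (hFc.pow 2).measurable fun x hx => ?_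
    rw [abs_pow]
    exact pow_le_pow_left₀ (abs_nonneg _) (hC' x (Set.Ioo_subset_Icc_self hx)) 2
  have iG : IntervalIntegrable (fun x => G x ^ 2 * l x) volume 0 D := by
    refine wint (C := C ^ 2) hD.le hlm hl (hGm.pow_const 2) fun x _ => ?_
    rw [abs_pow]
    exact pow_le_pow_left₀ (abs_nonneg _) (hGb x) 2
  have hred : ∀ k : ℝ → ℝ, (∀ x ∈ Set.Ioo 0 D, x ∉ Set.Ioo s t → k x = 0) →
      ∫ x in (0:ℝ)..D, k x = ∫ x in s..t, k x := by
    intro k hk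
    rw [intervalIntegral.integral_of_le hD.le, intervalIntegral.integral_of_le hst.le,
      integral_Ioc_eq_integral_Ioo, integral_Ioc_eq_integral_Ioo]
    exact setIntegral_eq_of_subset_of_forall_sdiff_eq_zero measurableSet_Ioo hIst
      (fun x hx => hk x hx.1 hx.2)
  have eF := hred (fun x => F x ^ 2 * l x) (fun x hx hn => by simp [hF0 x hx hn])
  have eG := hred (fun x => G x ^ 2 * l x) (fun x hx hn => by simp [hG0 x hn])
  have subI : ∀ k : ℝ → ℝ, IntervalIntegrable k volume 0 D → IntervalIntegrable k volume s t := by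
    intro k hk
    refine hk.mono_set ?_
    rw [Set.uIcc_of_le hst.le, Set.uIcc_of_le hD.le]
    exact Set.Icc_subset_Icc hs htD
  have hN : 0 < ∫ x in (0:ℝ)..D, F x ^ 2 * l x := by
    rw [eF]
    refine intervalIntegral.intervalIntegral_pos_of_pos_on (subI _ iF) (fun x hx => ?_) hst
    rw [hFin x (Set.Ioo_subset_Icc_self hx)]
    have := hP.fpos x hx
    have := (hl x (hIst hx)).1
    positivity
  have hGF : ∫ x in (0:ℝ)..D, G x ^ 2 * l x ≤ ∫ x in (0:ℝ)..D, F x ^ 2 * l x := by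
    rw [eF, eG]
    have h1 : ∫ x in s..t, (G x ^ 2 * l x - F x ^ 2 * l x) ≤ 0 := by
      refine le_of_eq_of_le ?_ hP.int
      rw [intervalIntegral.integral_of_le hst.le, intervalIntegral.integral_of_le hst.le,
        integral_Ioc_eq_integral_Ioo, integral_Ioc_eq_integral_Ioo]
      refine setIntegral_congr_fun measurableSet_Ioo fun x hx => ?_
      simp only [hFin x (Set.Ioo_subset_Icc_self hx), G, Set.indicator_of_mem hx]
      ring
    rw [intervalIntegral.integral_sub (subI _ iG) (subI _ iF)] at h1
    linarith
  set N := ∫ x in (0:ℝ)..D, F x ^ 2 * l x with hNdef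
  have hL : 0 < L := by
    have h0 : D / 2 ∈ Set.Ioo 0 D := ⟨by linarith, by linarith⟩
    have := hl _ h0; linarith
  -- choice of epsilon
  obtain ⟨ε, hε, hε1, hε2⟩ : ∃ ε : ℝ, 0 < ε ∧ L * ε ^ 2 ≤ κ * N ∧
      (ε * (D + 1) / 2) ^ 2 * (L * D) ≤ κ * N := by
    have h1 : Tendsto (fun ε : ℝ => L * ε ^ 2) (nhdsWithin 0 (Set.Ioi 0)) (nhds 0) := by
      have : Tendsto (fun ε : ℝ => L * ε ^ 2) (nhds 0) (nhds (L * 0 ^ 2)) := Continuous.tendsto (by fun_prop) 0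
      simp only [ne_eq, OfNat.ofNat_ne_zero, not_false_eq_true, zero_pow, mul_zero] at this
      exact this.mono_left nhdsWithin_le_nhds
    have h2 : Tendsto (fun ε : ℝ => (ε * (D + 1) / 2) ^ 2 * (L * D)) (nhdsWithin 0 (Set.Ioi 0)) (nhds 0) := by
      have : Tendsto (fun ε : ℝ => (ε * (D + 1) / 2) ^ 2 * (L * D)) (nhds 0)
        (nhds ((0 * (D + 1) / 2) ^ 2 * (L * D))) := Continuous.tendsto (by fun_prop) 0
      simp only [zero_mul, zero_div, ne_eq, OfNat.ofNat_ne_zero, not_false_eq_true, zero_pow] at this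
      exact this.mono_left nhdsWithin_le_nhds
    have hpos : 0 < κ * N := mul_pos hκ hN
    obtain ⟨ε, ⟨a, b⟩, c⟩ := (((h1.eventually (gt_mem_nhds hpos)).and
      (h2.eventually (gt_mem_nhds hpos))).and self_mem_nhdsWithin).exists
    exact ⟨ε, c, a.le, b.le⟩
  have hGL : MemLp G 2 volume := by
    have h1 : MemLp (fun x => g (max s (min t x))) 2 (volume.restrict (Set.Ioo s t)) := by
      refine MemLp.of_bound ?_ C ?_
      · refine Continuous.aestronglyMeasurable ?_
        rw [← continuousOn_univ]
        exact hP.cg.comp (by fun_prop) fun x _ => hcl x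
      · exact Eventually.of_forall fun x => hC _ (hcl x)
    have : G = (Set.Ioo s t).indicator (fun x => g (max s (min t x))) := by
      ext x
      by_cases hx : x ∈ Set.Ioo s t
      · simp [G, Set.indicator_of_mem hx, hx.1.le, hx.2.le]
      · simp [G, Set.indicator_of_notMem hx]
    rw [this]
    exact (memLp_indicator_iff_restrict measurableSet_Ioo).2 h1
  obtain ⟨Q, hQ, hQL, hQe⟩ := l2_smooth hGL hε
  have hQc : Continuous Q := hQ.continuous
  let w : ℝ → ℝ := fun x => F 0 + ∫ y in (0:ℝ)..x, Q y
  have hw : ∀ x, HasDerivAt w (Q x) x := fun x =>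
    (intervalIntegral.integral_hasDerivAt_right (hQc.intervalIntegrable _ _)
      (hQc.stronglyMeasurableAtFilter _ _) hQc.continuousAt).const_add _
  have hsq : Integrable (fun x => (G x - Q x) ^ 2) volume := hQL.integrable_sq
  have hsqI : IntervalIntegrable (fun x => (G x - Q x) ^ 2) volume 0 D := hsq.intervalIntegrable
  have hsqe : ∫ x in (0:ℝ)..D, (G x - Q x) ^ 2 ≤ ε ^ 2 := by
    rw [intervalIntegral.integral_of_le hD.le]
    refine le_trans (setIntegral_le_integral hsq (Eventually.of_forall fun x => sq_nonneg _)) hQe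
  have hGi : ∀ x, IntervalIntegrable G volume 0 x := fun x => by
    rw [intervalIntegrable_iff]
    refine Measure.integrableOn_of_bounded (M := C) (by simp) hGm.aestronglyMeasurable ?_
    exact Eventually.of_forall fun x => hGb x
  have hFG : ∀ x ∈ Set.Icc 0 D, ∫ y in (0:ℝ)..x, G y = F x - F 0 := by
    intro x hx
    refine integral_eq_of_hasDerivAt_off_countable_of_le F G hx.1 (s := {s, t})
      (Set.to_countable _) hFc.continuousOn ?_ (hGi x)
    intro z hz
    have hzs : z ≠ s := fun h => hz.2 (by simp [h])
    have hzt : z ≠ t := fun h => hz.2 (by simp [h])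
    rcases lt_or_gt_of_ne hzs with h1 | h1
    · rw [hG0 z (fun h => by linarith [h.1])]
      refine (hasDerivAt_const z (f s)).congr_of_eventuallyEq ?_
      filter_upwards [gt_mem_nhds h1] with u hu
      have : min t u ≤ s := (min_le_right _ _).trans (le_of_lt hu)
      simp [F, this]
    · rcases lt_or_gt_of_ne hzt with h2 | h2
      · have hzI : z ∈ Set.Ioo s t := ⟨h1, h2⟩
        simp only [G, Set.indicator_of_mem hzI]
        refine (hP.df z hzI).congr_of_eventuallyEq ?_
        filter_upwards [Ioo_mem_nhds h1 h2] with u hu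
        exact hFin u (Set.Ioo_subset_Icc_self hu)
      · rw [hG0 z (fun h => by linarith [h.2])]
        refine (hasDerivAt_const z (f t)).congr_of_eventuallyEq ?_
        filter_upwards [lt_mem_nhds h2] with u hu
        simp [F, le_of_lt hu, hst.le]
  have hwF : ∀ x ∈ Set.Icc 0 D, |w x - F x| ≤ ε * (D + 1) / 2 := by
    intro x hx
    have e : w x - F x = ∫ y in (0:ℝ)..x, (Q y - G y) := by
      rw [intervalIntegral.integral_sub (hQc.intervalIntegrable _ _) (hGi x), hFG x hx]
      simp only [w]; ring
    rw [e]
    have hdi : ∀ x, IntervalIntegrable (fun y => Q y - G y) volume 0 x := fun x =>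
      (hQc.intervalIntegrable _ _).sub (hGi x)
    calc _ ≤ ∫ y in (0:ℝ)..x, |Q y - G y| := intervalIntegral.abs_integral_le_integral_abs hx.1
      _ ≤ ∫ y in (0:ℝ)..D, |Q y - G y| := by
          refine intervalIntegral.integral_mono_interval le_rfl hx.1 hx.2 ?_ (hdi D).abs
          exact Eventually.of_forall fun y => abs_nonneg _
      _ ≤ ∫ y in (0:ℝ)..D, (ε / 2 + (2 * ε)⁻¹ * (G y - Q y) ^ 2) := by
          refine intervalIntegral.integral_mono_on hD.le (hdi D).abs
            (intervalIntegrable_const.add (hsqI.const_mul _)) fun y _ => ?_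
          have h1 : |Q y - G y| ^ 2 = (G y - Q y) ^ 2 := by rw [sq_abs]; ring
          rw [← h1]
          have h2 : 0 ≤ (2 * ε)⁻¹ * (|Q y - G y| - ε) ^ 2 := by positivity
          have h3 : (2 * ε)⁻¹ * (|Q y - G y| - ε) ^ 2 =
            ε / 2 + (2 * ε)⁻¹ * |Q y - G y| ^ 2 - |Q y - G y| := by field_simp; ring
          linarith
      _ = D * (ε / 2) + (2 * ε)⁻¹ * ∫ y in (0:ℝ)..D, (G y - Q y) ^ 2 := by
          rw [intervalIntegral.integral_add intervalIntegrable_const (hsqI.const_mul _),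
            intervalIntegral.integral_const, intervalIntegral.integral_const_mul]
          simp
      _ ≤ D * (ε / 2) + (2 * ε)⁻¹ * ε ^ 2 := by gcongr
      _ = _ := by field_simp
  have hwc : Continuous w := continuous_iff_continuousAt.2 fun x => (hw x).continuousAt
  refine ⟨F, G, w, Q, hFc, hGm, ⟨C, hGb⟩, ?_, hw, hQc, hF0, hG0, hN, hGF, ?_, ?_⟩
  · rw [contDiff_infty_iff_deriv]
    refine ⟨fun x => (hw x).differentiableAt, ?_⟩
    have : deriv w = Q := funext fun x => (hw x).deriv
    rw [this]; exact hQ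
  · calc _ ≤ ∫ x in (0:ℝ)..D, L * (G x - Q x) ^ 2 := by
          rw [intervalIntegral.integral_of_le hD.le, intervalIntegral.integral_of_le hD.le,
            integral_Ioc_eq_integral_Ioo, integral_Ioc_eq_integral_Ioo]
          refine integral_mono_of_nonneg ?_ ?_ ?_
          · filter_upwards [ae_restrict_mem measurableSet_Ioo] with x hx
            have := (hl x hx).1
            simp only [Pi.zero_apply]; positivity
          · exact (hsq.const_mul L).integrableOn
          · filter_upwards [ae_restrict_mem measurableSet_Ioo] with x hx
            have := (hl x hx).2
            have h2 := sq_nonneg (G x - Q x)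

            nlinarith
      _ = L * ∫ x in (0:ℝ)..D, (G x - Q x) ^ 2 := intervalIntegral.integral_const_mul _ _
      _ ≤ L * ε ^ 2 := by gcongr
      _ ≤ _ := hε1
  · calc _ ≤ ∫ x in (0:ℝ)..D, (ε * (D + 1) / 2) ^ 2 * L := by
          rw [intervalIntegral.integral_of_le hD.le, intervalIntegral.integral_of_le hD.le,
            integral_Ioc_eq_integral_Ioo, integral_Ioc_eq_integral_Ioo]
          refine integral_mono_of_nonneg ?_ ?_ ?_
          · filter_upwards [ae_restrict_mem measurableSet_Ioo] with x hx
            have := (hl x hx).1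
            simp only [Pi.zero_apply]; positivity
          · exact integrableOn_const (by simp)
          · filter_upwards [ae_restrict_mem measurableSet_Ioo] with x hx
            have h1 := hl x hx
            have h2 := hwF x (Set.Ioo_subset_Icc_self hx)
            have h3 := pow_le_pow_left₀ (abs_nonneg _) h2 2
            rw [sq_abs] at h3
            exact mul_le_mul h3 h1.2 h1.1.le (by positivity)
      _ = (ε * (D + 1) / 2) ^ 2 * (L * D) := by
          rw [intervalIntegral.integral_const]; simp; ring
      _ ≤ _ := hε2

end

section
open scoped ContDiff

theorem three_sq {η κ a0 a1 a2 b0 b1 b2 : ℝ} (hη : 0 < η) (hκ : (1 + 1/η) * 3 * κ = η) :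
    (b0 + b1 + b2) ^ 2 ≤ (1 + η) * (a0 + a1 + a2) ^ 2 +
      (1 + 1/η) * 3 * ((b0-a0)^2 + (b1-a1)^2 + (b2-a2)^2) := by
  set A := a0 + a1 + a2
  set E := (b0-a0) + (b1-a1) + (b2-a2) with hE
  have h1 : b0 + b1 + b2 = A + E := by simp only [A, E]; ring
  have h2 : E ^ 2 ≤ 3 * ((b0-a0)^2 + (b1-a1)^2 + (b2-a2)^2) := by
    rw [hE]
    nlinarith [sq_nonneg ((b0-a0)-(b1-a1)), sq_nonneg ((b0-a0)-(b2-a2)), sq_nonneg ((b1-a1)-(b2-a2))]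
  have h3 : (A + E) ^ 2 ≤ (1 + η) * A ^ 2 + (1 + 1/η) * E ^ 2 := by
    have : (1 + η) * A ^ 2 + (1 + 1/η) * E ^ 2 - (A + E)^2 = (η * A - E)^2 / η := by
      field_simp; ring
    have h4 : 0 ≤ (η * A - E)^2 / η := by positivity
    linarith
  rw [h1]
  have h5 : (1 + 1/η) * E ^ 2 ≤ (1 + 1/η) * (3 * ((b0-a0)^2 + (b1-a1)^2 + (b2-a2)^2)) := by
    gcongr
  linarith

theorem three_combine {D L η κ : ℝ} (hD : 0 ≤ D) {l : ℝ → ℝ} (hlm : Measurable l)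
    (hl : ∀ x ∈ Set.Ioo 0 D, 0 < l x ∧ l x ≤ L) (hη : 0 < η) (hκ : (1 + 1/η) * 3 * κ = η)
    {a0 a1 a2 b0 b1 b2 : ℝ → ℝ} {N0 N1 N2 : ℝ} (c0 c1 c2 : ℝ)
    (ma0 : Measurable a0) (ma1 : Measurable a1) (ma2 : Measurable a2)
    (mb0 : Measurable b0) (mb1 : Measurable b1) (mb2 : Measurable b2)
    {C : ℝ} (hC : ∀ x ∈ Set.Ioo 0 D, |a0 x| ≤ C ∧ |a1 x| ≤ C ∧ |a2 x| ≤ C ∧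
      |b0 x| ≤ C ∧ |b1 x| ≤ C ∧ |b2 x| ≤ C)
    (hort : ∀ x ∈ Set.Ioo 0 D, a0 x * a1 x = 0 ∧ a0 x * a2 x = 0 ∧ a1 x * a2 x = 0)
    (e0 : ∫ x in (0:ℝ)..D, (b0 x - a0 x) ^ 2 * l x ≤ κ * N0)
    (e1 : ∫ x in (0:ℝ)..D, (b1 x - a1 x) ^ 2 * l x ≤ κ * N1)
    (e2 : ∫ x in (0:ℝ)..D, (b2 x - a2 x) ^ 2 * l x ≤ κ * N2) :
    (∫ x in (0:ℝ)..D, (c0 * b0 x + c1 * b1 x + c2 * b2 x) ^ 2 * l x) ≤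
      (1 + η) * (c0^2 * (∫ x in (0:ℝ)..D, a0 x ^ 2 * l x) + c1^2 * (∫ x in (0:ℝ)..D, a1 x ^ 2 * l x)
        + c2^2 * (∫ x in (0:ℝ)..D, a2 x ^ 2 * l x)) + η * (c0^2 * N0 + c1^2*N1 + c2^2*N2) ∧
    c0^2 * (∫ x in (0:ℝ)..D, a0 x ^ 2 * l x) + c1^2 * (∫ x in (0:ℝ)..D, a1 x ^ 2 * l x)
        + c2^2 * (∫ x in (0:ℝ)..D, a2 x ^ 2 * l x) ≤
     (1 + η) * (∫ x in (0:ℝ)..D, (c0 * b0 x + c1 * b1 x + c2 * b2 x) ^ 2 * l x)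
       + η * (c0^2 * N0 + c1^2*N1 + c2^2*N2) := by
  have key : ∀ k : ℝ → ℝ, Measurable k → ∀ C, (∀ x ∈ Set.Ioo 0 D, |k x| ≤ C) →
      IntervalIntegrable (fun x => k x ^ 2 * l x) volume 0 D := by
    intro k hk C hC
    refine wint (C := C ^ 2) hD hlm hl (hk.pow_const 2) fun x hx => ?_
    rw [abs_pow]
    exact pow_le_pow_left₀ (abs_nonneg _) (hC x hx) 2
  have ia0 := key a0 ma0 C fun x hx => (hC x hx).1
  have ia1 := key a1 ma1 C fun x hx => (hC x hx).2.1
  have ia2 := key a2 ma2 C fun x hx => (hC x hx).2.2.1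
  have id0 := key (fun x => b0 x - a0 x) (mb0.sub ma0) (C + C) fun x hx =>
    (abs_sub _ _).trans (add_le_add (hC x hx).2.2.2.1 (hC x hx).1)
  have id1 := key (fun x => b1 x - a1 x) (mb1.sub ma1) (C + C) fun x hx =>
    (abs_sub _ _).trans (add_le_add (hC x hx).2.2.2.2.1 (hC x hx).2.1)
  have id2 := key (fun x => b2 x - a2 x) (mb2.sub ma2) (C + C) fun x hx =>
    (abs_sub _ _).trans (add_le_add (hC x hx).2.2.2.2.2 (hC x hx).2.2.1)
  have iB := key (fun x => c0 * b0 x + c1 * b1 x + c2 * b2 x) (by fun_prop)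
    (|c0| * C + |c1| * C + |c2| * C) fun x hx => by
      obtain ⟨_, _, _, h0, h1, h2⟩ := hC x hx
      refine (abs_add_three _ _ _).trans ?_
      rw [abs_mul, abs_mul, abs_mul]; gcongr
  have hS : ∫ x in (0:ℝ)..D, (c0 ^ 2 * (a0 x ^ 2 * l x) + c1 ^ 2 * (a1 x ^ 2 * l x)
      + c2 ^ 2 * (a2 x ^ 2 * l x)) =
      c0^2 * (∫ x in (0:ℝ)..D, a0 x ^ 2 * l x) + c1^2 * (∫ x in (0:ℝ)..D, a1 x ^ 2 * l x)
        + c2^2 * (∫ x in (0:ℝ)..D, a2 x ^ 2 * l x) := by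
    rw [intervalIntegral.integral_add ((ia0.const_mul _).add (ia1.const_mul _)) (ia2.const_mul _),
      intervalIntegral.integral_add (ia0.const_mul _) (ia1.const_mul _)]
    simp only [intervalIntegral.integral_const_mul]
  have hE : ∫ x in (0:ℝ)..D, (c0 ^ 2 * ((b0 x - a0 x) ^ 2 * l x) + c1 ^ 2 * ((b1 x - a1 x) ^ 2 * l x)
      + c2 ^ 2 * ((b2 x - a2 x) ^ 2 * l x)) ≤ κ * (c0^2 * N0 + c1^2 * N1 + c2^2 * N2) := by
    rw [intervalIntegral.integral_add ((id0.const_mul _).add (id1.const_mul _)) (id2.const_mul _),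
      intervalIntegral.integral_add (id0.const_mul _) (id1.const_mul _)]
    simp only [intervalIntegral.integral_const_mul]
    have h0 := mul_le_mul_of_nonneg_left e0 (sq_nonneg c0)
    have h1 := mul_le_mul_of_nonneg_left e1 (sq_nonneg c1)
    have h2 := mul_le_mul_of_nonneg_left e2 (sq_nonneg c2)
    linarith
  have iS := ((ia0.const_mul (c0^2)).add (ia1.const_mul (c1^2))).add (ia2.const_mul (c2^2))
  have iE := ((id0.const_mul (c0^2)).add (id1.const_mul (c1^2))).add (id2.const_mul (c2^2))
  have hE' := mul_le_mul_of_nonneg_left hE (show 0 ≤ (1 + 1/η) * 3 by positivity)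
  rw [← mul_assoc, hκ] at hE'
  have sqs : ∀ x ∈ Set.Ioo 0 D, (c0 * a0 x + c1 * a1 x + c2 * a2 x) ^ 2 =
      c0^2 * a0 x ^ 2 + c1^2 * a1 x ^ 2 + c2^2 * a2 x ^ 2 := by
    intro x hx
    obtain ⟨h0, h1, h2⟩ := hort x hx
    linear_combination 2 * c0 * c1 * h0 + 2 * c0 * c2 * h1 + 2 * c1 * c2 * h2
  constructor
  · refine le_trans ?_ (add_le_add_right hE' _)
    rw [← hS, ← intervalIntegral.integral_const_mul, ← intervalIntegral.integral_const_mul,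
      ← intervalIntegral.integral_add (iS.const_mul _) (iE.const_mul _)]
    refine intervalIntegral.integral_mono_on_of_le_Ioo hD iB ((iS.const_mul _).add (iE.const_mul _)) fun x hx => ?_
    have h := three_sq (a0 := c0 * a0 x) (a1 := c1 * a1 x) (a2 := c2 * a2 x)
      (b0 := c0 * b0 x) (b1 := c1 * b1 x) (b2 := c2 * b2 x) hη hκ
    rw [sqs x hx] at h
    have h2 := mul_le_mul_of_nonneg_right h (hl x hx).1.le
    refine h2.trans_eq ?_
    ring
  · rw [← hS]
    refine le_trans ?_ (add_le_add_right hE' _)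
    rw [← intervalIntegral.integral_const_mul, ← intervalIntegral.integral_const_mul,
      ← intervalIntegral.integral_add (iB.const_mul _) (iE.const_mul _)]
    refine intervalIntegral.integral_mono_on_of_le_Ioo hD iS ((iB.const_mul _).add (iE.const_mul _)) fun x hx => ?_
    have h := three_sq (b0 := c0 * a0 x) (b1 := c1 * a1 x) (b2 := c2 * a2 x)
      (a0 := c0 * b0 x) (a1 := c1 * b1 x) (a2 := c2 * b2 x) hη hκ
    rw [sqs x hx] at h
    have h2 := mul_le_mul_of_nonneg_right h (hl x hx).1.le
    refine Eq.trans_le ?_ (h2.trans_eq ?_) <;> ring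

theorem three_approx {n : ℕ} (hn : 2 ≤ n) {D H η j1 j2 p : ℝ} {Φ q v v1 : ℝ → ℝ}
    (hp : 2 * p = n) (B : BesselPack p j1 j2 Φ q v v1) (hD : D = j1 + j2) {h : ℝ → ℝ}
    (hc : ConcaveOn ℝ (Set.Ioo 0 D) h) (hpos : ∀ x ∈ Set.Ioo 0 D, 0 < h x ∧ h x ≤ H)
    (hm : Measurable h) (hη : 0 < η) (hη1 : η < 1) :
    ∃ w0 w1 w2 z0 z1 z2 : ℝ → ℝ, (ContDiff ℝ ∞ w0 ∧ ContDiff ℝ ∞ w1 ∧ ContDiff ℝ ∞ w2) ∧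
      (∀ x, HasDerivAt w0 (z0 x) x ∧ HasDerivAt w1 (z1 x) x ∧ HasDerivAt w2 (z2 x) x) ∧
      (Continuous z0 ∧ Continuous z1 ∧ Continuous z2) ∧
      ∀ c0 c1 c2 : ℝ, (c0 ≠ 0 ∨ c1 ≠ 0 ∨ c2 ≠ 0) →
        0 < ∫ x in (0:ℝ)..D, (c0 * w0 x + c1 * w1 x + c2 * w2 x) ^ 2 * h x ^ n ∧
        (1 - η) * (∫ x in (0:ℝ)..D, (c0 * z0 x + c1 * z1 x + c2 * z2 x) ^ 2 * h x ^ n) ≤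
        (1 + 2 * η) * (1 + η) *
          ∫ x in (0:ℝ)..D, (c0 * w0 x + c1 * w1 x + c2 * w2 x) ^ 2 * h x ^ n := by
  have hj1 := B.j1_pos
  have hj12 := B.j12
  have hD0 : 0 < D := by linarith
  have hl : ∀ x ∈ Set.Ioo 0 D, 0 < h x ^ n ∧ h x ^ n ≤ H ^ n := fun x hx =>
    ⟨pow_pos (hpos x hx).1 n, pow_le_pow_left₀ (hpos x hx).1.le (hpos x hx).2 n⟩
  have hlm : Measurable (fun x => h x ^ n) := hm.pow_const n
  have PL := left_piece hn hp B (show j1 < D by linarith) hc hpos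
  have hc' : ConcaveOn ℝ (Set.Ioo 0 D) (fun x => h (D - x)) := by
    refine ⟨convex_Ioo _ _, fun x hx y hy α β hα hβ hαβ => ?_⟩
    have := hc.2 (x := D - x) (y := D - y) ⟨by linarith [hx.2], by linarith [hx.1]⟩
      ⟨by linarith [hy.2], by linarith [hy.1]⟩ hα hβ hαβ
    simp only [smul_eq_mul] at this ⊢
    convert this using 2
    linear_combination (-D) * hαβ
  have hpos' : ∀ x ∈ Set.Ioo 0 D, 0 < h (D - x) ∧ h (D - x) ≤ H := fun x hx =>
    hpos _ ⟨by linarith [hx.2], by linarith [hx.1]⟩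
  have PR := (left_piece hn hp B (show j1 < D by linarith) hc' hpos').reflect (l := fun x => h x ^ n)
  obtain ⟨f, g, PM, f1, f2⟩ := mid_exists hn hp B hD hc (fun x hx => (hpos x hx).1)
  have hDj : D - j1 = j2 := by linarith
  rw [hDj, sub_zero] at PR
  set κ := η ^ 2 / (3 * (1 + η)) with hκd
  have hκ : 0 < κ := by positivity
  have hκ' : (1 + 1/η) * 3 * κ = η := by rw [hκd]; field_simp; ring
  obtain ⟨F0, G0, w0, z0, cF0, mG0, ⟨C0, bG0⟩, sw0, dw0, cz0, oF0, oG0, N0, GF0, ez0, ew0⟩ :=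
    piece_approx hlm hl le_rfl hj1 (by linarith) PL (Or.inl rfl) (Or.inr B.Φ_j1) hκ
  obtain ⟨F1, G1, w1, z1, cF1, mG1, ⟨C1, bG1⟩, sw1, dw1, cz1, oF1, oG1, N1, GF1, ez1, ew1⟩ :=
    piece_approx hlm hl hj1.le hj12 (by linarith) PM (Or.inr f1) (Or.inr f2) hκ
  obtain ⟨F2, G2, w2, z2, cF2, mG2, ⟨C2, bG2⟩, sw2, dw2, cz2, oF2, oG2, N2, GF2, ez2, ew2⟩ :=
    piece_approx hlm hl (by linarith) (show j2 < D by linarith) le_rfl PR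
      (Or.inr (by simpa [← hDj] using B.Φ_j1)) (Or.inl rfl) hκ
  refine ⟨w0, w1, w2, z0, z1, z2, ⟨sw0, sw1, sw2⟩, fun x => ⟨dw0 x, dw1 x, dw2 x⟩,
    ⟨cz0, cz1, cz2⟩, fun c0 c1 c2 hcne => ?_⟩
  have ortg : ∀ {A0 A1 A2 : ℝ → ℝ} (x : ℝ), (x ∉ Set.Ioo 0 j1 → A0 x = 0) →
      (x ∉ Set.Ioo j1 j2 → A1 x = 0) → (x ∉ Set.Ioo j2 D → A2 x = 0) →
      A0 x * A1 x = 0 ∧ A0 x * A2 x = 0 ∧ A1 x * A2 x = 0 := by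
    intro A0 A1 A2 x h0 h1 h2
    by_cases hx0 : x < j1
    · rw [h1 fun h => by linarith [h.1], h2 fun h => by linarith [h.1]]; simp
    · rw [h0 fun h => hx0 h.2]
      by_cases hx1 : x < j2
      · rw [h2 fun h => by linarith [h.1]]; simp
      · rw [h1 fun h => hx1 h.2]; simp
  have bdd : ∀ k : ℝ → ℝ, Continuous k → ∃ C, ∀ x ∈ Set.Ioo 0 D, |k x| ≤ C := fun k hk => by
    obtain ⟨C, hC⟩ := isCompact_Icc.exists_bound_of_continuousOn (hk.continuousOn (s := Set.Icc 0 D))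
    exact ⟨C, fun x hx => hC x (Set.Ioo_subset_Icc_self hx)⟩
  have comb : ∀ {a0 a1 a2 b0 b1 b2 : ℝ → ℝ}, (∃ C, ∀ x ∈ Set.Ioo 0 D, |a0 x| ≤ C) →
     (∃ C, ∀ x ∈ Set.Ioo 0 D, |a1 x| ≤ C) → (∃ C, ∀ x ∈ Set.Ioo 0 D, |a2 x| ≤ C) →
     (∃ C, ∀ x ∈ Set.Ioo 0 D, |b0 x| ≤ C) → (∃ C, ∀ x ∈ Set.Ioo 0 D, |b1 x| ≤ C) →
     (∃ C, ∀ x ∈ Set.Ioo 0 D, |b2 x| ≤ C) → ∃ C, ∀ x ∈ Set.Ioo 0 D, |a0 x| ≤ C ∧ |a1 x| ≤ C ∧ |a2 x| ≤ C ∧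
      |b0 x| ≤ C ∧ |b1 x| ≤ C ∧ |b2 x| ≤ C := by
    rintro a0 a1 a2 b0 b1 b2 ⟨A0, h0⟩ ⟨A1, h1⟩ ⟨A2, h2⟩ ⟨A3, h3⟩ ⟨A4, h4⟩ ⟨A5, h5⟩
    refine ⟨|A0| + |A1| + |A2| + |A3| + |A4| + |A5|, fun x hx => ?_⟩
    have t0 := h0 x hx; have t1 := h1 x hx; have t2 := h2 x hx
    have t3 := h3 x hx; have t4 := h4 x hx; have t5 := h5 x hx
    have q0 := le_abs_self A0; have q1 := le_abs_self A1; have q2 := le_abs_self A2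
    have q3 := le_abs_self A3; have q4 := le_abs_self A4; have q5 := le_abs_self A5
    have r0 := abs_nonneg A0; have r1 := abs_nonneg A1; have r2 := abs_nonneg A2
    have r3 := abs_nonneg A3; have r4 := abs_nonneg A4; have r5 := abs_nonneg A5
    refine ⟨?_, ?_, ?_, ?_, ?_, ?_⟩ <;> linarith
  obtain ⟨C, hC⟩ := comb (bdd _ cF0) (bdd _ cF1) (bdd _ cF2) (bdd _ sw0.continuous)
    (bdd _ sw1.continuous) (bdd _ sw2.continuous)
  obtain ⟨C', hC'⟩ := comb ⟨C0, fun x _ => bG0 x⟩ ⟨C1, fun x _ => bG1 x⟩ ⟨C2, fun x _ => bG2 x⟩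
    (bdd _ cz0) (bdd _ cz1) (bdd _ cz2)
  have R1 := (three_combine hD0.le hlm hl hη hκ' c0 c1 c2 mG0 mG1 mG2 cz0.measurable cz1.measurable
    cz2.measurable hC' (fun x hx => ortg x (oG0 x) (oG1 x) (oG2 x)) ez0 ez1 ez2).1
  have R2 := (three_combine hD0.le hlm hl hη hκ' c0 c1 c2 cF0.measurable cF1.measurable
    cF2.measurable sw0.continuous.measurable sw1.continuous.measurable sw2.continuous.measurable
     hC (fun x hx => ortg x (oF0 x hx) (oF1 x hx) (oF2 x hx)) ew0 ew1 ew2).2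
  set n0 := ∫ x in (0:ℝ)..D, F0 x ^ 2 * h x ^ n
  set n1 := ∫ x in (0:ℝ)..D, F1 x ^ 2 * h x ^ n
  set n2 := ∫ x in (0:ℝ)..D, F2 x ^ 2 * h x ^ n
  have g0 := mul_le_mul_of_nonneg_left GF0 (sq_nonneg c0)
  have g1 := mul_le_mul_of_nonneg_left GF1 (sq_nonneg c1)
  have g2 := mul_le_mul_of_nonneg_left GF2 (sq_nonneg c2)
  have hS : 0 < c0^2 * n0 + c1^2 * n1 + c2^2 * n2 := by
    rcases hcne with hh | hh | hh <;> positivity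
  set S := c0^2 * n0 + c1^2 * n1 + c2^2 * n2
  set X := ∫ x in (0:ℝ)..D, (c0 * w0 x + c1 * w1 x + c2 * w2 x) ^ 2 * h x ^ n
  set Y := ∫ x in (0:ℝ)..D, (c0 * z0 x + c1 * z1 x + c2 * z2 x) ^ 2 * h x ^ n
  have hY : Y ≤ (1 + 2 * η) * S := by
    have := mul_le_mul_of_nonneg_left (add_le_add (add_le_add g0 g1) g2) (show 0 ≤ 1 + η by linarith)
    linarith
  have hX : (1 - η) * S ≤ (1 + η) * X := by linarith
  constructor
  · have : 0 < (1 - η) * S := mul_pos (by linarith) hS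
    exact pos_of_mul_pos_right (this.trans_le hX) (by linarith)
  · have a1 := mul_le_mul_of_nonneg_left hY (show 0 ≤ 1 - η by linarith)
    have a2 := mul_le_mul_of_nonneg_left hX (show 0 ≤ 1 + 2 * η by linarith)
    linarith

end

section
open scoped ContDiff

theorem kroger_aux {n : ℕ} (hn : 2 ≤ n) (Ω : Set (Euc (n+1))) (hΩ : IsConvexDomain Ω)
    {p q : Euc (n+1)} (hp : p ∈ Ω) (hq : q ∈ Ω) (hpq : p ≠ q) {η : ℝ} (hη : 0 < η) (hη1 : η < 1) :
    ∃ V : Submodule ℝ (Euc (n+1) → ℝ),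
    (∀ u ∈ V, ContDiff ℝ (⊤ : ℕ∞) u) ∧
    Module.finrank ℝ (V.map (LinearMap.funLeft ℝ ℝ ((↑) : Ω → Euc (n+1)))) = 2 + 1 ∧
    sSup { r : ℝ | ∃ u ∈ V, (0 < ∫ x in Ω, (u x) ^ 2) ∧ r = rayleigh Ω u } ≤
      (1 + 2 * η) * (1 + η) / (1 - η) *
      ((besselZero1 (((n:ℝ)-1)/2) + besselZero2 (((n:ℝ)-1)/2)) / ‖q - p‖) ^ 2 := by
  have hnorm : 0 < ‖q - p‖ := norm_pos_iff.2 (sub_ne_zero.2 hpq.symm)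
  set e : Euc (n+1) := ‖q - p‖⁻¹ • (q - p) with hedef
  have he : ‖e‖ = 1 := by rw [hedef, norm_smul, norm_inv, norm_norm, inv_mul_cancel₀ hnorm.ne']
  obtain ⟨a, b, H, h, hab, him, hcon, hpos, hm, hmap⟩ := section_lemma n (by omega) Ω hΩ e he
  obtain ⟨Φ, qq, v, v1, B⟩ := bessel_pack hn
  set j1 := besselZero1 (((n:ℝ)-1)/2)
  set j2 := besselZero2 (((n:ℝ)-1)/2)
  have hj1 := B.j1_pos
  have hj12 := B.j12
  set D := j1 + j2 with hD
  have hD0 : 0 < D := by linarith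
  set s := (b - a) / D with hs
  have hba : 0 < b - a := by linarith
  have hs0 : 0 < s := div_pos hba hD0
  have hsD : s * D = b - a := by rw [hs]; field_simp
  have hw : ‖q - p‖ ≤ b - a := by
    have h1 : inner ℝ e p ∈ Set.Ioo a b := him ▸ ⟨p, hp, rfl⟩
    have h2 : inner ℝ e q ∈ Set.Ioo a b := him ▸ ⟨q, hq, rfl⟩
    have h3 : inner ℝ e (q - p) = ‖q - p‖ := by
      rw [hedef, real_inner_smul_left, real_inner_self_eq_norm_sq]; field_simp
    rw [inner_sub_right] at h3
    linarith [h1.1, h2.2]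
  have hmem : ∀ x ∈ Set.Ioo 0 D, a + s * x ∈ Set.Ioo a b := fun x hx => by
    have h1 := mul_pos hs0 hx.1
    have h2 := mul_lt_mul_of_pos_left hx.2 hs0
    exact ⟨by linarith, by linarith⟩
  have hc' : ConcaveOn ℝ (Set.Ioo 0 D) (fun x => h (a + s * x)) := by
    refine ⟨convex_Ioo _ _, fun x hx y hy α β hα hβ hαβ => ?_⟩
    have := hcon.2 (hmem x hx) (hmem y hy) hα hβ hαβ
    simp only [smul_eq_mul] at this ⊢
    convert this using 2
    linear_combination (-a) * hαβ
  obtain ⟨w0, w1, w2, z0, z1, z2, ⟨sw0, sw1, sw2⟩, hd, ⟨cz0, cz1, cz2⟩, hR⟩ :=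
    three_approx hn (by ring) B hD hc' (fun x hx => hpos _ (hmem x hx)) (by fun_prop) hη hη1
  let φ : Euc (n+1) → ℝ := fun x => (inner ℝ e x - a) / s
  have hφ : ContDiff ℝ ∞ φ := by
    refine ContDiff.div_const ?_ s
    exact (contDiff_const.inner ℝ contDiff_id).sub contDiff_const
  let U : Fin 3 → Euc (n+1) → ℝ := ![w0 ∘ φ, w1 ∘ φ, w2 ∘ φ]
  have hU : ∀ i, ContDiff ℝ ∞ (U i) := by
    intro i; fin_cases i
    · exact sw0.comp hφ
    · exact sw1.comp hφ
    · exact sw2.comp hφ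
  have hch : ∀ k : ℝ → ℝ, ∫ t in a..b, k ((t - a)/s) * h t ^ n
      = s * ∫ x in (0:ℝ)..D, k x * h (a + s * x) ^ n := by
    intro k
    have := intervalIntegral.mul_integral_comp_add_mul (a := 0) (b := D)
      (f := fun t => k ((t - a)/s) * h t ^ n) s a
    rw [mul_zero, add_zero, hsD] at this
    rw [show a + (b - a) = b by ring] at this
    rw [← this]
    congr 1
    refine intervalIntegral.integral_congr fun x _ => ?_
    congr 2
    field_simp; ring
  have hint : ∀ k : ℝ → ℝ, Measurable k → ∫ x in Ω, k (φ x) =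
      s * ∫ x in (0:ℝ)..D, k x * h (a + s * x) ^ n := by
    intro k hk
    rw [← hch k]
    exact integral_of_map_eq hab (fun t ht => (hpos t ht).1) hm hmap (fun t => k ((t - a)/s)) (by fun_prop)
  have hu2 : ∀ c : Fin 3 → ℝ, ∫ x in Ω, ((∑ i, c i • U i) x) ^ 2 =
      s * ∫ x in (0:ℝ)..D, (c 0 * w0 x + c 1 * w1 x + c 2 * w2 x) ^ 2 * h (a + s * x) ^ n := by
    intro c
    rw [← hint (fun y => (c 0 * w0 y + c 1 * w1 y + c 2 * w2 y) ^ 2)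
      (by have := sw0.continuous; have := sw1.continuous; have := sw2.continuous; fun_prop)]
    simp [Fin.sum_univ_three, U]
  have hdu : ∀ (c : Fin 3 → ℝ) x, ‖fderiv ℝ (∑ i, c i • U i) x‖ =
      |(c 0 * z0 (φ x) + c 1 * z1 (φ x) + c 2 * z2 (φ x)) / s| := by
    intro c x
    have h1 : HasFDerivAt φ (s⁻¹ • innerSL ℝ e) x := by
      have : HasFDerivAt (fun y => inner ℝ e y) (innerSL ℝ e) x := (innerSL ℝ e).hasFDerivAt
      have h2 := (this.sub_const a).const_smul s⁻¹
      refine h2.congr_of_eventuallyEq (Eventually.of_forall fun y => ?_)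
      simp only [φ, Pi.smul_apply, smul_eq_mul]; ring
    have h2 : HasDerivAt (fun y => c 0 * w0 y + c 1 * w1 y + c 2 * w2 y)
        (c 0 * z0 (φ x) + c 1 * z1 (φ x) + c 2 * z2 (φ x)) (φ x) :=
      (((hd (φ x)).1.const_mul _).add ((hd (φ x)).2.1.const_mul _)).add ((hd (φ x)).2.2.const_mul _)
    have h3 := h2.comp_hasFDerivAt x h1
    have h4 : (∑ i, c i • U i) = (fun y => c 0 * w0 y + c 1 * w1 y + c 2 * w2 y) ∘ φ := by
      ext y; simp [Fin.sum_univ_three, U]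
    rw [h4, h3.fderiv, norm_smul, norm_smul, innerSL_apply_norm, he, mul_one, ← norm_mul,
      Real.norm_eq_abs, div_eq_mul_inv]
  have hdu2 : ∀ c : Fin 3 → ℝ, ∫ x in Ω, ‖fderiv ℝ (∑ i, c i • U i) x‖ ^ 2 =
      s⁻¹ ^ 2 * (s * ∫ x in (0:ℝ)..D, (c 0 * z0 x + c 1 * z1 x + c 2 * z2 x) ^ 2 * h (a + s * x) ^ n) := by
    intro c
    rw [← hint (fun y => (c 0 * z0 y + c 1 * z1 y + c 2 * z2 y) ^ 2) (by fun_prop),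
      ← integral_const_mul]
    refine integral_congr_ae (Eventually.of_forall fun x => ?_)
    simp only [hdu, sq_abs]
    ring
  have hcne : ∀ c : Fin 3 → ℝ, c ≠ 0 → c 0 ≠ 0 ∨ c 1 ≠ 0 ∨ c 2 ≠ 0 := by
    intro c hc
    by_contra hcon
    push Not at hcon
    apply hc; ext i; fin_cases i <;> simp [hcon]
  have hli : LinearIndependent ℝ (fun i => LinearMap.funLeft ℝ ℝ ((↑) : Ω → Euc (n+1)) (U i)) := by
    rw [Fintype.linearIndependent_iff]
    intro c hc
    by_contra hcon
    have hc0 : c ≠ 0 := fun h => hcon fun i => by rw [h]; rfl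
    have h1 := (hR _ _ _ (hcne c hc0)).1
    have h2 := hu2 c
    have h3 : ∫ x in Ω, ((∑ i, c i • U i) x) ^ 2 = 0 := by
      rw [setIntegral_eq_zero_of_forall_eq_zero]
      intro x hx
      have := congrFun hc ⟨x, hx⟩
      simp only [Finset.sum_apply, Pi.smul_apply, LinearMap.funLeft_apply, Pi.zero_apply] at this
      simp only [smul_eq_mul] at this
      simp [this]
    have := mul_pos hs0 h1
    linarith
  refine ⟨Submodule.span ℝ (Set.range U), ?_, ?_, ?_⟩
  · intro u hu
    obtain ⟨c, rfl⟩ := (Submodule.mem_span_range_iff_exists_fun ℝ).1 hu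
    have : ContDiff ℝ ∞ (fun x => ∑ i, c i • U i x) :=
      ContDiff.sum fun i _ => (hU i).const_smul (c i)
    convert this using 1
    ext x; simp
  · rw [Submodule.map_span, ← Set.range_comp]
    have := finrank_span_eq_card hli
    simpa [Function.comp_def] using this
  · have hbd : 0 ≤ (1 + 2 * η) * (1 + η) / (1 - η) * (D / ‖q - p‖) ^ 2 := by
      have : 0 < 1 - η := by linarith
      positivity
    refine Real.sSup_le ?_ hbd
    rintro r ⟨u, hu, hupos, rfl⟩
    obtain ⟨c, rfl⟩ := (Submodule.mem_span_range_iff_exists_fun ℝ).1 hu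
    have hc0 : c ≠ 0 := by
      rintro rfl; simp at hupos
    obtain ⟨hX, hY⟩ := hR _ _ _ (hcne c hc0)
    rw [rayleigh, hu2, hdu2, div_le_iff₀ (mul_pos hs0 hX)]
    set X := ∫ x in (0:ℝ)..D, (c 0 * w0 x + c 1 * w1 x + c 2 * w2 x) ^ 2 * h (a + s * x) ^ n
    set Y := ∫ x in (0:ℝ)..D, (c 0 * z0 x + c 1 * z1 x + c 2 * z2 x) ^ 2 * h (a + s * x) ^ n
    have hη2 : 0 < 1 - η := by linarith
    have e1 : Y ≤ (1 + 2 * η) * (1 + η) / (1 - η) * X := by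
      rw [div_mul_eq_mul_div, le_div_iff₀ hη2]; linarith
    have e2 : s⁻¹ ≤ D / ‖q - p‖ := by
      rw [hs, inv_div]
      exact div_le_div_of_nonneg_left hD0.le hnorm hw
    have e3 : s⁻¹ ^ 2 ≤ (D / ‖q - p‖) ^ 2 := pow_le_pow_left₀ (by positivity) e2 2
    calc s⁻¹ ^ 2 * (s * Y) ≤ s⁻¹ ^ 2 * (s * ((1 + 2 * η) * (1 + η) / (1 - η) * X)) := by gcongr
      _ ≤ (D / ‖q - p‖) ^ 2 * (s * ((1 + 2 * η) * (1 + η) / (1 - η) * X)) := by gcongr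
      _ = _ := by ring

theorem rayleigh_nonneg {d : ℕ} (Ω : Set (Euc d)) (u : Euc d → ℝ) : 0 ≤ rayleigh Ω u :=
  div_nonneg (integral_nonneg fun x => by positivity) (integral_nonneg fun x => by positivity)

theorem kroger {n : ℕ} (hn : 2 ≤ n) (Ω : Set (Euc (n+1))) (hΩ : IsConvexDomain Ω)
    {p q : Euc (n+1)} (hp : p ∈ Ω) (hq : q ∈ Ω) (hpq : p ≠ q) :
    neumannEigenvalue 2 Ω ≤
      ((besselZero1 (((n:ℝ)-1)/2) + besselZero2 (((n:ℝ)-1)/2)) / ‖q - p‖) ^ 2 := by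
  set T := ((besselZero1 (((n:ℝ)-1)/2) + besselZero2 (((n:ℝ)-1)/2)) / ‖q - p‖) ^ 2
  have key : ∀ η ∈ Set.Ioo (0:ℝ) 1, neumannEigenvalue 2 Ω ≤ (1 + 2 * η) * (1 + η) / (1 - η) * T := by
    intro η hη
    obtain ⟨V, h1, h2, h3⟩ := kroger_aux hn Ω hΩ hp hq hpq hη.1 hη.2
    refine le_trans (csInf_le ⟨0, ?_⟩ ⟨V, h1, h2, rfl⟩) h3
    rintro t ⟨V', -, -, rfl⟩
    refine Real.sSup_nonneg ?_
    rintro r ⟨u, -, -, rfl⟩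
    exact rayleigh_nonneg _ _
  have ht : Tendsto (fun η : ℝ => (1 + 2 * η) * (1 + η) / (1 - η) * T) (nhdsWithin 0 (Set.Ioi 0))
      (nhds T) := by
    have : ContinuousAt (fun η : ℝ => (1 + 2 * η) * (1 + η) / (1 - η) * T) 0 := by
      refine ContinuousAt.mul (ContinuousAt.div ?_ ?_ (by norm_num)) continuousAt_const <;>
        exact Continuous.continuousAt (by fun_prop)
    have h := this.tendsto
    simp only [mul_zero, add_zero, sub_zero, mul_one, div_one, one_mul] at h
    exact h.mono_left nhdsWithin_le_nhds
  refine ge_of_tendsto ht ?_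
  filter_upwards [Ioo_mem_nhdsGT (show (0:ℝ) < 1 by norm_num)] with η hη
  exact key η hη

end

section
/-- Payne-Weinberger for a smooth concave profile. -/
theorem pw_smooth {α β δ : ℝ} (hαβ : α < β) (hδ : 0 < δ) (n : ℕ) {g g1 g2 f f1 : ℝ → ℝ}
    (hg : ∀ x, HasDerivAt g (g1 x) x) (hg1 : ∀ x, HasDerivAt g1 (g2 x) x)
    (hpos : ∀ x ∈ Set.Icc α β, 0 < g x) (hneg : ∀ x ∈ Set.Icc α β, g2 x ≤ 0)
    (hf : ∀ x, HasDerivAt f (f1 x) x) (hf1 : Continuous f1)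
    (h0 : ∫ x in α..β, f x * g x ^ n = 0) :
    (π / (β - α + 2 * δ)) ^ 2 * ∫ x in α..β, f x ^ 2 * g x ^ n ≤ ∫ x in α..β, f1 x ^ 2 * g x ^ n := by
  set c := π / (β - α + 2 * δ) with hc
  have hc0 : 0 < c := div_pos pi_pos (by linarith)
  have gc : Continuous g := continuous_iff_continuousAt.2 fun x => (hg x).continuousAt
  have fc : Continuous f := continuous_iff_continuousAt.2 fun x => (hf x).continuousAt
  have hlc : Continuous fun x => f x * g x ^ n := by fun_prop
  let Hf : ℝ → ℝ := fun x => ∫ y in α..x, f y * g y ^ n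
  have hH : ∀ x, HasDerivAt Hf (f x * g x ^ n) x := fun x =>
    intervalIntegral.integral_hasDerivAt_right (hlc.intervalIntegrable _ _)
      (hlc.stronglyMeasurableAtFilter _ _) hlc.continuousAt
  have hHα : Hf α = 0 := intervalIntegral.integral_same
  have hHβ : Hf β = 0 := h0
  let θ : ℝ → ℝ := fun x => c * (x - α + δ)
  have hθ : ∀ x, HasDerivAt θ c x := fun x => by
    have := (((hasDerivAt_id x).sub_const α).add_const δ).const_mul c
    simpa using this
  have hsin : ∀ x ∈ Set.Icc α β, 0 < sin (θ x) := by
    intro x hx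
    apply sin_pos_of_pos_of_lt_pi
    · have : 0 < x - α + δ := by linarith [hx.1]
      exact mul_pos hc0 this
    · have : c * (x - α + δ) < c * (β - α + 2 * δ) := by
        apply mul_lt_mul_of_pos_left _ hc0
        linarith [hx.2]
      have h2 : c * (β - α + 2 * δ) = π := by
        rw [hc]; field_simp [show β - α + 2 * δ ≠ 0 by linarith]
      simp only [θ]; linarith
  -- r = n g1/(2g) + c cos/sin ; M = -2 c² f H + c² H² r / g^n
  let r : ℝ → ℝ := fun x => (n / 2 : ℝ) * (g1 x / g x) + c * (cos (θ x) / sin (θ x))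
  let M : ℝ → ℝ := fun x => -2 * c ^ 2 * (f x * Hf x) + c ^ 2 * (Hf x ^ 2 * (r x / g x ^ n))
  let r' : ℝ → ℝ := fun x => (n / 2 : ℝ) * ((g2 x * g x - g1 x * g1 x) / g x ^ 2) +
    c * ((-sin (θ x) * c * sin (θ x) - cos (θ x) * (cos (θ x) * c)) / sin (θ x) ^ 2)
  have hr : ∀ x ∈ Set.Icc α β, HasDerivAt r (r' x) x := by
    intro x hx
    have h1 := ((hg1 x).div (hg x) (hpos x hx).ne').const_mul (n / 2 : ℝ)
    have h2 := (((hθ x).cos).div ((hθ x).sin) (hsin x hx).ne').const_mul c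
    exact h1.add h2
  let M' : ℝ → ℝ := fun x => -2 * c ^ 2 * (f1 x * Hf x + f x * (f x * g x ^ n)) +
    c ^ 2 * (2 * Hf x * (f x * g x ^ n) * (r x / g x ^ n) +
      Hf x ^ 2 * ((r' x * g x ^ n - r x * (n * g x ^ (n - 1) * g1 x)) / (g x ^ n) ^ 2))
  have hM : ∀ x ∈ Set.Icc α β, HasDerivAt M (M' x) x := by
    intro x hx
    have h1 := ((hf x).mul (hH x)).const_mul (-2 * c ^ 2)
    have h2 := ((hH x).pow 2).mul ((hr x hx).div ((hg x).pow n) (pow_pos (hpos x hx) n).ne')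
    refine (h1.add (h2.const_mul (c ^ 2))).congr_deriv ?_
    simp only [M', Pi.div_apply, Pi.pow_apply]
    ring
  have hle : ∀ x ∈ Set.Icc α β, M' x ≤ f1 x ^ 2 * g x ^ n - c ^ 2 * (f x ^ 2 * g x ^ n) := by
    intro x hx
    have gp := hpos x hx
    have sp := hsin x hx
    have hsc := sin_sq_add_cos_sq (θ x)
    set S := sin (θ x)
    set C := cos (θ x)
    set m := g1 x / g x with hm
    set k := C / S with hk
    set l := g x ^ n with hl
    have lp : 0 < l := pow_pos gp n
    have e1 : (-S * c * S - C * (C * c)) / S ^ 2 = - c * (1 + k ^ 2) := by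
      rw [hk]; field_simp; ring
    have e2 : (n * g x ^ (n - 1) * g1 x) = n * l * m := by
      rw [hl, hm]
      rcases n with _ | n
      · simp
      · simp only [Nat.add_sub_cancel]; rw [pow_succ]; field_simp
    have e3 : (g2 x * g x - g1 x * g1 x) / g x ^ 2 = g2 x / g x - m ^ 2 := by
      rw [hm]; field_simp
    have g2n : g2 x / g x ≤ 0 := div_nonpos_of_nonpos_of_nonneg (hneg x hx) gp.le
    simp only [M', r, r']
    rw [e1, e2, e3]
    set z := g2 x / g x
    set R := (n / 2 : ℝ) * m + c * k with hR
    set u := Hf x / l with hu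
    have hHu : Hf x = u * l := by rw [hu]; field_simp
    rw [hHu]
    have e4 : -2 * c ^ 2 * (f1 x * (u * l) + f x * (f x * l)) +
      c ^ 2 * (2 * (u * l) * (f x * l) * (R / l) +
      (u * l) ^ 2 * (((n / 2 * (z - m ^ 2) + c * (-c * (1 + k ^ 2))) * l - R * (n * l * m)) / l ^ 2)) =
      l * (-2 * c ^ 2 * (f1 x * u + f x * f x) + c ^ 2 * (2 * u * f x * R +
        u ^ 2 * (n / 2 * (z - m ^ 2) + c * (-c * (1 + k ^ 2)) - R * (n * m)))) := by
      field_simp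
    rw [e4]
    have e5 : f1 x ^ 2 * l - c ^ 2 * (f x ^ 2 * l) = l * (f1 x ^ 2 - c ^ 2 * f x ^ 2) := by ring
    rw [e5]
    refine mul_le_mul_of_nonneg_left ?_ lp.le
    -- (f1 + c² u)² + c² (f - R u)² + extra
    have e6 : (f1 x ^ 2 - c ^ 2 * f x ^ 2) - (-2 * c ^ 2 * (f1 x * u + f x * f x) + c ^ 2 * (2 * u * f x * R +
        u ^ 2 * (n / 2 * (z - m ^ 2) + c * (-c * (1 + k ^ 2)) - R * (n * m)))) =
        (f1 x + c ^ 2 * u) ^ 2 + c ^ 2 * (f x - R * u) ^ 2 +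
        c ^ 2 * u ^ 2 * ((n/2) * (- z) + (n/2) * m ^ 2 + ((n/2) * m) ^ 2) := by
      rw [hR]; ring
    have hn0 : (0:ℝ) ≤ n := Nat.cast_nonneg n
    have : 0 ≤ (f1 x + c ^ 2 * u) ^ 2 + c ^ 2 * (f x - R * u) ^ 2 +
        c ^ 2 * u ^ 2 * ((n/2) * (- z) + (n/2) * m ^ 2 + ((n/2) * m) ^ 2) := by
      have : 0 ≤ -z := by linarith
      positivity
    linarith
  have ic : Continuous fun x => f1 x ^ 2 * g x ^ n - c ^ 2 * (f x ^ 2 * g x ^ n) := by fun_prop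
  have key := intervalIntegral.sub_le_integral_of_hasDeriv_right_of_le hαβ.le (g := M) (g' := M')
    (φ := fun x => f1 x ^ 2 * g x ^ n - c ^ 2 * (f x ^ 2 * g x ^ n))
    (fun x hx => (hM x hx).continuousAt.continuousWithinAt)
    (fun x hx => (hM x (Set.Ioo_subset_Icc_self hx)).hasDerivWithinAt)
    ic.continuousOn.integrableOn_Icc
    (fun x hx => hle x (Set.Ioo_subset_Icc_self hx))
  have hMα : M α = 0 := by simp [M, hHα]
  have hMβ : M β = 0 := by simp [M, hHβ]
  rw [hMα, hMβ, intervalIntegral.integral_sub (Continuous.intervalIntegrable (by fun_prop) _ _)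
    (Continuous.intervalIntegrable (by fun_prop) _ _), intervalIntegral.integral_const_mul] at key
  linarith

theorem pw_smooth_var {α β δ : ℝ} (hαβ : α < β) (hδ : 0 < δ) (n : ℕ) {g g1 g2 f f1 : ℝ → ℝ}
    (hg : ∀ x, HasDerivAt g (g1 x) x) (hg1 : ∀ x, HasDerivAt g1 (g2 x) x)
    (hpos : ∀ x ∈ Set.Icc α β, 0 < g x) (hneg : ∀ x ∈ Set.Icc α β, g2 x ≤ 0)
    (hf : ∀ x, HasDerivAt f (f1 x) x) (hf1 : Continuous f1) :
    (π / (β - α + 2 * δ)) ^ 2 * ((∫ x in α..β, f x ^ 2 * g x ^ n) * (∫ x in α..β, 1 * g x ^ n)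
      - (∫ x in α..β, f x * g x ^ n) ^ 2) ≤
      (∫ x in α..β, f1 x ^ 2 * g x ^ n) * ∫ x in α..β, 1 * g x ^ n := by
  have gc : Continuous g := continuous_iff_continuousAt.2 fun x => (hg x).continuousAt
  have fc : Continuous f := continuous_iff_continuousAt.2 fun x => (hf x).continuousAt
  have hA : 0 < ∫ x in α..β, 1 * g x ^ n := by
    refine intervalIntegral.intervalIntegral_pos_of_pos_on
      (Continuous.intervalIntegrable (by fun_prop) _ _) (fun x hx => ?_) hαβ
    have := hpos x (Set.Ioo_subset_Icc_self hx)
    positivity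
  set A := ∫ x in α..β, 1 * g x ^ n with hAd
  set B := ∫ x in α..β, f x * g x ^ n with hB
  have hi : ∀ k : ℝ → ℝ, Continuous k → IntervalIntegrable k volume α β := fun k hk =>
    hk.intervalIntegrable _ _
  have h0 : ∫ x in α..β, (f x - B / A) * g x ^ n = 0 := by
    have : ∀ x, (f x - B / A) * g x ^ n = f x * g x ^ n - B / A * (1 * g x ^ n) := fun x => by ring
    simp only [this]
    rw [intervalIntegral.integral_sub (hi _ (by fun_prop)) (hi _ (by fun_prop)),
      intervalIntegral.integral_const_mul, ← hAd, ← hB]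
    field_simp; ring
  have h := pw_smooth hαβ hδ n hg hg1 hpos hneg (f := fun x => f x - B / A) (f1 := f1)
    (fun x => (hf x).sub_const _) hf1 h0
  have h1 : ∫ x in α..β, (f x - B / A) ^ 2 * g x ^ n =
      (∫ x in α..β, f x ^ 2 * g x ^ n) - B ^ 2 / A := by
    have : ∀ x, (f x - B / A) ^ 2 * g x ^ n = f x ^ 2 * g x ^ n - 2 * (B / A) * (f x * g x ^ n) +
        (B / A) ^ 2 * (1 * g x ^ n) := fun x => by ring
    simp only [this]
    rw [intervalIntegral.integral_add (hi _ (by fun_prop)) (hi _ (by fun_prop)),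
      intervalIntegral.integral_sub (hi _ (by fun_prop)) (hi _ (by fun_prop)),
      intervalIntegral.integral_const_mul, intervalIntegral.integral_const_mul, ← hAd, ← hB]
    field_simp; ring
  rw [h1] at h
  have h2 := mul_le_mul_of_nonneg_right h hA.le
  refine le_trans (le_of_eq ?_) h2
  field_simp

/-- Smooth approximation of a concave function. -/
theorem concave_approx {a b H ε : ℝ} {h : ℝ → ℝ} (hc : ConcaveOn ℝ (Set.Ioo a b) h)
    (hpos : ∀ x ∈ Set.Ioo a b, 0 < h x ∧ h x ≤ H) {α β : ℝ} (ha : a < α) (hαβ : α < β) (hb : β < b)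
    (hε : 0 < ε) : ∃ g g1 g2 : ℝ → ℝ, (∀ x, HasDerivAt g (g1 x) x) ∧ (∀ x, HasDerivAt g1 (g2 x) x) ∧
      (∀ x ∈ Set.Icc α β, 0 < g x ∧ g x ≤ H ∧ |g x - h x| ≤ ε) ∧ ∀ x ∈ Set.Icc α β, g2 x ≤ 0 := by
  have hcont : ContinuousOn h (Set.Ioo a b) := hc.continuousOn isOpen_Ioo
  set β' := (β + b) / 2
  have hβ' : β < β' ∧ β' < b := ⟨by simp only [β']; linarith, by simp only [β']; linarith⟩
  have hsub : Set.Icc α β' ⊆ Set.Ioo a b := fun x hx => ⟨by linarith [hx.1], by linarith [hx.2]⟩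
  have huc := isCompact_Icc.uniformContinuousOn_of_continuous (hcont.mono hsub)
  rw [Metric.uniformContinuousOn_iff] at huc
  obtain ⟨δ, hδ, huc⟩ := huc ε hε
  obtain ⟨σ, hσ, hσ1, hσ2⟩ : ∃ σ : ℝ, 0 < σ ∧ 2 * σ < δ ∧ β + 2 * σ < β' := by
    refine ⟨min (δ / 4) ((β' - β) / 4), by apply lt_min <;> linarith [hβ'.1], ?_, ?_⟩
    · have := min_le_left (δ / 4) ((β' - β) / 4); linarith
    · have := min_le_right (δ / 4) ((β' - β) / 4); linarith [hβ'.1]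
  let k : ℝ → ℝ := fun x => h (max α (min β' x))
  have hkc : Continuous k := by
    rw [← continuousOn_univ]
    refine hcont.comp (by fun_prop) fun x _ => hsub ⟨le_max_left _ _, max_le (by linarith [hβ'.1]) (min_le_left _ _)⟩
  have hk : ∀ x ∈ Set.Icc α β', k x = h x := fun x hx => by simp [k, hx.1, hx.2]
  let K : ℝ → ℝ := fun x => ∫ y in α..x, k y
  have hK : ∀ x, HasDerivAt K (k x) x := fun x =>
    intervalIntegral.integral_hasDerivAt_right (hkc.intervalIntegrable _ _)
      (hkc.stronglyMeasurableAtFilter _ _) hkc.continuousAt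
  have hKc : Continuous K := continuous_iff_continuousAt.2 fun x => (hK x).continuousAt
  let J : ℝ → ℝ := fun x => ∫ y in α..x, K y
  have hJ : ∀ x, HasDerivAt J (K x) x := fun x =>
    intervalIntegral.integral_hasDerivAt_right (hKc.intervalIntegrable _ _)
      (hKc.stronglyMeasurableAtFilter _ _) hKc.continuousAt
  have sh : ∀ (P P1 : ℝ → ℝ), (∀ x, HasDerivAt P (P1 x) x) → ∀ x,
      HasDerivAt (fun x => (P (x + 2 * σ) - 2 * P (x + σ) + P x) / σ ^ 2)
        ((P1 (x + 2 * σ) - 2 * P1 (x + σ) + P1 x) / σ ^ 2) x := by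
    intro P P1 hP x
    have h1 : HasDerivAt (fun x => P (x + 2 * σ)) (P1 (x + 2 * σ)) x := (hP _).comp_add_const x _
    have h2 : HasDerivAt (fun x => P (x + σ)) (P1 (x + σ)) x := (hP _).comp_add_const x _
    exact ((h1.sub (h2.const_mul 2)).add (hP x)).div_const _
  refine ⟨_, _, _, sh J K hJ, sh K k hK, ?_, ?_⟩
  · intro x hx
    -- mean value twice
    have hA : ∀ y, HasDerivAt (fun y => J (y + σ) - J y) (K (y + σ) - K y) y := fun y =>
      ((hJ _).comp_add_const y σ).sub (hJ y)
    obtain ⟨ξ, hξ, e1⟩ := exists_hasDerivAt_eq_slope (fun y => J (y + σ) - J y) _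
      (show x < x + σ by linarith)
      (fun y _ => (hA y).continuousAt.continuousWithinAt) (fun y _ => hA y)
    obtain ⟨ζ, hζ, e2⟩ := exists_hasDerivAt_eq_slope K _ (show ξ < ξ + σ by linarith)
      (fun y _ => (hK y).continuousAt.continuousWithinAt) (fun y _ => hK y)
    have hζ1 : ζ ∈ Set.Icc α β' := ⟨by linarith [hx.1, hξ.1, hζ.1], by linarith [hx.2, hξ.2, hζ.2]⟩
    have hx1 : x ∈ Set.Icc α β' := ⟨hx.1, by linarith [hx.2, hβ'.1]⟩
    have e : (J (x + 2 * σ) - 2 * J (x + σ) + J x) / σ ^ 2 = h ζ := by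
      rw [← hk ζ hζ1, e2]
      have : K (ξ + σ) - K ξ = (J (x + 2 * σ) - 2 * J (x + σ) + J x) / σ := by
        rw [e1]
        rw [show x + σ + σ = x + 2 * σ by ring, show x + σ - x = σ by ring]
        ring
      rw [this, show ξ + σ - ξ = σ by ring]
      field_simp
    rw [e]
    refine ⟨(hpos _ (hsub hζ1)).1, (hpos _ (hsub hζ1)).2, ?_⟩
    have := huc ζ hζ1 x hx1 (by
      rw [Real.dist_eq, abs_of_pos (by linarith [hξ.1, hζ.1])]; linarith [hξ.2, hζ.2])
    rw [Real.dist_eq] at this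
    exact this.le
  · intro x hx
    have m0 : x ∈ Set.Icc α β' := ⟨hx.1, by linarith [hx.2, hβ'.1]⟩
    have m1 : x + σ ∈ Set.Icc α β' := ⟨by linarith [hx.1], by linarith [hx.2, hβ'.1]⟩
    have m2 : x + 2 * σ ∈ Set.Icc α β' := ⟨by linarith [hx.1], by linarith [hx.2, hβ'.1]⟩
    rw [hk _ m0, hk _ m1, hk _ m2]
    have := hc.2 (hsub m0) (hsub m2) (show (0:ℝ) ≤ 1/2 by norm_num) (show (0:ℝ) ≤ 1/2 by norm_num) (by norm_num)
    simp only [smul_eq_mul] at this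
    rw [show 1 / 2 * x + 1 / 2 * (x + 2 * σ) = x + σ by ring] at this
    refine div_nonpos_of_nonpos_of_nonneg (by linarith) (by positivity)

end

section
theorem pw_one {a b H : ℝ} (hab : a < b) (n : ℕ) {h : ℝ → ℝ} (hc : ConcaveOn ℝ (Set.Ioo a b) h)
    (hpos : ∀ x ∈ Set.Ioo a b, 0 < h x ∧ h x ≤ H) {f f1 : ℝ → ℝ}
    (hf : ∀ x, HasDerivAt f (f1 x) x) (hf1 : Continuous f1) :
    (π / (b - a)) ^ 2 * ((∫ x in a..b, f x ^ 2 * h x ^ n) * (∫ x in a..b, 1 * h x ^ n)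
      - (∫ x in a..b, f x * h x ^ n) ^ 2) ≤
      (∫ x in a..b, f1 x ^ 2 * h x ^ n) * ∫ x in a..b, 1 * h x ^ n := by
  have fc : Continuous f := continuous_iff_continuousAt.2 fun x => (hf x).continuousAt
  let ε : ℕ → ℝ := fun N => (b - a) * (1 / ((N : ℝ) + 1)) / 3
  have hba : 0 < b - a := by linarith
  have hε0 : ∀ N, 0 < ε N := fun N => by positivity
  have hε1 : ∀ N, ε N ≤ (b - a) / 3 := fun N => by
    have : 1 / ((N : ℝ) + 1) ≤ 1 := by
      rw [div_le_one (by positivity)]; linarith [Nat.cast_nonneg (α := ℝ) N]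
    have := mul_le_mul_of_nonneg_left this hba.le
    simp only [ε]; linarith
  have hεt : Tendsto ε atTop (nhds 0) := by
    have := ((tendsto_one_div_add_atTop_nhds_zero_nat (𝕜 := ℝ)).const_mul (b - a)).div_const 3
    simpa [ε] using this
  have hα : ∀ N, a < a + ε N := fun N => by linarith [hε0 N]
  have hβ : ∀ N, b - ε N < b := fun N => by linarith [hε0 N]
  have hαβ : ∀ N, a + ε N < b - ε N := fun N => by linarith [hε1 N]
  choose g g1 g2 hg hg1 hg' hg2 using fun N =>
    concave_approx hc hpos (hα N) (hαβ N) (hβ N) (hε0 N)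
  have key := fun N => pw_smooth_var (hαβ N) (hε0 N) n (hg N) (hg1 N) (fun x hx => (hg' N x hx).1)
    (hg2 N) hf hf1
  have lim : ∀ F : ℝ → ℝ, Continuous F → Tendsto (fun N => ∫ x in (a + ε N)..(b - ε N), F x * g N x ^ n)
      atTop (nhds (∫ x in a..b, F x * h x ^ n)) := by
    intro F hF
    obtain ⟨C, hC⟩ := isCompact_Icc.exists_bound_of_continuousOn (hF.continuousOn (s := Set.Icc a b))
    have e1 : ∀ N, ∫ x in (a + ε N)..(b - ε N), F x * g N x ^ n =
        ∫ x in Set.Ioo a b, (Set.Ioc (a + ε N) (b - ε N)).indicator (fun x => F x * g N x ^ n) x := by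
      intro N
      rw [setIntegral_indicator measurableSet_Ioc, intervalIntegral.integral_of_le (hαβ N).le]
      congr 2
      rw [Set.inter_eq_right.2]
      exact fun x hx => ⟨by linarith [hx.1, hα N], by linarith [hx.2, hβ N]⟩
    simp only [e1]
    rw [intervalIntegral.integral_of_le hab.le, integral_Ioc_eq_integral_Ioo]
    refine tendsto_integral_of_dominated_convergence (fun _ => C * H ^ n) ?_ ?_ ?_ ?_
    · intro N
      have gc : Continuous (g N) := continuous_iff_continuousAt.2 fun x => (hg N x).continuousAt
      exact (Measurable.indicator (Continuous.measurable (by fun_prop)) measurableSet_Ioc).aestronglyMeasurable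
    · exact integrableOn_const (by simp)
    · intro N
      filter_upwards [ae_restrict_mem measurableSet_Ioo] with x hx
      have hCx := hC x (Set.Ioo_subset_Icc_self hx)
      have hC0 : 0 ≤ C := (norm_nonneg _).trans hCx
      have hH0 : 0 ≤ H := (hpos x hx).1.le.trans (hpos x hx).2
      by_cases hxN : x ∈ Set.Ioc (a + ε N) (b - ε N)
      · rw [Set.indicator_of_mem hxN, norm_mul, norm_pow]
        have := hg' N x (Set.Ioc_subset_Icc_self hxN)
        rw [Real.norm_eq_abs (g N x), abs_of_pos this.1]
        have := this.1.le
        gcongr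
        tauto
      · rw [Set.indicator_of_notMem hxN, norm_zero]; positivity
    · filter_upwards [ae_restrict_mem measurableSet_Ioo] with x hx
      have hin : ∀ᶠ N in atTop, x ∈ Set.Icc (a + ε N) (b - ε N) ∧ x ∈ Set.Ioc (a + ε N) (b - ε N) := by
        have hlt : 0 < min (x - a) (b - x) := lt_min (by linarith [hx.1]) (by linarith [hx.2])
        filter_upwards [hεt.eventually (gt_mem_nhds hlt)] with N hN
        have h1 := lt_of_lt_of_le hN (min_le_left _ _)
        have h2 := lt_of_lt_of_le hN (min_le_right _ _)
        exact ⟨⟨by linarith, by linarith⟩, ⟨by linarith, by linarith⟩⟩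
      have hgt : Tendsto (fun N => g N x) atTop (nhds (h x)) := by
        rw [tendsto_iff_dist_tendsto_zero]
        refine squeeze_zero' (Eventually.of_forall fun N => dist_nonneg) ?_ hεt
        filter_upwards [hin] with N hN
        exact (hg' N x hN.1).2.2
      refine ((hgt.pow n).const_mul (F x)).congr' ?_
      filter_upwards [hin] with N hN
      rw [Set.indicator_of_mem hN.2]
  have l1 := lim (fun x => f x ^ 2) (by fun_prop)
  have l2 := lim (fun x => 1) (by fun_prop)
  have l3 := lim f fc
  have l4 := lim (fun x => f1 x ^ 2) (by fun_prop)
  have L1 := ((l1.mul l2).sub (l3.pow 2)).const_mul ((π / (b - a)) ^ 2)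
  refine le_of_tendsto_of_tendsto' L1 (l4.mul l2) fun N => ?_
  have h := key N
  rw [show b - ε N - (a + ε N) + 2 * ε N = b - a by ring] at h
  exact h

end

section
/-- The cutting functional. -/
def cutf {d : ℕ} (a b : Fin d) (s t c1 c2 : ℝ) (x : Euc d) : ℝ := c1 * (x a - s) + c2 * (x b - t)

theorem cutf_cont {d : ℕ} (a b : Fin d) (s t c1 c2 : ℝ) : Continuous (cutf a b s t c1 c2) := by
  unfold cutf; fun_prop

theorem cutf_null {d : ℕ} {a b : Fin d} (hab : a ≠ b) (s t : ℝ) {c1 c2 : ℝ} (hc : c1 ^ 2 + c2 ^ 2 ≠ 0) :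
    volume {x : Euc d | cutf a b s t c1 c2 x = 0} = 0 := by
  let A : AffineSubspace ℝ (Euc d) :=
    { carrier := {x | cutf a b s t c1 c2 x = 0}
      smul_vsub_vadd_mem' := by
        intro r p q w hp hq hw
        simp only [cutf, Set.mem_ofPred_eq, vsub_eq_sub, vadd_eq_add] at *
        simp only [PiLp.add_apply, PiLp.smul_apply, PiLp.sub_apply, smul_eq_mul]
        linear_combination r * hp - r * hq + hw }
  refine Measure.addHaar_affineSubspace volume A ?_
  intro h
  apply hc
  have hall : ∀ x : Euc d, cutf a b s t c1 c2 x = 0 := fun x => by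
    have : x ∈ A := by rw [h]; trivial
    exact this
  have h1 := hall (WithLp.toLp 2 (fun i => if i = a then s + c1 else if i = b then t + c2 else 0))
  simp only [cutf, if_true, if_neg hab.symm] at h1
  linear_combination h1

theorem bisect {d : ℕ} {K : Set (Euc d)} (hK : IsConvexDomain K) {u Ψ : Euc d → ℝ}
    (hu : IntegrableOn u K) (hΨ : IntegrableOn Ψ K) (h0 : ∫ x in K, u x = 0)
    (hneg : ∫ x in K, Ψ x < 0) {a b : Fin d} (hab : a ≠ b) (s t : ℝ) :
    ∃ c1 c2 : ℝ, c1 ^ 2 + c2 ^ 2 ≠ 0 ∧ IsConvexDomain (K ∩ {x | 0 < cutf a b s t c1 c2 x}) ∧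
      ∫ x in K ∩ {x | 0 < cutf a b s t c1 c2 x}, u x = 0 ∧
      ∫ x in K ∩ {x | 0 < cutf a b s t c1 c2 x}, Ψ x < 0 := by
  obtain ⟨hne, ho, hb, hcv⟩ := hK
  have hopen : ∀ c1 c2, IsOpen {x : Euc d | 0 < cutf a b s t c1 c2 x} := fun c1 c2 =>
    isOpen_lt continuous_const (cutf_cont a b s t c1 c2)
  have hmeas : ∀ c1 c2, MeasurableSet {x : Euc d | 0 < cutf a b s t c1 c2 x} := fun c1 c2 =>
    (hopen c1 c2).measurableSet
  -- splitting
  have split : ∀ (c1 c2 : ℝ), c1 ^ 2 + c2 ^ 2 ≠ 0 → ∀ F : Euc d → ℝ, IntegrableOn F K →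
      (∫ x in K ∩ {x | 0 < cutf a b s t c1 c2 x}, F x) +
      (∫ x in K ∩ {x | 0 < cutf a b s t (-c1) (-c2) x}, F x) = ∫ x in K, F x := by
    intro c1 c2 hc F hF
    rw [← integral_inter_add_sdiff (hmeas c1 c2) hF]
    congr 1
    refine setIntegral_congr_set ?_
    have hn : ∀ᵐ x : Euc d, cutf a b s t c1 c2 x ≠ 0 := by
      rw [ae_iff]; simpa using cutf_null hab s t hc
    filter_upwards [hn] with x hx
    apply propext
    show (x ∈ K ∧ 0 < cutf a b s t (-c1) (-c2) x) ↔ (x ∈ K ∧ ¬ 0 < cutf a b s t c1 c2 x)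
    have e : cutf a b s t (-c1) (-c2) x = - cutf a b s t c1 c2 x := by simp only [cutf]; ring
    rw [e]
    constructor
    · rintro ⟨h1, h2⟩; exact ⟨h1, by linarith⟩
    · rintro ⟨h1, h2⟩
      exact ⟨h1, by have := lt_of_le_of_ne (not_lt.1 h2) hx; linarith⟩
  let m : ℝ → ℝ := fun θ => ∫ x in K ∩ {x | 0 < cutf a b s t (cos θ) (sin θ) x}, u x
  have hcs : ∀ θ, cos θ ^ 2 + sin θ ^ 2 ≠ 0 := fun θ => by rw [cos_sq_add_sin_sq]; norm_num
  have hmc : Continuous m := by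
    rw [continuous_iff_continuousAt]
    intro θ
    have e : ∀ θ, m θ = ∫ x in K, ({x | 0 < cutf a b s t (cos θ) (sin θ) x} : Set (Euc d)).indicator u x :=
      fun θ => (setIntegral_indicator (hmeas _ _)).symm
    rw [show m = fun θ => ∫ x in K, ({x | 0 < cutf a b s t (cos θ) (sin θ) x} : Set (Euc d)).indicator u x
      from funext e]
    refine continuousAt_of_dominated (bound := fun x => ‖u x‖) ?_ ?_ hu.norm ?_
    · exact Eventually.of_forall fun θ => hu.aestronglyMeasurable.indicator (hmeas _ _)
    · exact Eventually.of_forall fun θ => Eventually.of_forall fun x => norm_indicator_le_norm_self _ _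
    · have hn : ∀ᵐ x : Euc d, cutf a b s t (cos θ) (sin θ) x ≠ 0 := by
        rw [ae_iff]; simpa using cutf_null hab s t (hcs θ)
      filter_upwards [ae_restrict_of_ae hn] with x hx
      have hct : Continuous fun θ => cutf a b s t (cos θ) (sin θ) x := by unfold cutf; fun_prop
      rcases lt_or_gt_of_ne hx with h | h
      · refine continuousAt_const.congr (f := fun _ => (0:ℝ)) ?_
        filter_upwards [hct.continuousAt.eventually (gt_mem_nhds h)] with θ' h'
        rw [Set.indicator_of_notMem]
        simp only [Set.mem_ofPred_eq]
        exact not_lt.2 (le_of_lt h')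
      · refine continuousAt_const.congr (f := fun _ => u x) ?_
        filter_upwards [hct.continuousAt.eventually (lt_mem_nhds h)] with θ' h'
        rw [Set.indicator_of_mem]
        exact h'
  have hsym : m π = - m 0 := by
    have := split (cos 0) (sin 0) (hcs 0) u hu
    have e1 : cos π = - cos 0 := by simp
    have e2 : sin π = - sin 0 := by simp
    simp only [m, e1, e2]
    linarith
  obtain ⟨θ, hθ⟩ : ∃ θ, m θ = 0 := by
    rcases le_total (m 0) 0 with h | h
    · exact mem_range_of_exists_le_of_exists_ge hmc ⟨0, h⟩ ⟨π, by linarith⟩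
    · exact mem_range_of_exists_le_of_exists_ge hmc ⟨π, by linarith⟩ ⟨0, h⟩
  have fin : ∀ c1 c2 : ℝ, c1 ^ 2 + c2 ^ 2 ≠ 0 → ∫ x in K ∩ {x | 0 < cutf a b s t c1 c2 x}, u x = 0 →
      ∫ x in K ∩ {x | 0 < cutf a b s t c1 c2 x}, Ψ x < 0 →
      ∃ c1 c2 : ℝ, c1 ^ 2 + c2 ^ 2 ≠ 0 ∧ IsConvexDomain (K ∩ {x | 0 < cutf a b s t c1 c2 x}) ∧
      ∫ x in K ∩ {x | 0 < cutf a b s t c1 c2 x}, u x = 0 ∧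
      ∫ x in K ∩ {x | 0 < cutf a b s t c1 c2 x}, Ψ x < 0 := by
    intro c1 c2 hc h1 h2
    refine ⟨c1, c2, hc, ⟨?_, ho.inter (hopen _ _), hb.subset Set.inter_subset_left, hcv.inter ?_⟩, h1, h2⟩
    · by_contra hemp
      rw [Set.not_nonempty_iff_eq_empty] at hemp
      rw [hemp] at h2; simp at h2
    · intro x hx y hy α β hα hβ hαβ
      simp only [Set.mem_ofPred_eq] at *
      have e : cutf a b s t c1 c2 (α • x + β • y) = α * cutf a b s t c1 c2 x + β * cutf a b s t c1 c2 y := by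
        simp only [cutf, PiLp.add_apply, PiLp.smul_apply, smul_eq_mul]
        linear_combination (c1 * s + c2 * t) * hαβ
      rw [e]
      rcases hα.eq_or_lt with h | h
      · have : β = 1 := by linarith
        rw [← h, this]; linarith
      · have := mul_pos h hx
        have := mul_nonneg hβ hy.le
        linarith
  have s1 := split _ _ (hcs θ) u hu
  have s2 := split _ _ (hcs θ) Ψ hΨ
  by_cases hlt : ∫ x in K ∩ {x | 0 < cutf a b s t (cos θ) (sin θ) x}, Ψ x < 0
  · exact fin _ _ (hcs θ) hθ hlt
  · refine fin (-cos θ) (-sin θ) (by simpa using hcs θ) ?_ ?_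
    · have : m θ = 0 := hθ
      simp only [m] at this
      linarith
    · linarith

end

section
theorem cut_sequence {d : ℕ} {Ω : Set (Euc d)} (hΩ : IsConvexDomain Ω) {u Ψ : Euc d → ℝ}
    (hu : IntegrableOn u Ω) (hΨ : IntegrableOn Ψ Ω) (h0 : ∫ x in Ω, u x = 0)
    (hneg : ∫ x in Ω, Ψ x < 0) (σ : ℕ → Fin d × Fin d × ℚ × ℚ) :
    ∃ K : ℕ → Set (Euc d), (∀ i, IsConvexDomain (K i) ∧ K i ⊆ Ω ∧ ∫ x in K i, u x = 0 ∧
      ∫ x in K i, Ψ x < 0) ∧ (∀ i, K (i+1) ⊆ K i) ∧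
      ∀ i, (σ i).1 ≠ (σ i).2.1 → ∃ c1 c2 : ℝ, c1 ^ 2 + c2 ^ 2 ≠ 0 ∧
        ∀ x ∈ K (i+1), 0 < cutf (σ i).1 (σ i).2.1 (σ i).2.2.1 (σ i).2.2.2 c1 c2 x := by
  let P : Set (Euc d) → Prop := fun K => IsConvexDomain K ∧ K ⊆ Ω ∧ ∫ x in K, u x = 0 ∧
      ∫ x in K, Ψ x < 0
  have step : ∀ (i : ℕ) (K : {K : Set (Euc d) // P K}), ∃ K' : {K : Set (Euc d) // P K},
      K'.1 ⊆ K.1 ∧ ((σ i).1 ≠ (σ i).2.1 → ∃ c1 c2 : ℝ, c1 ^ 2 + c2 ^ 2 ≠ 0 ∧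
        ∀ x ∈ K'.1, 0 < cutf (σ i).1 (σ i).2.1 (σ i).2.2.1 (σ i).2.2.2 c1 c2 x) := by
    rintro i ⟨K, hK, hKΩ, hK0, hKn⟩
    by_cases hab : (σ i).1 = (σ i).2.1
    · exact ⟨⟨K, hK, hKΩ, hK0, hKn⟩, subset_rfl, fun h => absurd hab h⟩
    · obtain ⟨c1, c2, hc, hd, he, hf⟩ := bisect hK (hu.mono_set hKΩ) (hΨ.mono_set hKΩ) hK0 hKn hab
        (σ i).2.2.1 (σ i).2.2.2
      exact ⟨⟨_, hd, Set.inter_subset_left.trans hKΩ, he, hf⟩, Set.inter_subset_left,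
        fun _ => ⟨c1, c2, hc, fun x hx => hx.2⟩⟩
  choose nx hnx1 hnx2 using step
  let S : ℕ → {K : Set (Euc d) // P K} := fun i => Nat.rec ⟨Ω, hΩ, subset_rfl, h0, hneg⟩ (fun i K => nx i K) i
  exact ⟨fun i => (S i).1, fun i => (S i).2, fun i => hnx1 i (S i), fun i => hnx2 i (S i)⟩

theorem tri_rat {X1 X2 Y1 Y2 Z1 Z2 : ℝ} (hΔ : (Y1 - X1) * (Z2 - X2) - (Y2 - X2) * (Z1 - X1) ≠ 0) :
    ∃ s t : ℚ, ∀ c1 c2 : ℝ, 0 ≤ c1 * (X1 - s) + c2 * (X2 - t) → 0 ≤ c1 * (Y1 - s) + c2 * (Y2 - t) →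
      0 ≤ c1 * (Z1 - s) + c2 * (Z2 - t) → c1 = 0 ∧ c2 = 0 := by
  set Δ := (Y1 - X1) * (Z2 - X2) - (Y2 - X2) * (Z1 - X1) with hΔd
  let lam : ℝ × ℝ → ℝ := fun p => ((p.1 - X1) * (Z2 - X2) - (p.2 - X2) * (Z1 - X1)) / Δ
  let mu : ℝ × ℝ → ℝ := fun p => ((Y1 - X1) * (p.2 - X2) - (Y2 - X2) * (p.1 - X1)) / Δ
  have hlc : Continuous lam := by simp only [lam]; fun_prop
  have hmc : Continuous mu := by simp only [mu]; fun_prop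
  let O : Set (ℝ × ℝ) := {p | 0 < lam p} ∩ ({p | 0 < mu p} ∩ {p | lam p + mu p < 1})
  have hO : IsOpen O := (isOpen_lt continuous_const hlc).inter
    ((isOpen_lt continuous_const hmc).inter (isOpen_lt (hlc.add hmc) continuous_const))
  have hOn : O.Nonempty := by
    refine ⟨((X1 + Y1 + Z1) / 3, (X2 + Y2 + Z2) / 3), ?_⟩
    have e1 : lam ((X1 + Y1 + Z1) / 3, (X2 + Y2 + Z2) / 3) = 1 / 3 := by
      simp only [lam]; rw [div_eq_iff hΔ, hΔd]; ring
    have e2 : mu ((X1 + Y1 + Z1) / 3, (X2 + Y2 + Z2) / 3) = 1 / 3 := by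
      simp only [mu]; rw [div_eq_iff hΔ, hΔd]; ring
    refine ⟨?_, ?_, ?_⟩ <;> simp only [Set.mem_ofPred_eq, e1, e2] <;> norm_num
  have hdense : DenseRange (Prod.map ((↑) : ℚ → ℝ) ((↑) : ℚ → ℝ)) :=
    Rat.denseRange_cast.prodMap Rat.denseRange_cast
  obtain ⟨⟨s, t⟩, hst⟩ := hdense.exists_mem_open hO hOn
  refine ⟨s, t, fun c1 c2 hX hY hZ => ?_⟩
  obtain ⟨h1, h2, h3⟩ := hst
  simp only [Set.mem_ofPred_eq, Prod.map_apply] at h1 h2 h3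
  have el : lam ((s:ℝ), (t:ℝ)) * Δ = ((s - X1) * (Z2 - X2) - (t - X2) * (Z1 - X1)) := by
    simp only [lam]; field_simp
  have em : mu ((s:ℝ), (t:ℝ)) * Δ = ((Y1 - X1) * (t - X2) - (Y2 - X2) * (s - X1)) := by
    simp only [mu]; field_simp
  set l := lam ((s:ℝ), (t:ℝ))
  set m := mu ((s:ℝ), (t:ℝ))
  have es : (s:ℝ) = X1 + l * (Y1 - X1) + m * (Z1 - X1) := by
    apply mul_right_cancel₀ hΔ
    rw [add_mul, add_mul, mul_right_comm l, mul_right_comm m, el, em, hΔd]; ring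
  have et : (t:ℝ) = X2 + l * (Y2 - X2) + m * (Z2 - X2) := by
    apply mul_right_cancel₀ hΔ
    rw [add_mul, add_mul, mul_right_comm l, mul_right_comm m, el, em, hΔd]; ring
  set A := c1 * (X1 - s) + c2 * (X2 - t) with hA
  set B := c1 * (Y1 - s) + c2 * (Y2 - t) with hB
  set C := c1 * (Z1 - s) + c2 * (Z2 - t) with hC
  have hsum : (1 - l - m) * A + l * B + m * C = 0 := by
    rw [hA, hB, hC, es, et]; ring
  have p1 : 0 ≤ (1 - l - m) * A := mul_nonneg (by linarith) hX
  have p2 : 0 ≤ l * B := mul_nonneg h1.le hY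
  have p3 : 0 ≤ m * C := mul_nonneg h2.le hZ
  have zA : A = 0 := by
    have : (1 - l - m) * A = 0 := by linarith
    rcases mul_eq_zero.1 this with h | h
    · linarith
    · exact h
  have zB : B = 0 := by
    have : l * B = 0 := by linarith
    rcases mul_eq_zero.1 this with h | h
    · linarith
    · exact h
  have zC : C = 0 := by
    have : m * C = 0 := by linarith
    rcases mul_eq_zero.1 this with h | h
    · linarith
    · exact h
  constructor
  · apply mul_right_cancel₀ hΔ
    rw [hΔd]; linear_combination (Z2 - X2) * zB - (Z2 - X2) * zA - (Y2 - X2) * zC + (Y2 - X2) * zA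
  · apply mul_right_cancel₀ hΔ
    rw [hΔd]; linear_combination (Y1 - X1) * zC - (Y1 - X1) * zA - (Z1 - X1) * zB + (Z1 - X1) * zA

theorem localization {n : ℕ} {Ω : Set (Euc (n+1))} (hΩ : IsConvexDomain Ω) {u Ψ : Euc (n+1) → ℝ}
    (hu : IntegrableOn u Ω) (hΨ : IntegrableOn Ψ Ω) (h0 : ∫ x in Ω, u x = 0)
    (hneg : ∫ x in Ω, Ψ x < 0) :
    ∃ e x0 : Euc (n+1), ‖e‖ = 1 ∧ x0 ∈ closure Ω ∧ ∀ ε > 0, ∃ K, IsConvexDomain K ∧ K ⊆ Ω ∧ ∫ x in K, u x = 0 ∧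
      ∫ x in K, Ψ x < 0 ∧ ∀ x ∈ K, ‖x - (x0 + (inner ℝ e (x - x0) : ℝ) • e)‖ < ε := by
  obtain ⟨σ, hσ⟩ := exists_surjective_nat (Fin (n+1) × Fin (n+1) × ℚ × ℚ)
  obtain ⟨K, hK, hKs, hKc⟩ := cut_sequence hΩ hu hΨ h0 hneg σ
  have hanti : Antitone K := antitone_nat_of_succ_le hKs
  have hVc : ∀ i, IsCompact (closure (K i)) := fun i => (hK i).1.2.2.1.isCompact_closure
  have hCne : (⋂ i, closure (K i)).Nonempty :=
    IsCompact.nonempty_iInter_of_sequence_nonempty_isCompact_isClosed _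
      (fun i => closure_mono (hKs i)) (fun i => (hK i).1.1.closure) (hVc 0) fun i => isClosed_closure
  have hminor : ∀ x ∈ ⋂ i, closure (K i), ∀ y ∈ ⋂ i, closure (K i), ∀ z ∈ ⋂ i, closure (K i),
      ∀ a b : Fin (n+1), (y a - x a) * (z b - x b) - (y b - x b) * (z a - x a) = 0 := by
    intro x hx y hy z hz a b
    by_cases hab : a = b
    · subst hab; ring
    by_contra hne
    obtain ⟨s, t, hst⟩ := tri_rat hne
    obtain ⟨i, hi⟩ := hσ (a, b, s, t)
    have hc := hKc i
    rw [hi] at hc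
    obtain ⟨c1, c2, hc0, hcut⟩ := hc hab
    have hcl : ∀ w ∈ ⋂ i, closure (K i), 0 ≤ cutf a b s t c1 c2 w := by
      intro w hw
      have hw' := Set.mem_iInter.1 hw (i+1)
      have hclosed : IsClosed {w | 0 ≤ cutf a b s t c1 c2 w} :=
        isClosed_le continuous_const (cutf_cont _ _ _ _ _ _)
      exact closure_minimal (fun w hw => (hcut w hw).le) hclosed hw'
    obtain ⟨e1, e2⟩ := hst c1 c2 (hcl x hx) (hcl y hy) (hcl z hz)
    apply hc0; rw [e1, e2]; norm_num
  obtain ⟨x0, hx0⟩ := hCne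
  obtain ⟨e, he, hline⟩ : ∃ e : Euc (n+1), ‖e‖ = 1 ∧ ∀ z ∈ ⋂ i, closure (K i),
      z - (x0 + (inner ℝ e (z - x0) : ℝ) • e) = 0 := by
    by_cases hall : ∀ y ∈ ⋂ i, closure (K i), y = x0
    · refine ⟨EuclideanSpace.single 0 1, by simp, fun z hz => ?_⟩
      rw [hall z hz]; simp
    · push Not at hall
      obtain ⟨y, hy, hyx⟩ := hall
      have hv : y - x0 ≠ 0 := sub_ne_zero.2 hyx
      have hnorm : 0 < ‖y - x0‖ := norm_pos_iff.2 hv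
      refine ⟨‖y - x0‖⁻¹ • (y - x0), by rw [norm_smul, norm_inv, norm_norm, inv_mul_cancel₀ hnorm.ne'],
        fun z hz => ?_⟩
      obtain ⟨a, ha⟩ : ∃ a, (y - x0) a ≠ 0 := by
        by_contra hcon; push Not at hcon
        exact hv (by ext i; simpa using hcon i)
      have hz' : z - x0 = ((z - x0) a / (y - x0) a) • (y - x0) := by
        ext b
        have := hminor x0 hx0 y hy z hz a b
        simp only [PiLp.smul_apply, PiLp.sub_apply, smul_eq_mul] at ha ⊢
        field_simp
        linarith
      set r := (z - x0) a / (y - x0) a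
      have : z - (x0 + (inner ℝ (‖y - x0‖⁻¹ • (y - x0)) (z - x0) : ℝ) • (‖y - x0‖⁻¹ • (y - x0))) =
        (z - x0) - (inner ℝ (‖y - x0‖⁻¹ • (y - x0)) (z - x0) : ℝ) • (‖y - x0‖⁻¹ • (y - x0)) := by abel
      rw [this, hz', real_inner_smul_left, real_inner_smul_right, real_inner_self_eq_norm_sq, smul_smul,
        ← sub_smul]
      have : r - ‖y - x0‖⁻¹ * (r * ‖y - x0‖ ^ 2) * ‖y - x0‖⁻¹ = 0 := by field_simp; ring
      rw [this, zero_smul]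
  refine ⟨e, x0, he, closure_mono (hK 0).2.1 (Set.mem_iInter.1 hx0 0), fun ε hε => ?_⟩
  have hU : IsOpen {x : Euc (n+1) | ‖x - (x0 + (inner ℝ e (x - x0) : ℝ) • e)‖ < ε} := by
    refine isOpen_lt ?_ continuous_const
    fun_prop
  obtain ⟨i, hi⟩ := exists_subset_nhds_of_isCompact (V := fun i => closure (K i))
    (fun i j => ⟨max i j, closure_mono (hanti (le_max_left _ _)), closure_mono (hanti (le_max_right _ _))⟩)
    hVc (U := {x : Euc (n+1) | ‖x - (x0 + (inner ℝ e (x - x0) : ℝ) • e)‖ < ε})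
    (fun x hx => hU.mem_nhds (by simp only [Set.mem_ofPred_eq]; rw [hline x hx, norm_zero]; exact hε))
  exact ⟨K i, (hK i).1, (hK i).2.1, (hK i).2.2.1, (hK i).2.2.2, fun x hx => hi (subset_closure hx)⟩

end

section
theorem cont_intOn {d : ℕ} {K : Set (Euc d)} (hb : Bornology.IsBounded K) {F : Euc d → ℝ} (hF : Continuous F) :
    IntegrableOn F K :=
  (hF.continuousOn.integrableOn_compact hb.isCompact_closure).mono_set subset_closure

theorem pw_thin {n : ℕ} (hn : 0 < n) {K : Set (Euc (n+1))} (hK : IsConvexDomain K) {u : Euc (n+1) → ℝ}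
    (hu : ContDiff ℝ 1 u) (h0 : ∫ x in K, u x = 0) {D : ℝ} (hD : ∀ x ∈ K, ∀ y ∈ K, ‖x - y‖ ≤ D)
    (hD0 : 0 < D) {e x0 : Euc (n+1)} (he : ‖e‖ = 1) {M ω : ℝ} (hω : 0 ≤ ω)
    (hM1 : ∀ x ∈ K, |u x| ≤ M ∧ |fderiv ℝ u x e| ≤ M)
    (hM2 : ∀ x ∈ K, |u (x0 + (inner ℝ e (x - x0) : ℝ) • e)| ≤ M ∧
      |fderiv ℝ u (x0 + (inner ℝ e (x - x0) : ℝ) • e) e| ≤ M)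
    (hω1 : ∀ x ∈ K, |u x - u (x0 + (inner ℝ e (x - x0) : ℝ) • e)| ≤ ω ∧
      |fderiv ℝ u x e - fderiv ℝ u (x0 + (inner ℝ e (x - x0) : ℝ) • e) e| ≤ ω) :
    (π / D) ^ 2 * ((∫ x in K, u x ^ 2) - (2 * M * ω + ω ^ 2) * ∫ x in K, (1:ℝ)) ≤
      (∫ x in K, ‖fderiv ℝ u x‖ ^ 2) + 2 * M * ω * ∫ x in K, (1:ℝ) := by
  obtain ⟨a, b, H, h, hab, him, hcon, hpos, hm, hmap⟩ := section_lemma n hn K hK e he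
  obtain ⟨hne, ho, hb, hcv⟩ := hK
  have hmeas := ho.measurableSet
  have hdc : Continuous (fderiv ℝ u) := hu.continuous_fderiv (by norm_num)
  have huc : Continuous u := hu.continuous
  let p : ℝ → Euc (n+1) := fun t => x0 + (t - inner ℝ e x0) • e
  have hpc : Continuous p := by simp only [p]; fun_prop
  have hp : ∀ x, p (inner ℝ e x) = x0 + (inner ℝ e (x - x0) : ℝ) • e := fun x => by
    simp only [p, inner_sub_right]
  have hpd : ∀ t, HasDerivAt p e t := fun t => by
    have := (((hasDerivAt_id t).sub_const (inner ℝ e x0)).smul_const e).const_add x0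
    refine this.congr_deriv ?_
    simp
  let f : ℝ → ℝ := fun t => u (p t)
  let f1 : ℝ → ℝ := fun t => fderiv ℝ u (p t) e
  have hf : ∀ t, HasDerivAt f (f1 t) t := fun t =>
    ((hu.differentiable (by norm_num)) (p t)).hasFDerivAt.comp_hasDerivAt t (hpd t)
  have hf1 : Continuous f1 := (hdc.comp hpc).clm_apply continuous_const
  have fc : Continuous f := huc.comp hpc
  have hint : ∀ F : ℝ → ℝ, Continuous F → ∫ x in K, F (inner ℝ e x) = ∫ t in a..b, F t * h t ^ n :=
    fun F hF => integral_of_map_eq hab (fun t ht => (hpos t ht).1) hm hmap F hF.measurable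
  have key := pw_one hab n hcon hpos hf hf1
  rw [← hint (fun t => f t ^ 2) (by fun_prop), ← hint (fun _ => 1) (by fun_prop), ← hint f fc,
    ← hint (fun t => f1 t ^ 2) (by fun_prop)] at key
  have ic : ∀ F : Euc (n+1) → ℝ, Continuous F → IntegrableOn F K := fun F hF => cont_intOn hb hF
  have hV : 0 < ∫ x in K, (1:ℝ) := by
    simp only [integral_const, MeasurableSet.univ, measureReal_restrict_apply, Set.univ_inter, smul_eq_mul, mul_one]
    exact ENNReal.toReal_pos (ho.measure_pos volume hne).ne' hb.measure_lt_top.ne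
  set V := ∫ x in K, (1:ℝ) with hVd
  have hba : b - a ≤ D := by
    by_contra hcon
    push Not at hcon
    set η := (b - a - D) / 3 with hη
    have hη0 : 0 < η := by rw [hη]; linarith
    have m1 : a + η ∈ Set.Ioo a b := ⟨by linarith, by linarith⟩
    have m2 : b - η ∈ Set.Ioo a b := ⟨by linarith, by linarith⟩
    rw [← him] at m1 m2
    obtain ⟨x, hx, hx'⟩ := m1
    obtain ⟨y, hy, hy'⟩ := m2
    have h1 := hD y hy x hx
    have h2 := real_inner_le_norm e (y - x)
    simp only at hx' hy'
    rw [he, one_mul, inner_sub_right, hx', hy'] at h2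
    linarith
  set F2 := ∫ x in K, f (inner ℝ e x) ^ 2 with hF2
  set F1 := ∫ x in K, f (inner ℝ e x) with hF1
  set G2 := ∫ x in K, f1 (inner ℝ e x) ^ 2 with hG2
  have hG0 : 0 ≤ G2 := integral_nonneg fun x => sq_nonneg _
  have hk : (π / D) ^ 2 ≤ (π / (b - a)) ^ 2 := by
    have : 0 < b - a := by linarith
    have := pi_pos
    gcongr
  have key2 : (π / D) ^ 2 * (F2 * V - F1 ^ 2) ≤ G2 * V := by
    rcases le_total 0 (F2 * V - F1 ^ 2) with hX | hX
    · exact (mul_le_mul_of_nonneg_right hk hX).trans key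
    · exact (mul_nonpos_of_nonneg_of_nonpos (sq_nonneg _) hX).trans (mul_nonneg hG0 hV.le)
  have iE : Continuous fun x : Euc (n+1) => (inner ℝ e x : ℝ) := by fun_prop
  have hF1b : |F1| ≤ ω * V := by
    have e1 : F1 = ∫ x in K, (f (inner ℝ e x) - u x) := by
      rw [integral_sub (f := fun x => f (inner ℝ e x)) (ic _ (fc.comp iE)) (ic _ huc), h0, sub_zero]
    rw [e1, hVd, ← integral_const_mul, ← Real.norm_eq_abs]
    refine (norm_integral_le_of_norm_le (g := fun _ => ω * 1) (ic _ continuous_const) ?_)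
    filter_upwards [ae_restrict_mem hmeas] with x hx
    have := (hω1 x hx).1
    rw [Real.norm_eq_abs, abs_sub_comm]
    simp only [f, hp]; linarith
  have hF1s : F1 ^ 2 ≤ ω ^ 2 * V * V := by
    have := pow_le_pow_left₀ (abs_nonneg _) hF1b 2
    rw [sq_abs] at this
    nlinarith
  have hsq : ∀ x y : ℝ, |x| ≤ M → |y| ≤ M → |x - y| ≤ ω → x ^ 2 ≤ y ^ 2 + 2 * M * ω := by
    intro x y hx hy hxy
    have h1 : |x + y| ≤ 2 * M := (abs_add_le _ _).trans (by linarith)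
    have h2 : (x - y) * (x + y) ≤ ω * (2 * M) := by
      refine (le_abs_self _).trans ?_
      rw [abs_mul]
      exact mul_le_mul hxy h1 (abs_nonneg _) hω
    nlinarith
  have c1 : ∫ x in K, u x ^ 2 ≤ F2 + 2 * M * ω * V := by
    rw [hF2, hVd, ← integral_const_mul, ← integral_add (ic _ (by fun_prop)) (ic _ (by fun_prop))]
    refine setIntegral_mono_on (ic _ (by fun_prop)) (ic _ (by fun_prop)) hmeas fun x hx => ?_
    have := hsq _ _ (hM1 x hx).1 (hM2 x hx).1 (hω1 x hx).1
    simp only [f, hp]; linarith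
  have c2 : G2 ≤ (∫ x in K, ‖fderiv ℝ u x‖ ^ 2) + 2 * M * ω * V := by
    rw [hG2, hVd, ← integral_const_mul, ← integral_add (ic _ (by fun_prop)) (ic _ (by fun_prop))]
    refine setIntegral_mono_on (ic _ (by fun_prop)) (ic _ (by fun_prop)) hmeas fun x hx => ?_
    have h1 := hsq _ _ (hM2 x hx).2 (hM1 x hx).2 (by rw [abs_sub_comm]; exact (hω1 x hx).2)
    have h2 : (fderiv ℝ u x e) ^ 2 ≤ ‖fderiv ℝ u x‖ ^ 2 := by
      rw [← sq_abs]
      refine pow_le_pow_left₀ (abs_nonneg _) ?_ 2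
      have := (fderiv ℝ u x).le_opNorm e
      rwa [he, mul_one] at this
    simp only [f1, hp]; linarith
  have key3 : (π / D) ^ 2 * (F2 - ω ^ 2 * V) ≤ G2 := by
    refine le_of_mul_le_mul_right ?_ hV
    refine le_trans ?_ key2
    rw [mul_assoc]
    refine mul_le_mul_of_nonneg_left ?_ (sq_nonneg _)
    linarith
  refine le_trans ?_ (key3.trans c2)
  refine mul_le_mul_of_nonneg_left ?_ (sq_nonneg _)
  linarith

theorem payne_weinberger {n : ℕ} (hn : 0 < n) {Ω : Set (Euc (n+1))} (hΩ : IsConvexDomain Ω)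
    {u : Euc (n+1) → ℝ} (hu : ContDiff ℝ 1 u) (h0 : ∫ x in Ω, u x = 0) {D : ℝ}
    (hD : ∀ x ∈ Ω, ∀ y ∈ Ω, ‖x - y‖ ≤ D) (hD0 : 0 < D) :
    (π / D) ^ 2 * (∫ x in Ω, u x ^ 2) ≤ ∫ x in Ω, ‖fderiv ℝ u x‖ ^ 2 := by
  by_contra hcon
  push Not at hcon
  have hdc : Continuous (fderiv ℝ u) := hu.continuous_fderiv (by norm_num)
  have huc : Continuous u := hu.continuous
  have hb := hΩ.2.2.1
  have ic : ∀ K, K ⊆ Ω → ∀ F : Euc (n+1) → ℝ, Continuous F → IntegrableOn F K := fun K hK F hF =>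
    cont_intOn (hb.subset hK) hF
  set k := (π / D) ^ 2 with hk
  have hk0 : 0 ≤ k := sq_nonneg _
  set I := (∫ x in Ω, ‖fderiv ℝ u x‖ ^ 2) - k * ∫ x in Ω, u x ^ 2 with hI
  have hI0 : I < 0 := by linarith
  have hV0 : 0 ≤ ∫ x in Ω, (1:ℝ) := integral_nonneg fun _ => zero_le_one
  set V0 := ∫ x in Ω, (1:ℝ) with hV0d
  set δ := -I / (2 * (V0 + 1)) with hδ
  have hδ0 : 0 < δ := by rw [hδ]; apply div_pos <;> linarith
  let Ψ : Euc (n+1) → ℝ := fun x => ‖fderiv ℝ u x‖ ^ 2 - k * u x ^ 2 + δ * 1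
  have hΨc : Continuous Ψ := by simp only [Ψ]; fun_prop
  have hΨi : ∀ K, K ⊆ Ω → ∫ x in K, Ψ x = (∫ x in K, ‖fderiv ℝ u x‖ ^ 2) - k * (∫ x in K, u x ^ 2) +
      δ * ∫ x in K, (1:ℝ) := by
    intro K hK
    simp only [Ψ]
    rw [integral_add (ic K hK _ (by fun_prop)) (ic K hK _ (by fun_prop)),
      integral_sub (ic K hK _ (by fun_prop)) (ic K hK _ (by fun_prop)), integral_const_mul, integral_const_mul]
  have hneg : ∫ x in Ω, Ψ x < 0 := by
    rw [hΨi Ω subset_rfl, ← hI, ← hV0d]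
    have : δ * (2 * (V0 + 1)) = -I := by rw [hδ]; field_simp
    nlinarith
  obtain ⟨e, x0, he, hx0, hloc⟩ := localization hΩ (ic Ω subset_rfl u huc) (ic Ω subset_rfl Ψ hΨc) h0 hneg
  have hxD : ∀ x ∈ Ω, ‖x - x0‖ ≤ D := by
    intro x hx
    have hcl : IsClosed {y : Euc (n+1) | ‖x - y‖ ≤ D} := isClosed_le (by fun_prop) continuous_const
    exact closure_minimal (fun y hy => hD x hx y hy) hcl hx0
  let B := Metric.closedBall x0 D
  have hBc : IsCompact B := isCompact_closedBall _ _
  have hxB : ∀ x ∈ Ω, x ∈ B := fun x hx => by rw [Metric.mem_closedBall, dist_eq_norm]; exact hxD x hx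
  have hyB : ∀ x ∈ Ω, x0 + (inner ℝ e (x - x0) : ℝ) • e ∈ B := fun x hx => by
    rw [Metric.mem_closedBall, dist_eq_norm, add_sub_cancel_left, norm_smul, he, mul_one]
    refine (norm_inner_le_norm e (x - x0)).trans ?_
    rw [he, one_mul]; exact hxD x hx
  have hec : Continuous fun x => fderiv ℝ u x e := hdc.clm_apply continuous_const
  obtain ⟨M1, hM1⟩ := hBc.exists_bound_of_continuousOn huc.continuousOn
  obtain ⟨M2, hM2⟩ := hBc.exists_bound_of_continuousOn hec.continuousOn
  set M := max (max M1 M2) 0 with hM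
  have hM0 : 0 ≤ M := le_max_right _ _
  have bM1 : ∀ x ∈ B, |u x| ≤ M ∧ |fderiv ℝ u x e| ≤ M := fun x hx =>
    ⟨(hM1 x hx).trans ((le_max_left _ _).trans (le_max_left _ _)),
     (hM2 x hx).trans ((le_max_right _ _).trans (le_max_left _ _))⟩
  set Q := 2 * M + k * (2 * M + 1) + 1 with hQ
  have hQ0 : 0 < Q := by positivity
  set ω := min 1 (δ / Q) with hω
  have hω0 : 0 < ω := lt_min one_pos (div_pos hδ0 hQ0)
  have hω1 : ω ≤ 1 := min_le_left _ _
  have hωQ : ω * Q ≤ δ := by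
    have := min_le_right 1 (δ / Q)
    rw [← hω, le_div_iff₀ hQ0] at this; exact this
  have uc1 := Metric.uniformContinuousOn_iff.1 (hBc.uniformContinuousOn_of_continuous huc.continuousOn) ω hω0
  have uc2 := Metric.uniformContinuousOn_iff.1 (hBc.uniformContinuousOn_of_continuous hec.continuousOn) ω hω0
  obtain ⟨ε1, hε1, uc1⟩ := uc1
  obtain ⟨ε2, hε2, uc2⟩ := uc2
  obtain ⟨K, hK, hKΩ, hK0, hKn, hKt⟩ := hloc (min ε1 ε2) (lt_min hε1 hε2)
  have key := pw_thin hn hK hu hK0 (fun x hx y hy => hD x (hKΩ hx) y (hKΩ hy)) hD0 he (M := M)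
    hω0.le (fun x hx => bM1 x (hxB x (hKΩ hx))) (fun x hx => bM1 _ (hyB x (hKΩ hx)))
    (fun x hx => ⟨by
      have := uc1 x (hxB x (hKΩ hx)) _ (hyB x (hKΩ hx)) (by
        rw [dist_eq_norm]; exact (hKt x hx).trans_le (min_le_left _ _))
      exact le_of_lt this, by
      have := uc2 x (hxB x (hKΩ hx)) _ (hyB x (hKΩ hx)) (by
        rw [dist_eq_norm]; exact (hKt x hx).trans_le (min_le_right _ _))
      exact le_of_lt this⟩)
  rw [hΨi K hKΩ] at hKn
  have hVK : 0 ≤ ∫ x in K, (1:ℝ) := integral_nonneg fun _ => zero_le_one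
  rw [← hk] at key
  set V := ∫ x in K, (1:ℝ)
  have hfin : 2 * M * ω + k * (2 * M * ω + ω ^ 2) ≤ δ := by
    refine le_trans ?_ hωQ
    rw [hQ]
    have : ω ^ 2 ≤ ω := by nlinarith
    have := mul_le_mul_of_nonneg_left this hk0
    nlinarith
  have := mul_le_mul_of_nonneg_right hfin hVK
  nlinarith

end

section
theorem int_sq_pos {d : ℕ} {Ω : Set (Euc d)} (hΩ : IsConvexDomain Ω) {u : Euc d → ℝ} (hu : Continuous u)
    {x : Euc d} (hx : x ∈ Ω) (hux : u x ≠ 0) : 0 < ∫ x in Ω, u x ^ 2 := by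
  obtain ⟨hne, ho, hb, hcv⟩ := hΩ
  rw [setIntegral_pos_iff_support_of_nonneg_ae (Eventually.of_forall fun x => sq_nonneg _)
    (cont_intOn hb (by fun_prop))]
  have h1 : IsOpen (Function.support (fun x => u x ^ 2) ∩ Ω) :=
    (Continuous.isOpen_support (by fun_prop)).inter ho
  exact h1.measure_pos volume ⟨x, by simpa using hux, hx⟩

theorem rayleigh_congr {d : ℕ} {Ω : Set (Euc d)} (ho : IsOpen Ω) {u v : Euc d → ℝ} (h : Set.EqOn u v Ω) :
    rayleigh Ω u = rayleigh Ω v := by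
  unfold rayleigh
  congr 1
  · refine setIntegral_congr_fun ho.measurableSet fun x hx => ?_
    have : u =ᶠ[nhds x] v := h.eventuallyEq_of_mem (ho.mem_nhds hx)
    simp only [this.fderiv_eq]
  · refine setIntegral_congr_fun ho.measurableSet fun x hx => ?_
    simp only [h hx]

theorem cont_param {d : ℕ} {Ω : Set (Euc d)} (hb : Bornology.IsBounded Ω)
    {F : (Fin 3 → ℝ) → Euc d → ℝ} (hF : Continuous F.uncurry) :
    Continuous fun c => ∫ x in Ω, F c x := by
  have : IsFiniteMeasure (volume.restrict Ω) := ⟨by simpa using hb.measure_lt_top⟩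
  have h := continuous_parametric_integral_of_continuous (μ := volume.restrict Ω) hF hb.isCompact_closure
  rw [Measure.restrict_restrict isClosed_closure.measurableSet,
    Set.inter_eq_right.2 subset_closure] at h
  exact h

theorem rayleigh_bdd {d : ℕ} {Ω : Set (Euc d)} (hΩ : IsConvexDomain Ω) (u : Fin 3 → Euc d → ℝ)
    (hu : ∀ i, ContDiff ℝ 1 (u i))
    (hli : ∀ c : Fin 3 → ℝ, (∀ x ∈ Ω, ∑ i, c i * u i x = 0) → c = 0) :
    ∃ C : ℝ, ∀ c : Fin 3 → ℝ, rayleigh Ω (fun x => ∑ i, c i * u i x) ≤ C := by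
  obtain ⟨hne, ho, hb, hcv⟩ := id hΩ
  have huc : ∀ i, Continuous (u i) := fun i => (hu i).continuous
  have hud : ∀ i, Continuous (fderiv ℝ (u i)) := fun i => (hu i).continuous_fderiv (by norm_num)
  let N : (Fin 3 → ℝ) → ℝ := fun c => ∫ x in Ω, (∑ i, c i * u i x) ^ 2
  let G : (Fin 3 → ℝ) → ℝ := fun c => ∫ x in Ω, ‖∑ i, c i • fderiv ℝ (u i) x‖ ^ 2
  have hN : Continuous N := by
    refine cont_param hb ?_
    simp only [Function.uncurry_def]
    fun_prop
  have hG : Continuous G := by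
    refine cont_param hb ?_
    simp only [Function.uncurry_def]
    fun_prop
  have hNp : ∀ c, c ≠ 0 → 0 < N c := by
    intro c hc
    have : ∃ x ∈ Ω, ∑ i, c i * u i x ≠ 0 := by
      by_contra hcon
      push Not at hcon
      exact hc (hli c hcon)
    obtain ⟨x, hx, hx'⟩ := this
    exact int_sq_pos hΩ (u := fun x => ∑ i, c i * u i x) (by fun_prop) hx hx'
  have hR : ∀ c, rayleigh Ω (fun x => ∑ i, c i * u i x) = G c / N c := by
    intro c
    unfold rayleigh
    congr 1
    refine integral_congr_ae (Eventually.of_forall fun x => ?_)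
    have : HasFDerivAt (fun x => ∑ i, c i * u i x) (∑ i, c i • fderiv ℝ (u i) x) x := by
      refine HasFDerivAt.fun_sum fun i _ => ?_
      exact (((hu i).differentiable (by norm_num)) x).hasFDerivAt.const_mul (c i)
    simp only [this.fderiv]
  have hcR : ContinuousOn (fun c => G c / N c) (Metric.sphere 0 1) := by
    refine hG.continuousOn.div hN.continuousOn fun c hc => (hNp c ?_).ne'
    rintro rfl
    simp at hc
  obtain ⟨C, hC⟩ := (isCompact_sphere (0 : Fin 3 → ℝ) 1).bddAbove_image hcR
  refine ⟨max C 0, fun c => ?_⟩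
  rw [hR]
  by_cases hc : c = 0
  · subst hc
    simp [N]
  refine le_trans ?_ (le_max_left _ _)
  have hnc : 0 < ‖c‖ := norm_pos_iff.2 hc
  have hs : ∀ t : ℝ, N (t • c) = t ^ 2 * N c := by
    intro t
    simp only [N]
    rw [← integral_const_mul]
    congr 1; ext x
    rw [← mul_pow, Finset.mul_sum]
    simp [mul_assoc]
  have hs' : ∀ t : ℝ, G (t • c) = t ^ 2 * G c := by
    intro t
    simp only [G]
    rw [← integral_const_mul]
    congr 1; ext x
    have : ∑ i, (t • c) i • fderiv ℝ (u i) x = t • ∑ i, c i • fderiv ℝ (u i) x := by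
      rw [Finset.smul_sum]; simp [smul_smul]
    rw [this, norm_smul, mul_pow, Real.norm_eq_abs, sq_abs]
  have h := hC ⟨‖c‖⁻¹ • c, by simp [norm_smul, hnc.ne'], rfl⟩
  simp only [hs, hs'] at h
  rwa [mul_div_mul_left _ _ (by positivity)] at h

theorem two_points {n : ℕ} {Ω : Set (Euc (n+1))} (hΩ : IsConvexDomain Ω) :
    ∃ p ∈ Ω, ∃ q ∈ Ω, p ≠ q := by
  obtain ⟨⟨p, hp⟩, ho, hb, hcv⟩ := hΩ
  obtain ⟨q, hq, hqp⟩ := (infinite_of_mem_nhds p (ho.mem_nhds hp)).nontrivial.exists_ne p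
  exact ⟨p, hp, q, hq, hqp.symm⟩

theorem pw_lower {n : ℕ} (hn : 2 ≤ n) {Ω : Set (Euc (n+1))} (hΩ : IsConvexDomain Ω) {D : ℝ}
    (hD : ∀ x ∈ Ω, ∀ y ∈ Ω, ‖x - y‖ ≤ D) (hD0 : 0 < D) :
    (π / D) ^ 2 ≤ neumannEigenvalue 2 Ω := by
  obtain ⟨p, hp, q, hq, hpq⟩ := two_points hΩ
  obtain ⟨V0, h1, h2, -⟩ := kroger_aux hn Ω hΩ hp hq hpq (η := 1/2) (by norm_num) (by norm_num)
  obtain ⟨hne, ho, hb, hcv⟩ := id hΩ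
  refine le_csInf ⟨_, V0, h1, h2, rfl⟩ ?_
  rintro t ⟨V, hV, hfr, rfl⟩
  set W := V.map (LinearMap.funLeft ℝ ℝ ((↑) : Ω → Euc (n+1))) with hW
  have : Module.Finite ℝ W := Module.finite_of_finrank_pos (by rw [hfr]; norm_num)
  let B : Module.Basis (Fin 3) ℝ W := Module.finBasisOfFinrankEq ℝ W hfr
  have hex : ∀ i, ∃ w ∈ V, LinearMap.funLeft ℝ ℝ ((↑) : Ω → Euc (n+1)) w = (B i : Ω → ℝ) := fun i =>
    Submodule.mem_map.1 (B i).2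
  choose u huV huB using hex
  have hu : ∀ i, ContDiff ℝ 1 (u i) := fun i => (hV _ (huV i)).of_le (by exact_mod_cast le_top)
  have hval : ∀ i (x : Ω), u i x = (B i : Ω → ℝ) x := fun i x => by
    rw [← huB i]; rfl
  have hsum : ∀ (c : Fin 3 → ℝ) (x : Ω), ((∑ i, c i • B i : W) : Ω → ℝ) x = ∑ i, c i * u i x := by
    intro c x
    simp [hval, Finset.sum_apply]
  have hli : ∀ c : Fin 3 → ℝ, (∀ x ∈ Ω, ∑ i, c i * u i x = 0) → c = 0 := by
    intro c hc
    have h0 : (∑ i, c i • B i : W) = 0 := by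
      apply Subtype.ext
      funext x
      rw [hsum]
      exact hc x x.2
    funext i
    exact Fintype.linearIndependent_iff.1 B.linearIndependent c h0 i
  obtain ⟨C, hC⟩ := rayleigh_bdd hΩ u hu hli
  have hbdd : BddAbove { r : ℝ | ∃ u ∈ V, (0 < ∫ x in Ω, (u x) ^ 2) ∧ r = rayleigh Ω u } := by
    refine ⟨C, ?_⟩
    rintro r ⟨w, hw, -, rfl⟩
    let w' : W := ⟨_, Submodule.mem_map_of_mem (f := LinearMap.funLeft ℝ ℝ ((↑) : Ω → Euc (n+1))) hw⟩
    have heq : Set.EqOn w (fun x => ∑ i, B.repr w' i * u i x) Ω := by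
      intro x hx
      have := hsum (fun i => B.repr w' i) ⟨x, hx⟩
      rw [B.sum_repr] at this
      exact this
    rw [rayleigh_congr ho heq]
    exact hC _
  let a : Fin 3 → ℝ := fun i => ∫ x in Ω, u i x
  obtain ⟨c, hc, hca⟩ : ∃ c : Fin 3 → ℝ, c ≠ 0 ∧ ∑ i, c i * a i = 0 := by
    by_cases h : a 0 = 0
    · exact ⟨![1, 0, 0], fun h => by simpa using congrFun h 0, by simp [Fin.sum_univ_three, h]⟩
    · exact ⟨![a 1, - a 0, 0], fun h' => h (by simpa using congrFun h' 1),
        by simp [Fin.sum_univ_three]; ring⟩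
  let v : Euc (n+1) → ℝ := fun x => ∑ i, c i * u i x
  have hvV : v ∈ V := by
    have : v = ∑ i, c i • u i := by ext x; simp [v]
    rw [this]
    exact V.sum_mem fun i _ => V.smul_mem _ (huV i)
  have hv : ContDiff ℝ 1 v := (hV _ hvV).of_le (by exact_mod_cast le_top)
  have hv0 : ∫ x in Ω, v x = 0 := by
    rw [← hca, integral_finsetSum]
    · simp only [integral_const_mul, a]
    · intro i _
      exact cont_intOn hb ((hu i).continuous.const_mul _)
  have hpos : 0 < ∫ x in Ω, v x ^ 2 := by
    have : ∃ x ∈ Ω, v x ≠ 0 := by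
      by_contra hcon
      push Not at hcon
      exact hc (hli c hcon)
    obtain ⟨x, hx, hx'⟩ := this
    exact int_sq_pos hΩ hv.continuous hx hx'
  refine le_trans ?_ (le_csSup hbdd ⟨v, hvV, hpos, rfl⟩)
  unfold rayleigh
  rw [le_div_iff₀ hpos]
  exact payne_weinberger (by omega) hΩ hv hv0 hD hD0

theorem main_succ {n : ℕ} (hn : 2 ≤ n) {Ω₁ Ω₂ : Set (Euc (n+1))}
    (h₁ : IsConvexDomain Ω₁) (h₂ : IsConvexDomain Ω₂) (hsub : Ω₁ ⊆ Ω₂) :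
    0 < neumannEigenvalue 2 Ω₁ ∧ Real.pi ^ 2 /
          (besselZero1 (((n : ℝ) - 1) / 2) + besselZero2 (((n : ℝ) - 1) / 2)) ^ 2 *
        neumannEigenvalue 2 Ω₂ ≤ neumannEigenvalue 2 Ω₁ := by
  obtain ⟨Φ, qq, v, v1, B⟩ := bessel_pack hn
  have hj1 := B.j1_pos
  have hj12 := B.j12
  have hK := fun p q (hp : p ∈ Ω₁) (hq : q ∈ Ω₁) hpq =>
    kroger hn Ω₂ h₂ (p := p) (q := q) (hsub hp) (hsub hq) hpq
  set J := besselZero1 (((n : ℝ) - 1) / 2) + besselZero2 (((n : ℝ) - 1) / 2) with hJ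
  have hJ0 : 0 < J := by linarith
  obtain ⟨p0, hp0, q0, hq0, hpq0⟩ := two_points h₁
  set D := Metric.diam Ω₁ with hDd
  have hb := h₁.2.2.1
  have hD : ∀ x ∈ Ω₁, ∀ y ∈ Ω₁, ‖x - y‖ ≤ D := fun x hx y hy => by
    rw [← dist_eq_norm]; exact Metric.dist_le_diam_of_mem hb hx hy
  have hD0 : 0 < D := lt_of_lt_of_le (norm_pos_iff.2 (sub_ne_zero.2 hpq0)) (hD _ hp0 _ hq0)
  have hlow := pw_lower hn h₁ hD hD0
  have hpos2 : 0 < neumannEigenvalue 2 Ω₂ := by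
    have hD' : ∀ x ∈ Ω₂, ∀ y ∈ Ω₂, ‖x - y‖ ≤ Metric.diam Ω₂ := fun x hx y hy => by
      rw [← dist_eq_norm]; exact Metric.dist_le_diam_of_mem h₂.2.2.1 hx hy
    have h0 : 0 < Metric.diam Ω₂ := lt_of_lt_of_le (norm_pos_iff.2 (sub_ne_zero.2 hpq0))
      (hD' _ (hsub hp0) _ (hsub hq0))
    exact lt_of_lt_of_le (by positivity) (pw_lower hn h₂ hD' h0)
  refine ⟨lt_of_lt_of_le (by positivity) hlow, ?_⟩
  set s := √(neumannEigenvalue 2 Ω₂) with hs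
  have hs0 : 0 < s := Real.sqrt_pos.2 hpos2
  have hss : s ^ 2 = neumannEigenvalue 2 Ω₂ := Real.sq_sqrt hpos2.le
  have hDs : D ≤ J / s := by
    refine Metric.diam_le_of_forall_dist_le (by positivity) fun x hx y hy => ?_
    rw [dist_comm, dist_eq_norm]
    by_cases hxy : x = y
    · subst hxy; simp; positivity
    have hnx : 0 < ‖y - x‖ := norm_pos_iff.2 (sub_ne_zero.2 (Ne.symm hxy))
    have := hK x y hx hy hxy
    rw [← hss] at this
    have := (pow_le_pow_iff_left₀ hs0.le (by positivity) (by norm_num)).1 this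
    rw [le_div_iff₀ hs0, mul_comm]
    rwa [le_div_iff₀ hnx] at this
  refine le_trans ?_ hlow
  rw [← hss, div_pow, div_mul_eq_mul_div, div_le_div_iff₀ (by positivity) (by positivity)]
  rw [le_div_iff₀ hs0] at hDs
  have := pow_le_pow_left₀ (by positivity) hDs 2
  have := mul_le_mul_of_nonneg_left this (sq_nonneg π)
  nlinarith

theorem main_thm 
    (d : ℕ) (hd : 3 ≤ d) (Ω₁ Ω₂ : Set (Euc d))
    (h₁ : IsConvexDomain Ω₁) (h₂ : IsConvexDomain Ω₂) (hsub : Ω₁ ⊆ Ω₂) :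
    neumannEigenvalue 2 Ω₁ ≥
      Real.pi ^ 2 /
          (besselZero1 (((d : ℝ) - 2) / 2) + besselZero2 (((d : ℝ) - 2) / 2)) ^ 2 *
        neumannEigenvalue 2 Ω₂ ∧
    alphaConst 2 d ≥
      Real.pi ^ 2 /
        (besselZero1 (((d : ℝ) - 2) / 2) + besselZero2 (((d : ℝ) - 2) / 2)) ^ 2 := by
  obtain ⟨n, rfl⟩ : ∃ n, d = n + 1 := ⟨d - 1, by omega⟩
  have hn : 2 ≤ n := by omega
  have hc : (((n + 1 : ℕ) : ℝ) - 2) / 2 = ((n : ℝ) - 1) / 2 := by push_cast; ring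
  rw [hc]
  refine ⟨(main_succ hn h₁ h₂ hsub).2, ?_⟩
  refine le_csInf ⟨_, Ω₁, Ω₂, h₁, h₂, hsub, rfl⟩ ?_
  rintro r ⟨A, B, hA, hB, hAB, rfl⟩
  rw [le_div_iff₀ (main_succ hn hB hB subset_rfl).1]
  exact (main_succ hn hA hB hAB).2

end

/-- for `d ≥ 3`,
`μ₂(Ω₁) ≥ (π²/(j_{(d-2)/2,1} + j_{(d-2)/2,2})²) μ₂(Ω₂)` for nested bounded convex domains;
in particular `α_{2,d} ≥ π²/(j_{(d-2)/2,1} + j_{(d-2)/2,2})²`. -/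
theorem lower_bound_second_eigenvalue
    (d : ℕ) (hd : 3 ≤ d) (Ω₁ Ω₂ : Set (Euc d))
    (h₁ : IsConvexDomain Ω₁) (h₂ : IsConvexDomain Ω₂) (hsub : Ω₁ ⊆ Ω₂) :
    neumannEigenvalue 2 Ω₁ ≥
      Real.pi ^ 2 /
          (besselZero1 (((d : ℝ) - 2) / 2) + besselZero2 (((d : ℝ) - 2) / 2)) ^ 2 *
        neumannEigenvalue 2 Ω₂ ∧
    alphaConst 2 d ≥
      Real.pi ^ 2 /
        (besselZero1 (((d : ℝ) - 2) / 2) + besselZero2 (((d : ℝ) - 2) / 2)) ^ 2 := by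
  exact main_thm d hd Ω₁ Ω₂ h₁ h₂ hsub

end
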